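/- Let u be a Lipschitz solution of either the thin obstacle problem in B₁ or the boundary (Signorini) obstacle problem in B₁⁺, with F, F₀ satisfying (H0) and (H1), and let z₀ ∈ Γ(u). If z_k ∈ Γ(u) with z_k → z₀, and t_k with 0 < t_k < 1 − |z_k| and t_k → 0, then the rescalings u_k(x) := u(z_k + t_k x)/t_k converge uniformly (on B₁, respectively B₁⁺) to the linear function ∂_{n+1}u(z₀)·x_{n+1}, where ∂_{n+1}u(z₀) = lim_{t→0⁺} u(z₀ + t·e_{n+1})/t is the normal derivative of u at z₀ (which exists). -/

import Mathlib

open MeasureTheory Metric Filter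
open scoped InnerProductSpace NNReal ENNReal Topology

noncomputable section

/-- Euclidean space `ℝ^{n+1}`. -/
abbrev Eucl (n : ℕ) : Type := EuclideanSpace ℝ (Fin (n + 1))

namespace TOP

variable {n : ℕ}

/-- The `(n+1)`-st standard basis vector `e_{n+1}`. -/
def eLast (n : ℕ) : Eucl n := EuclideanSpace.single (Fin.last n) 1

/-- Open upper half ball `B_r⁺(x₀)`. -/
def hBall (x₀ : Eucl n) (r : ℝ) : Set (Eucl n) :=
  Metric.ball x₀ r ∩ {x : Eucl n | 0 < x (Fin.last n)}

/-- Open lower half ball `B_r⁻(x₀)`. -/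
def hBallNeg (x₀ : Eucl n) (r : ℝ) : Set (Eucl n) :=
  Metric.ball x₀ r ∩ {x : Eucl n | x (Fin.last n) < 0}

/-- Thin ball `B_r'(x₀)`. -/
def tBall (x₀ : Eucl n) (r : ℝ) : Set (Eucl n) :=
  Metric.ball x₀ r ∩ {x : Eucl n | x (Fin.last n) = 0}

/-- (H0): `F` and `F₀` are of class `C¹` on `B₁ × ℝ × ℝ^{n+1}`. -/
def H0 (F : Eucl n → ℝ → Eucl n → Eucl n) (F₀ : Eucl n → ℝ → Eucl n → ℝ) : Prop :=
  ContDiffOn ℝ 1 (fun q : Eucl n × ℝ × Eucl n => F q.1 q.2.1 q.2.2)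
      (Metric.ball (0 : Eucl n) 1 ×ˢ (Set.univ : Set ℝ) ×ˢ (Set.univ : Set (Eucl n))) ∧
    ContDiffOn ℝ 1 (fun q : Eucl n × ℝ × Eucl n => F₀ q.1 q.2.1 q.2.2)
      (Metric.ball (0 : Eucl n) 1 ×ˢ (Set.univ : Set ℝ) ×ˢ (Set.univ : Set (Eucl n)))

/-- (H1): uniform ellipticity of `D_pF` on compact subsets. -/
def H1 (F : Eucl n → ℝ → Eucl n → Eucl n) : Prop :=
  ∀ M : ℝ, 0 < M → ∃ lam : ℝ, 0 < lam ∧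
    ∀ x ∈ Metric.ball (0 : Eucl n) 1, ∀ z : ℝ, |z| ≤ M → ∀ p : Eucl n, ‖p‖ ≤ M →
      ∀ ξ : Eucl n, lam * ‖ξ‖ ^ 2 ≤ ⟪fderiv ℝ (F x z) p ξ, ξ⟫_ℝ

/-- (H1) with a prescribed ellipticity function `lam : M ↦ λ(M)`. -/
def H1With (lam : ℝ → ℝ) (F : Eucl n → ℝ → Eucl n → Eucl n) : Prop :=
  ∀ M : ℝ, 0 < M → 0 < lam M ∧
    ∀ x ∈ Metric.ball (0 : Eucl n) 1, ∀ z : ℝ, |z| ≤ M → ∀ p : Eucl n, ‖p‖ ≤ M →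
      ∀ ξ : Eucl n, lam M * ‖ξ‖ ^ 2 ≤ ⟪fderiv ℝ (F x z) p ξ, ξ⟫_ℝ

/-- `div_x F (x, z, p) = ∑ᵢ ∂_{xᵢ} Fᵢ (x, z, p)`. -/
def divx (F : Eucl n → ℝ → Eucl n → Eucl n) (x : Eucl n) (z : ℝ) (p : Eucl n) : ℝ :=
  ∑ i : Fin (n + 1), fderiv ℝ (fun y : Eucl n => F y z p i) x (EuclideanSpace.single i 1)

/-- `(F, F₀)` is `t`-rescaled with bound function `L : M ↦ L(M)`. -/
def Rescaled (t : ℝ) (L : ℝ → ℝ) (F : Eucl n → ℝ → Eucl n → Eucl n)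
    (F₀ : Eucl n → ℝ → Eucl n → ℝ) : Prop :=
  ∀ M : ℝ, 0 < M → ∀ x ∈ Metric.ball (0 : Eucl n) 1, ∀ z : ℝ, |z| ≤ M →
    ∀ p : Eucl n, ‖p‖ ≤ M →
      |(- divx F x z p - ⟪deriv (fun s : ℝ => F x s p) z, p⟫_ℝ + F₀ x z p)| ≤ t * L M ∧
        ‖fderiv ℝ (F x z) p‖ ≤ L M

/-- The operator `H_t` acting classically on a `C²` function `φ`:
`H_t(φ)(x) = −div_x F − ⟨∂_z F, ∇φ⟩ − tr(D_pF · D²φ) + F₀`, all evaluated at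
`(x, φ(x), ∇φ(x))`. -/
def Hop (F : Eucl n → ℝ → Eucl n → Eucl n) (F₀ : Eucl n → ℝ → Eucl n → ℝ)
    (φ : Eucl n → ℝ) (x : Eucl n) : ℝ :=
  - divx F x (φ x) (gradient φ x)
    - ⟪deriv (fun s : ℝ => F x s (gradient φ x)) (φ x), gradient φ x⟫_ℝ
    - ∑ i : Fin (n + 1),
        ⟪fderiv ℝ (F x (φ x)) (gradient φ x)
          (fderiv ℝ (gradient φ) x (EuclideanSpace.single i 1)), EuclideanSpace.single i 1⟫_ℝ
    + F₀ x (φ x) (gradient φ x)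

/-- The admissible class `A_g` for the thin obstacle problem: `W^{1,∞}(B₁)` functions
with boundary value `g` on `∂B₁` which are nonnegative on `B₁'`. -/
def AdmissibleThin (g v : Eucl n → ℝ) : Prop :=
  (∃ C : ℝ≥0, LipschitzOnWith C v (Metric.closedBall (0 : Eucl n) 1)) ∧
    (∀ x ∈ Metric.sphere (0 : Eucl n) 1, v x = g x) ∧
    ∀ x ∈ tBall (0 : Eucl n) 1, 0 ≤ v x

/-- A (Lipschitz) solution of the thin obstacle problem in `B₁`. -/
def ThinSolution (F : Eucl n → ℝ → Eucl n → Eucl n) (F₀ : Eucl n → ℝ → Eucl n → ℝ)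
    (g u : Eucl n → ℝ) : Prop :=
  AdmissibleThin g u ∧
    ∀ v : Eucl n → ℝ, AdmissibleThin g v →
      0 ≤ ∫ x in Metric.ball (0 : Eucl n) 1,
        (⟪F x (u x) (gradient u x), gradient v x - gradient u x⟫_ℝ +
          F₀ x (u x) (gradient u x) * (v x - u x))

/-- The admissible class `A_g` for the boundary (Signorini) obstacle problem:
`W^{1,∞}(B₁⁺)` functions with boundary value `g` on `∂B₁⁺ ∖ B₁'` which are
nonnegative on `B₁'`. -/
def AdmissibleBdry (g v : Eucl n → ℝ) : Prop :=
  (∃ C : ℝ≥0, LipschitzOnWith C v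
      (Metric.closedBall (0 : Eucl n) 1 ∩ {x : Eucl n | 0 ≤ x (Fin.last n)})) ∧
    (∀ x : Eucl n, ‖x‖ = 1 → 0 ≤ x (Fin.last n) → v x = g x) ∧
    ∀ x ∈ tBall (0 : Eucl n) 1, 0 ≤ v x

/-- A (Lipschitz) solution of the boundary (Signorini) obstacle problem in `B₁⁺`. -/
def BdrySolution (F : Eucl n → ℝ → Eucl n → Eucl n) (F₀ : Eucl n → ℝ → Eucl n → ℝ)
    (g u : Eucl n → ℝ) : Prop :=
  AdmissibleBdry g u ∧
    ∀ v : Eucl n → ℝ, AdmissibleBdry g v →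
      0 ≤ ∫ x in hBall (0 : Eucl n) 1,
        (⟪F x (u x) (gradient u x), gradient v x - gradient u x⟫_ℝ +
          F₀ x (u x) (gradient u x) * (v x - u x))

/-- The coincidence set `Λ(u) = {x ∈ B₁' : u(x) = 0}`. -/
def coincidenceSet (u : Eucl n → ℝ) : Set (Eucl n) :=
  {x ∈ tBall (0 : Eucl n) 1 | u x = 0}

/-- The free boundary `Γ(u)`: the boundary of `Λ(u)` in the relative topology of `B₁'`. -/
def freeBoundary (u : Eucl n → ℝ) : Set (Eucl n) :=
  {x ∈ coincidenceSet u |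
    ∀ r : ℝ, 0 < r → ∃ y ∈ tBall (0 : Eucl n) 1, y ∈ Metric.ball x r ∧ 0 < u y}

/-- `w` satisfies the Caccioppoli inequality with constant `Q` at `x₀ ∈ B₁'`. -/
def CaccAt (w : Eucl n → ℝ) (Q : ℝ) (x₀ : Eucl n) : Prop :=
  ∀ k : ℝ, 0 ≤ k → ∀ r R : ℝ, 0 < r → r < R → R < 1 - ‖x₀‖ →
    (∫ x in ({x : Eucl n | k ≤ w x} ∩ hBall x₀ r), ‖gradient w x‖ ^ 2) ≤
      Q / (R - r) ^ 2 * (∫ x in ({x : Eucl n | k ≤ w x} ∩ hBall x₀ R), (w x - k) ^ 2) +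
        Q * (volume ({x : Eucl n | k ≤ w x} ∩ hBall x₀ R)).toReal

/-- Difference quotient `D_e^h w (x) = (w(x + h e) − w(x))/h`. -/
def diffQuot (h : ℝ) (e : Eucl n) (w : Eucl n → ℝ) (x : Eucl n) : ℝ :=
  (w (x + h • e) - w x) / h

/-- The barrier function `η(x) = t(|x' − x₀'|² − K x_{n+1}²) + m x_{n+1} + γ`. -/
def etaFn (x₀ : Eucl n) (t K m γ : ℝ) (x : Eucl n) : ℝ :=
  t * ((∑ i : Fin n, (x i.castSucc - x₀ i.castSucc) ^ 2) - K * (x (Fin.last n)) ^ 2) +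
    m * x (Fin.last n) + γ

end TOP

namespace TOP

variable {n : ℕ}

lemma gradient_eq_zero_of_isLocalMin {f : Eucl n → ℝ} {x : Eucl n} (h : IsLocalMin f x) :
    gradient f x = 0 := by
  simp [gradient, h.fderiv_eq_zero]

lemma gradient_sub_apply {f g : Eucl n → ℝ} {x : Eucl n} (hf : DifferentiableAt ℝ f x)
    (hg : DifferentiableAt ℝ g x) :
    gradient (fun y => f y - g y) x = gradient f x - gradient g x := by
  simp [gradient, fderiv_fun_sub hf hg]

lemma gradient_add_apply {f g : Eucl n → ℝ} {x : Eucl n} (hf : DifferentiableAt ℝ f x)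
    (hg : DifferentiableAt ℝ g x) :
    gradient (fun y => f y + g y) x = gradient f x + gradient g x := by
  simp [gradient, fderiv_fun_add hf hg]

lemma gradient_neg_apply (f : Eucl n → ℝ) (x : Eucl n) :
    gradient (fun y => -f y) x = -gradient f x := by
  simp [gradient, fderiv_fun_neg]

/-- Two differentiable functions that touch from one side have the same gradient. -/
lemma gradient_eq_of_touching {f g : Eucl n → ℝ} {x : Eucl n} (hf : DifferentiableAt ℝ f x)
    (hg : DifferentiableAt ℝ g x) (hle : ∀ᶠ y in 𝓝 x, f y ≤ g y) (heq : f x = g x) :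
    gradient f x = gradient g x := by
  have h : IsLocalMin (fun y => g y - f y) x := by
    filter_upwards [hle] with y hy
    simp only [heq, sub_self]
    linarith
  have := gradient_eq_zero_of_isLocalMin h
  rw [gradient_sub_apply hg hf] at this
  exact (sub_eq_zero.1 this).symm

lemma norm_gradient_le {f : Eucl n → ℝ} {C : ℝ≥0} (hf : LipschitzWith C f) (x : Eucl n) :
    ‖gradient f x‖ ≤ C := by
  simpa [gradient] using norm_fderiv_le_of_lipschitz ℝ hf (x₀ := x)

lemma measurable_gradient (f : Eucl n → ℝ) : Measurable (gradient f) :=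
  ((InnerProductSpace.toDual ℝ (Eucl n)).symm.continuous.measurable).comp (measurable_fderiv ℝ f)

lemma integrable_of_bounded_of_support {f : Eucl n → ℝ} (hf : AEStronglyMeasurable f volume)
    {B : ℝ} (hB : ∀ x, ‖f x‖ ≤ B) {x₁ : Eucl n} {s : ℝ}
    (hs : ∀ x, x ∉ closedBall x₁ s → f x = 0) : Integrable f := by
  have h : IntegrableOn f (closedBall x₁ s) :=
    Measure.integrableOn_of_bounded (M := B) (measure_closedBall_lt_top.ne) hf
      (Eventually.of_forall hB)
  exact (integrableOn_iff_integrable_of_support_subset (by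
    intro x hx; by_contra hx'; exact hx (hs x hx'))).1 h

lemma gradient_eq_zero_of_nonneg {ψ : Eucl n → ℝ} (hnn : ∀ x, 0 ≤ ψ x) {x : Eucl n}
    (hx : ψ x = 0) : gradient ψ x = 0 :=
  gradient_eq_zero_of_isLocalMin (Eventually.of_forall fun y => by simpa [hx] using hnn y)

lemma integrable_inner_gradient {ψ : Eucl n → ℝ} {C : ℝ≥0} (hψ : LipschitzWith C ψ)
    (hnn : ∀ x, 0 ≤ ψ x) {x₁ : Eucl n} {s : ℝ} (hs : ∀ x, x ∉ closedBall x₁ s → ψ x = 0)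
    {V : Eucl n → Eucl n} (hV : AEStronglyMeasurable V volume) {M : ℝ}
    (hM : ∀ x, ψ x ≠ 0 → ‖V x‖ ≤ M) : Integrable (fun x => ⟪V x, gradient ψ x⟫_ℝ) := by
  refine integrable_of_bounded_of_support (B := |M| * C) (x₁ := x₁) (s := s)
    (hV.inner (measurable_gradient ψ).aestronglyMeasurable) (fun x => ?_) (fun x hx => ?_)
  · by_cases hx : ψ x = 0
    · rw [gradient_eq_zero_of_nonneg hnn hx, inner_zero_right, norm_zero]
      positivity
    · refine (norm_inner_le_norm _ _).trans ?_
      exact mul_le_mul ((hM x hx).trans (le_abs_self M)) (norm_gradient_le hψ x)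
        (norm_nonneg _) (abs_nonneg M)
  · rw [gradient_eq_zero_of_nonneg hnn (hs x hx), inner_zero_right]

lemma integrable_mul_of_support {ψ : Eucl n → ℝ} {C : ℝ≥0} (hψ : LipschitzWith C ψ)
    {x₁ : Eucl n} {s : ℝ} (hs : ∀ x, x ∉ closedBall x₁ s → ψ x = 0)
    {V : Eucl n → ℝ} (hV : AEStronglyMeasurable V volume) {M : ℝ}
    (hM : ∀ x, ψ x ≠ 0 → |V x| ≤ M) : Integrable (fun x => V x * ψ x) := by
  obtain ⟨B, hB⟩ := (isCompact_closedBall x₁ s).exists_bound_of_continuousOn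
    hψ.continuous.continuousOn
  refine integrable_of_bounded_of_support (B := |M| * |B|) (x₁ := x₁) (s := s)
    (hV.mul hψ.continuous.aestronglyMeasurable) (fun x => ?_) (fun x hx => ?_)
  · by_cases hx : ψ x = 0
    · rw [hx, mul_zero, norm_zero]
      positivity
    · rw [norm_mul]
      have hxs : x ∈ closedBall x₁ s := by
        by_contra h
        exact hx (hs x h)
      exact mul_le_mul ((hM x hx).trans (le_abs_self M)) ((hB x hxs).trans (le_abs_self B))
        (norm_nonneg _) (abs_nonneg M)
  · rw [hs x hx, mul_zero]

/-- The (a.e. defined) divergence of a Lipschitz vector field. -/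
def lipDiv (G : Eucl n → Eucl n) (x : Eucl n) : ℝ :=
  ∑ i, lineDeriv ℝ (fun y => G y i) x (EuclideanSpace.single i 1)

lemma lipschitzWith_coord {C : ℝ≥0} {G : Eucl n → Eucl n} (hG : LipschitzWith C G)
    (i : Fin (n + 1)) : LipschitzWith C (fun y => G y i) := by
  refine LipschitzWith.of_dist_le_mul fun x y => ?_
  refine le_trans ?_ (hG.dist_le_mul x y)
  rw [dist_eq_norm, dist_eq_norm]
  simpa using PiLp.norm_apply_le (G x - G y) i

lemma measurable_lipDiv {C : ℝ≥0} {G : Eucl n → Eucl n} (hG : LipschitzWith C G) :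
    Measurable (lipDiv G) := by
  unfold lipDiv
  exact Finset.measurable_sum _ fun i _ =>
    measurable_lineDeriv (lipschitzWith_coord hG i).continuous

lemma exists_bound_lipDiv {C : ℝ≥0} {G : Eucl n → Eucl n} (hG : LipschitzWith C G) :
    ∃ B : ℝ, ∀ x, |lipDiv G x| ≤ B := by
  refine ⟨∑ _i : Fin (n + 1), (C : ℝ), fun x => ?_⟩
  refine (Finset.abs_sum_le_sum_abs _ _).trans (Finset.sum_le_sum fun i _ => ?_)
  simpa using norm_lineDeriv_le_of_lipschitz ℝ (lipschitzWith_coord hG i) (x₀ := x)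
    (v := EuclideanSpace.single i (1 : ℝ))

lemma inner_gradient_eq_sum {ψ : Eucl n → ℝ} {x : Eucl n} (h : DifferentiableAt ℝ ψ x)
    (v : Eucl n) :
    ⟪v, gradient ψ x⟫_ℝ = ∑ i, lineDeriv ℝ ψ x (EuclideanSpace.single i 1) * v i := by
  have hv : v = ∑ i, v i • EuclideanSpace.single i (1 : ℝ) := by
    ext j
    simp [Finset.sum_apply, Pi.single_apply]
  have h1 : ⟪v, gradient ψ x⟫_ℝ = fderiv ℝ ψ x v := by
    rw [real_inner_comm, inner_gradient_left]
  rw [h1]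
  conv_lhs => rw [hv]
  rw [map_sum]
  refine Finset.sum_congr rfl fun i _ => ?_
  rw [map_smul, h.lineDeriv_eq_fderiv, smul_eq_mul, mul_comm]

lemma hasCompactSupport_of_closedBall {ψ : Eucl n → ℝ} {x₁ : Eucl n} {s : ℝ}
    (hs : ∀ x, x ∉ closedBall x₁ s → ψ x = 0) : HasCompactSupport ψ :=
  HasCompactSupport.intro (isCompact_closedBall x₁ s) hs

/-- Integration by parts for Lipschitz vector fields. -/
lemma integral_inner_gradient_eq {C C' : ℝ≥0} {G : Eucl n → Eucl n} (hG : LipschitzWith C' G)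
    {ψ : Eucl n → ℝ} (hψ : LipschitzWith C ψ) {x₁ : Eucl n} {s : ℝ}
    (hs : ∀ x, x ∉ closedBall x₁ s → ψ x = 0) :
    ∫ x, ⟪G x, gradient ψ x⟫_ℝ = ∫ x, -lipDiv G x * ψ x := by
  have hc := hasCompactSupport_of_closedBall hs
  have hae : ∀ᵐ x ∂(volume : Measure (Eucl n)), ⟪G x, gradient ψ x⟫_ℝ =
      ∑ i, lineDeriv ℝ ψ x (EuclideanSpace.single i 1) * G x i := by
    filter_upwards [hψ.ae_differentiableAt] with x hx using inner_gradient_eq_sum hx _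
  have hGint : ∀ i, Integrable (fun x => lineDeriv ℝ (fun y => G y i) x
      (EuclideanSpace.single i 1) * ψ x) := fun i => by
    refine integrable_mul_of_support (M := C') hψ hs
      (measurable_lineDeriv (lipschitzWith_coord hG i).continuous).aestronglyMeasurable
      fun x _ => ?_
    simpa using norm_lineDeriv_le_of_lipschitz ℝ (lipschitzWith_coord hG i) (x₀ := x)
      (v := EuclideanSpace.single i (1 : ℝ))
  have key : ∀ i, ∫ x, lineDeriv ℝ ψ x (EuclideanSpace.single i 1) * G x i =
      ∫ x, -(lineDeriv ℝ (fun y => G y i) x (EuclideanSpace.single i 1) * ψ x) := fun i => by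
    have h := (lipschitzWith_coord hG i).integral_lineDeriv_mul_eq (μ := volume) hψ hc
      (EuclideanSpace.single i (1 : ℝ))
    simp only [lineDeriv_neg, neg_mul] at h
    rw [integral_neg, h, integral_neg, neg_neg]
  have hψint : ∀ i, Integrable (fun x => lineDeriv ℝ ψ x (EuclideanSpace.single i 1) * G x i) :=
    fun i => by
    obtain ⟨B, hB⟩ := (isCompact_closedBall x₁ s).exists_bound_of_continuousOn
      (lipschitzWith_coord hG i).continuous.continuousOn
    have hz : ∀ x, x ∉ closedBall x₁ s →
        lineDeriv ℝ ψ x (EuclideanSpace.single i 1) = 0 := by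
      intro x hx
      have : ψ =ᶠ[𝓝 x] fun _ => 0 := by
        filter_upwards [isClosed_closedBall.isOpen_compl.mem_nhds hx] with y hy using hs y hy
      rw [this.lineDeriv_eq]
      simp [lineDeriv]
    refine integrable_of_bounded_of_support (B := C * |B|) (x₁ := x₁) (s := s)
      ((measurable_lineDeriv hψ.continuous).aestronglyMeasurable.mul
        (lipschitzWith_coord hG i).continuous.aestronglyMeasurable) (fun x => ?_) fun x hx => ?_
    · by_cases hx : x ∈ closedBall x₁ s
      · rw [norm_mul]
        refine mul_le_mul ?_ ((hB x hx).trans (le_abs_self B)) (norm_nonneg _) (by positivity)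
        simpa using norm_lineDeriv_le_of_lipschitz ℝ hψ (x₀ := x)
          (v := EuclideanSpace.single i (1 : ℝ))
      · rw [hz x hx, zero_mul, norm_zero]
        positivity
    · rw [hz x hx, zero_mul]
  rw [integral_congr_ae hae, integral_finsetSum _ fun i _ => hψint i]
  simp only [key, integral_neg, Finset.sum_neg_distrib]
  rw [← integral_finsetSum _ fun i _ => hGint i, ← integral_neg]
  refine integral_congr_ae (Eventually.of_forall fun x => ?_)
  simp only [lipDiv, neg_mul, Finset.sum_mul]

lemma hasGradientAt_coord (c : ℝ) (x : Eucl n) :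
    HasGradientAt (fun y : Eucl n => c * y (Fin.last n)) (c • eLast n) x := by
  rw [hasGradientAt_iff_hasFDerivAt]
  have h : HasFDerivAt (fun y : Eucl n => c * y (Fin.last n))
      (c • (EuclideanSpace.proj (Fin.last n) : Eucl n →L[ℝ] ℝ)) x :=
    ((EuclideanSpace.proj (Fin.last n) : Eucl n →L[ℝ] ℝ).hasFDerivAt).const_mul c
  have e : (InnerProductSpace.toDual ℝ (Eucl n)) (c • eLast n) =
      c • (EuclideanSpace.proj (Fin.last n) : Eucl n →L[ℝ] ℝ) := by
    ext y
    simp [eLast, EuclideanSpace.inner_single_left]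
  rw [e]
  exact h

lemma inner_eLast (x : Eucl n) : ⟪x, eLast n⟫_ℝ = x (Fin.last n) := by
  simp [eLast, EuclideanSpace.inner_single_right]

lemma continuous_last : Continuous fun x : Eucl n => x (Fin.last n) :=
  (EuclideanSpace.proj (Fin.last n) : Eucl n →L[ℝ] ℝ).continuous

lemma isOpen_upper : IsOpen {x : Eucl n | 0 < x (Fin.last n)} :=
  isOpen_lt continuous_const continuous_last

/-- One-sided integration by parts on the upper half-space, for a vector field which points
inwards on the boundary. -/
lemma setIntegral_inner_gradient_le {C C' : ℝ≥0} {G : Eucl n → Eucl n} (hG : LipschitzWith C' G)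
    {ψ : Eucl n → ℝ} (hψ : LipschitzWith C ψ) (hnn : ∀ x, 0 ≤ ψ x) {x₁ : Eucl n} {s : ℝ}
    (hs : ∀ x, x ∉ closedBall x₁ s → ψ x = 0)
    (hflux : ∀ x, ψ x ≠ 0 → 0 ≤ G x (Fin.last n)) :
    ∫ x in {x : Eucl n | 0 < x (Fin.last n)}, ⟪G x, gradient ψ x⟫_ℝ ≤
      ∫ x in {x : Eucl n | 0 < x (Fin.last n)}, -lipDiv G x * ψ x := by
  set H : Set (Eucl n) := {x : Eucl n | 0 < x (Fin.last n)} with hH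
  have hHm : MeasurableSet H := isOpen_upper.measurableSet
  let ψj : ℕ → Eucl n → ℝ := fun j x => min (ψ x) (max ((j : ℝ) * x (Fin.last n)) 0)
  have hjL : ∀ j, ∃ Cj : ℝ≥0, LipschitzWith Cj (ψj j) := fun j =>
    ⟨_, hψ.min
      ((((j : ℝ) • (EuclideanSpace.proj (Fin.last n) : Eucl n →L[ℝ] ℝ)).lipschitz).max_const 0)⟩
  have hjs : ∀ j x, x ∉ closedBall x₁ s → ψj j x = 0 := fun j x hx => by
    simp only [ψj, hs x hx]
    exact min_eq_left (le_max_right _ _)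
  have hjnn : ∀ j x, 0 ≤ ψj j x := fun j x => le_min (hnn x) (le_max_right _ _)
  have hjle : ∀ j x, ψj j x ≤ ψ x := fun j x => min_le_left _ _
  obtain ⟨MG, hMG⟩ := (isCompact_closedBall x₁ s).exists_bound_of_continuousOn
    hG.continuous.continuousOn
  have hsupp : ∀ x, ψ x ≠ 0 → x ∈ closedBall x₁ s := fun x hx => by
    by_contra h
    exact hx (hs x h)
  have hI : Integrable (fun x => ⟪G x, gradient ψ x⟫_ℝ) :=
    integrable_inner_gradient hψ hnn hs hG.continuous.aestronglyMeasurable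
      fun x hx => hMG x (hsupp x hx)
  obtain ⟨B, hB⟩ := exists_bound_lipDiv hG
  have hdiv : AEStronglyMeasurable (fun x => -lipDiv G x) (volume : Measure (Eucl n)) :=
    (measurable_lipDiv hG).neg.aestronglyMeasurable
  have hD : Integrable (fun x => -lipDiv G x * ψ x) :=
    integrable_mul_of_support hψ hs hdiv fun x _ => by simpa using hB x
  let S : ℕ → Set (Eucl n) :=
    fun j => {x | 0 < x (Fin.last n) ∧ ψ x ≤ (j : ℝ) * x (Fin.last n)}
  have hSm : ∀ j, MeasurableSet (S j) := fun j =>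
    hHm.inter (measurableSet_le hψ.continuous.measurable
      (continuous_const.mul continuous_last).measurable)
  have hmono : ∀ j, ∫ x, (S j).indicator (fun x => ⟪G x, gradient ψ x⟫_ℝ) x ≤
      ∫ x, -lipDiv G x * ψj j x := by
    intro j
    obtain ⟨Cj, hCj⟩ := hjL j
    rw [← integral_inner_gradient_eq hG hCj (hjs j)]
    refine integral_mono_ae (hI.indicator (hSm j))
      (integrable_inner_gradient hCj (hjnn j) (hjs j) hG.continuous.aestronglyMeasurable
        (M := MG) fun x hx => hMG x ?_) ?_
    · by_contra h
      exact hx (hjs j x h)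
    filter_upwards [hψ.ae_differentiableAt, hCj.ae_differentiableAt] with x hx hxj
    by_cases hxl : 0 < x (Fin.last n)
    · by_cases hle : ψ x ≤ (j : ℝ) * x (Fin.last n)
      · rw [Set.indicator_of_mem (show x ∈ S j from ⟨hxl, hle⟩)]
        rw [gradient_eq_of_touching hxj hx (Eventually.of_forall (hjle j))
          (min_eq_left (hle.trans (le_max_left _ _)))]
      · rw [Set.indicator_of_notMem (fun h => hle h.2)]
        have hg := hasGradientAt_coord (j : ℝ) x
        have heq : ψj j x = (j : ℝ) * x (Fin.last n) := by
          simp only [ψj]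
          rw [max_eq_left (by positivity), min_eq_right (not_le.1 hle).le]
        have hev : ∀ᶠ y in 𝓝 x, ψj j y ≤ (j : ℝ) * y (Fin.last n) := by
          filter_upwards [isOpen_upper.mem_nhds hxl] with y hy
          refine (min_le_right _ _).trans (max_le le_rfl ?_)
          have : 0 < y (Fin.last n) := hy
          positivity
        rw [gradient_eq_of_touching hxj hg.differentiableAt hev heq, hg.gradient,
          inner_smul_right, inner_eLast]
        refine mul_nonneg (by positivity) (hflux x fun h => hle ?_)
        rw [h]
        positivity
    · rw [Set.indicator_of_notMem (fun h => hxl h.1)]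
      have h0 : ψj j x = 0 := by
        simp only [ψj]
        rw [max_eq_right (mul_nonpos_of_nonneg_of_nonpos (by positivity) (not_lt.1 hxl)),
          min_eq_right (hnn x)]
      rw [gradient_eq_zero_of_nonneg (hjnn j) h0, inner_zero_right]
  have hev : ∀ x : Eucl n, 0 < x (Fin.last n) →
      ∀ᶠ j : ℕ in atTop, ψ x ≤ (j : ℝ) * x (Fin.last n) := fun x hx => by
    filter_upwards [eventually_ge_atTop ⌈ψ x / x (Fin.last n)⌉₊] with j hj
    rw [← div_le_iff₀ hx]
    exact (Nat.le_ceil _).trans (by exact_mod_cast hj)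
  have hlim1 : Tendsto (fun j => ∫ x, (S j).indicator (fun x => ⟪G x, gradient ψ x⟫_ℝ) x) atTop
      (𝓝 (∫ x, H.indicator (fun x => ⟪G x, gradient ψ x⟫_ℝ) x)) := by
    refine tendsto_integral_of_dominated_convergence (fun x => ‖⟪G x, gradient ψ x⟫_ℝ‖)
      (fun j => (hI.indicator (hSm j)).aestronglyMeasurable) hI.norm
      (fun j => Eventually.of_forall fun x => norm_indicator_le_norm_self _ _)
      (Eventually.of_forall fun x => ?_)
    by_cases hx : 0 < x (Fin.last n)
    · refine tendsto_const_nhds.congr' ?_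
      filter_upwards [hev x hx] with j hj
      rw [Set.indicator_of_mem (show x ∈ S j from ⟨hx, hj⟩),
        Set.indicator_of_mem (show x ∈ H from hx)]
    · refine tendsto_const_nhds.congr fun j => ?_
      rw [Set.indicator_of_notMem (fun h : x ∈ S j => hx h.1),
        Set.indicator_of_notMem (fun h : x ∈ H => hx h)]
  have hlim2 : Tendsto (fun j => ∫ x, -lipDiv G x * ψj j x) atTop
      (𝓝 (∫ x, H.indicator (fun x => -lipDiv G x * ψ x) x)) := by
    refine tendsto_integral_of_dominated_convergence (fun x => ‖-lipDiv G x * ψ x‖)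
      (fun j => ?_) hD.norm (fun j => Eventually.of_forall fun x => ?_)
      (Eventually.of_forall fun x => ?_)
    · obtain ⟨Cj, hCj⟩ := hjL j
      exact hdiv.mul hCj.continuous.aestronglyMeasurable
    · rw [norm_mul, norm_mul]
      refine mul_le_mul_of_nonneg_left ?_ (norm_nonneg _)
      rw [Real.norm_of_nonneg (hjnn j x), Real.norm_of_nonneg (hnn x)]
      exact hjle j x
    by_cases hx : 0 < x (Fin.last n)
    · refine tendsto_const_nhds.congr' ?_
      filter_upwards [hev x hx] with j hj
      rw [Set.indicator_of_mem (show x ∈ H from hx)]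
      simp only [ψj]
      rw [min_eq_left (hj.trans (le_max_left _ _))]
    · refine tendsto_const_nhds.congr fun j => ?_
      rw [Set.indicator_of_notMem (fun h : x ∈ H => hx h)]
      simp only [ψj]
      rw [max_eq_right (mul_nonpos_of_nonneg_of_nonpos (by positivity) (not_lt.1 hx)),
        min_eq_right (hnn x), mul_zero]
  rw [← integral_indicator hHm, ← integral_indicator hHm]
  exact le_of_tendsto_of_tendsto' hlim1 hlim2 hmono

/-- The uncurried vector field. -/
def uncurryF (F : Eucl n → ℝ → Eucl n → Eucl n) (q : Eucl n × ℝ × Eucl n) : Eucl n :=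
  F q.1 q.2.1 q.2.2

/-- The uncurried lower order term. -/
def uncurryF₀ (F₀ : Eucl n → ℝ → Eucl n → ℝ) (q : Eucl n × ℝ × Eucl n) : ℝ :=
  F₀ q.1 q.2.1 q.2.2

/-- The domain of definition of the structure functions. -/
def jetDom (n : ℕ) : Set (Eucl n × ℝ × Eucl n) :=
  ball (0 : Eucl n) 1 ×ˢ (Set.univ : Set ℝ) ×ˢ (Set.univ : Set (Eucl n))

lemma isOpen_jetDom : IsOpen (jetDom n) := isOpen_ball.prod (isOpen_univ.prod isOpen_univ)

lemma mem_jetDom {x : Eucl n} (hx : x ∈ ball (0 : Eucl n) 1) (z : ℝ) (p : Eucl n) :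
    (x, z, p) ∈ jetDom n := ⟨hx, trivial, trivial⟩

lemma exists_lipschitzOnWith_of_contDiffOn {E E' : Type*} [NormedAddCommGroup E]
    [NormedSpace ℝ E] [NormedAddCommGroup E'] [NormedSpace ℝ E'] {f : E → E'} {U K : Set E}
    (hU : IsOpen U) (hf : ContDiffOn ℝ 1 f U) (hK : IsCompact K) (hKU : K ⊆ U) :
    ∃ C : ℝ≥0, LipschitzOnWith C f K := by
  refine LocallyLipschitzOn.exists_lipschitzOnWith_of_compact hK fun x hx => ?_
  obtain ⟨C, t, ht, h⟩ := (hf.contDiffAt (hU.mem_nhds (hKU hx))).exists_lipschitzOnWith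
  exact ⟨C, t, mem_nhdsWithin_of_mem_nhds ht, h⟩

lemma measurable_indicator_of_continuousOn {E E' : Type*} [TopologicalSpace E]
    [MeasurableSpace E] [BorelSpace E] [NormedAddCommGroup E']
    [MeasurableSpace E'] [BorelSpace E'] {f : E → E'} {U : Set E}
    (hU : IsOpen U) (hf : ContinuousOn f U) : Measurable (U.indicator f) := by
  classical
  rw [← Set.piecewise_eq_indicator]
  exact hf.measurable_piecewise continuousOn_const hU.measurableSet

/-- Strict monotonicity in the gradient variable. -/
lemma monotone_of_elliptic {F : Eucl n → ℝ → Eucl n → Eucl n}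
    (hF : ContDiffOn ℝ 1 (uncurryF F) (jetDom n)) {M lam : ℝ}
    (hell : ∀ x ∈ ball (0 : Eucl n) 1, ∀ z : ℝ, |z| ≤ M → ∀ p : Eucl n, ‖p‖ ≤ M →
      ∀ ξ : Eucl n, lam * ‖ξ‖ ^ 2 ≤ ⟪fderiv ℝ (F x z) p ξ, ξ⟫_ℝ)
    {x : Eucl n} (hx : x ∈ ball (0 : Eucl n) 1) {z : ℝ} (hz : |z| ≤ M) {p p' : Eucl n}
    (hp : ‖p‖ ≤ M) (hp' : ‖p'‖ ≤ M) :
    lam * ‖p - p'‖ ^ 2 ≤ ⟪F x z p - F x z p', p - p'⟫_ℝ := by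
  have hd : ∀ q : Eucl n, DifferentiableAt ℝ (F x z) q := fun q => by
    have h1 : DifferentiableAt ℝ (uncurryF F) (x, z, q) :=
      (hF.contDiffAt (isOpen_jetDom.mem_nhds (mem_jetDom hx z q))).differentiableAt (by simp)
    exact h1.comp q (f := fun q : Eucl n => (x, z, q)) (by fun_prop)
  let γ : ℝ → Eucl n := fun s => p' + s • (p - p')
  have hγ : ∀ s, HasDerivAt γ (p - p') s := fun s => by
    have h := ((hasDerivAt_id s).smul_const (p - p')).const_add p'
    rw [one_smul] at h
    exact h
  have hg : ∀ s, HasDerivAt (fun s => ⟪F x z (γ s), p - p'⟫_ℝ)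
      (⟪fderiv ℝ (F x z) (γ s) (p - p'), p - p'⟫_ℝ) s := fun s => by
    have h := ((hd (γ s)).hasFDerivAt.comp_hasDerivAt s (hγ s)).inner ℝ
      (hasDerivAt_const s (p - p'))
    simpa using h
  obtain ⟨c, hc, hceq⟩ := exists_hasDerivAt_eq_slope _ _ (zero_lt_one' ℝ)
    (fun s _ => (hg s).continuousAt.continuousWithinAt) (fun s _ => hg s)
  have hcM : ‖γ c‖ ≤ M := by
    have : γ c ∈ closedBall (0 : Eucl n) M := by
      have hconv := convex_closedBall (0 : Eucl n) M
      exact hconv.add_smul_sub_mem (by simpa using hp') (by simpa using hp) ⟨hc.1.le, hc.2.le⟩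
    simpa using this
  have h := hell x hx z hz (γ c) hcM (p - p')
  rw [hceq] at h
  simpa [γ, inner_sub_left] using h

/-- A quadratic polynomial centred at `y`. -/
def quad (c : ℝ) (p ν : Eucl n) (a b : ℝ) (y x : Eucl n) : ℝ :=
  c + ⟪p, x - y⟫_ℝ + a * ⟪ν, x - y⟫_ℝ ^ 2 - b * ‖x - y‖ ^ 2

/-- The gradient of `quad`. -/
def quadGrad (p ν : Eucl n) (a b : ℝ) (y x : Eucl n) : Eucl n :=
  p + (2 * a * ⟪ν, x - y⟫_ℝ) • ν - (2 * b) • (x - y)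

lemma contDiff_quad (c : ℝ) (p ν : Eucl n) (a b : ℝ) (y : Eucl n) :
    ContDiff ℝ 1 (quad c p ν a b y) := by
  unfold quad
  have h1 : ContDiff ℝ 1 (fun x : Eucl n => x - y) := contDiff_id.sub contDiff_const
  have h2 := h1.norm_sq ℝ
  have h3 := (contDiff_const (c := ν)).inner ℝ h1
  have h4 := (contDiff_const (c := p)).inner ℝ h1
  exact ((contDiff_const.add h4).add (contDiff_const.mul (h3.pow 2))).sub (contDiff_const.mul h2)

lemma hasGradientAt_quad (c : ℝ) (p ν : Eucl n) (a b : ℝ) (y x : Eucl n) :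
    HasGradientAt (quad c p ν a b y) (quadGrad p ν a b y x) x := by
  have h1 : HasFDerivAt (fun x : Eucl n => x - y) (ContinuousLinearMap.id ℝ (Eucl n)) x :=
    (hasFDerivAt_id x).sub_const y
  have hin : ∀ w : Eucl n, HasFDerivAt (fun x : Eucl n => ⟪w, x - y⟫_ℝ) (innerSL ℝ w) x :=
    fun w => (innerSL ℝ w).hasFDerivAt.comp x h1
  have h : HasFDerivAt (quad c p ν a b y) _ x :=
    (((hin p).const_add c).add (((hin ν).pow 2).const_mul a)).sub ((h1.norm_sq).const_mul b)
  rw [hasGradientAt_iff_hasFDerivAt]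
  refine h.congr_fderiv ?_
  ext v
  simp [quadGrad]
  ring

lemma hasFDerivAt_quadGrad (p ν : Eucl n) (a b : ℝ) (y x : Eucl n) :
    HasFDerivAt (quadGrad p ν a b y) ((2 * a) • (innerSL ℝ ν).smulRight ν -
      (2 * b) • ContinuousLinearMap.id ℝ (Eucl n)) x := by
  have h1 : HasFDerivAt (fun x : Eucl n => x - y) (ContinuousLinearMap.id ℝ (Eucl n)) x :=
    (hasFDerivAt_id x).sub_const y
  have h2 : HasFDerivAt (fun x : Eucl n => ⟪ν, x - y⟫_ℝ) (innerSL ℝ ν) x :=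
    (innerSL ℝ ν).hasFDerivAt.comp x h1
  have h := ((((h2.const_mul (2 * a)).smul_const ν).const_add p).sub (h1.const_smul (2 * b)))
  refine HasFDerivAt.congr_fderiv h ?_
  ext v i
  simp [mul_assoc]

lemma contDiff_quadGrad (p ν : Eucl n) (a b : ℝ) (y : Eucl n) :
    ContDiff ℝ 1 (quadGrad p ν a b y) := by
  unfold quadGrad
  have h1 : ContDiff ℝ 1 (fun x : Eucl n => x - y) := contDiff_id.sub contDiff_const
  have h3 := (contDiff_const (c := ν)).inner ℝ h1
  exact (contDiff_const.add ((contDiff_const.mul h3).smul contDiff_const)).sub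
    (h1.const_smul (2 * b))

/-- The divergence of `F (x, φ, ∇φ)` at a jet of a quadratic polynomial `φ` with Hessian
`2 a ν⊗ν - 2 b`. -/
def jetDiv (F : Eucl n → ℝ → Eucl n → Eucl n) (a b : ℝ) (ν : Eucl n)
    (q : Eucl n × ℝ × Eucl n) : ℝ :=
  ∑ i, fderiv ℝ (uncurryF F) q (EuclideanSpace.single i 1, q.2.2 i,
    (2 * a * ν i) • ν - (2 * b) • EuclideanSpace.single i (1 : ℝ)) i

lemma continuousOn_jetDiv {F : Eucl n → ℝ → Eucl n → Eucl n}
    (hF : ContDiffOn ℝ 1 (uncurryF F) (jetDom n)) (a b : ℝ) (ν : Eucl n) :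
    ContinuousOn (jetDiv F a b ν) (jetDom n) := by
  unfold jetDiv
  refine continuousOn_finsetSum _ fun i _ => ?_
  have h := hF.continuousOn_fderiv_of_isOpen isOpen_jetDom le_rfl
  have h2 : Continuous fun q : Eucl n × ℝ × Eucl n =>
      (((EuclideanSpace.single i 1 : Eucl n), q.2.2 i,
      (2 * a * ν i) • ν - (2 * b) • EuclideanSpace.single i (1 : ℝ)) : Eucl n × ℝ × Eucl n) := by
    have := (EuclideanSpace.proj i : Eucl n →L[ℝ] ℝ).continuous.comp
      (continuous_snd.comp (continuous_snd (X := Eucl n) (Y := ℝ × Eucl n)))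
    exact continuous_const.prodMk (Continuous.prodMk this continuous_const)
  exact (EuclideanSpace.proj i : Eucl n →L[ℝ] ℝ).continuous.comp_continuousOn
    (h.clm_apply h2.continuousOn)

/-- The jet of a quadratic polynomial. -/
def quadJet (c : ℝ) (p ν : Eucl n) (a b : ℝ) (y x : Eucl n) : Eucl n × ℝ × Eucl n :=
  (x, quad c p ν a b y x, quadGrad p ν a b y x)

lemma contDiff_quadJet (c : ℝ) (p ν : Eucl n) (a b : ℝ) (y : Eucl n) :
    ContDiff ℝ 1 (quadJet c p ν a b y) :=
  contDiff_id.prodMk ((contDiff_quad c p ν a b y).prodMk (contDiff_quadGrad p ν a b y))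

lemma lipDiv_eq_jetDiv {F : Eucl n → ℝ → Eucl n → Eucl n}
    (hF : ContDiffOn ℝ 1 (uncurryF F) (jetDom n)) (c : ℝ) (p ν : Eucl n) (a b : ℝ)
    (y x : Eucl n) (hx : x ∈ ball (0 : Eucl n) 1) {G : Eucl n → Eucl n}
    (hG : G =ᶠ[𝓝 x] fun x => uncurryF F (quadJet c p ν a b y x)) :
    lipDiv G x = jetDiv F a b ν (quadJet c p ν a b y x) := by
  unfold lipDiv jetDiv
  refine Finset.sum_congr rfl fun i _ => ?_
  have hJ : HasFDerivAt (quadJet c p ν a b y) _ x :=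
    (hasFDerivAt_id x).prodMk (((hasGradientAt_quad c p ν a b y x).hasFDerivAt).prodMk
      (hasFDerivAt_quadGrad p ν a b y x))
  have hFd : DifferentiableAt ℝ (uncurryF F) (quadJet c p ν a b y x) :=
    (hF.contDiffAt (isOpen_jetDom.mem_nhds (mem_jetDom hx _ _))).differentiableAt (by simp)
  have h1 := hFd.hasFDerivAt.comp x hJ
  have h2 : HasFDerivAt G _ x := h1.congr_of_eventuallyEq hG
  have h3 := (EuclideanSpace.proj i : Eucl n →L[ℝ] ℝ).hasFDerivAt.comp x h2
  have h4 := h3.hasLineDerivAt (EuclideanSpace.single i (1 : ℝ))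
  have h5 := h4.lineDeriv
  refine h5.trans ?_
  simp [quadJet, EuclideanSpace.inner_single_right, smul_smul]

/-- The whole space, or the open upper half-space when `half` holds. -/
def upper (half : Prop) : Set (Eucl n) := {x | half → 0 < x (Fin.last n)}

/-- The whole space, or the closed upper half-space when `half` holds. -/
def upperCl (half : Prop) : Set (Eucl n) := {x | half → 0 ≤ x (Fin.last n)}

lemma upper_subset_upperCl (half : Prop) : (upper half : Set (Eucl n)) ⊆ upperCl half :=
  fun _ hx h => (hx h).le

lemma isOpen_upper' (half : Prop) : IsOpen (upper half : Set (Eucl n)) := by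
  by_cases h : half
  · simpa [upper, h] using isOpen_upper
  · simp [upper, h]

lemma isClosed_upperCl (half : Prop) : IsClosed (upperCl half : Set (Eucl n)) := by
  by_cases h : half
  · simpa [upperCl, h] using isClosed_le continuous_const continuous_last
  · simp [upperCl, h]

/-- The variational inequality for nonnegative test functions in a small ball. -/
def LocalWeak (half : Prop) (F : Eucl n → ℝ → Eucl n → Eucl n) (F₀ : Eucl n → ℝ → Eucl n → ℝ)
    (u : Eucl n → ℝ) (x₁ : Eucl n) (r : ℝ) : Prop :=
  ∀ ψ : Eucl n → ℝ, (∃ C : ℝ≥0, LipschitzWith C ψ) → (∀ x, 0 ≤ ψ x) → (∀ x, ψ x ≤ r) →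
    (∀ x, x ∉ ball x₁ r → ψ x = 0) →
    0 ≤ ∫ x in upper half ∩ ball (0 : Eucl n) 1,
      (⟪F x (u x) (gradient u x), gradient ψ x⟫_ℝ + F₀ x (u x) (gradient u x) * ψ x)

lemma energy_comparison {F : Eucl n → ℝ → Eucl n → Eucl n} {F₀ : Eucl n → ℝ → Eucl n → ℝ}
    {M lam : ℝ} {C : ℝ≥0} (hlam : 0 < lam)
    (hF : ContDiffOn ℝ 1 (uncurryF F) (jetDom n))
    (hell : ∀ x ∈ ball (0 : Eucl n) 1, ∀ z : ℝ, |z| ≤ M → ∀ p : Eucl n, ‖p‖ ≤ M →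
      ∀ ξ : Eucl n, lam * ‖ξ‖ ^ 2 ≤ ⟪fderiv ℝ (F x z) p ξ, ξ⟫_ℝ)
    {B : Set (Eucl n)} (hB : B ⊆ ball 0 1)
    (hC : LipschitzOnWith C (uncurryF F) (B ×ˢ closedBall 0 M ×ˢ closedBall 0 M))
    (hC₀ : LipschitzOnWith C (uncurryF₀ F₀) (B ×ˢ closedBall 0 M ×ˢ closedBall 0 M))
    {x : Eucl n} (hx : x ∈ B) {z z' : ℝ} (hz : |z| ≤ M) (hz' : |z'| ≤ M) {p p' : Eucl n}
    (hp : ‖p‖ ≤ M) (hp' : ‖p'‖ ≤ M) (hzz : z ≤ z') :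
    ⟪F x z p, p' - p⟫_ℝ + F₀ x z p * (z' - z) ≤
      ⟪F x z' p', p' - p⟫_ℝ + F₀ x z' p' * (z' - z) + (C ^ 2 / lam + C) * (z' - z) ^ 2 := by
  have hm := monotone_of_elliptic hF hell (hB hx) hz hp' hp
  have mem : ∀ {z : ℝ} {p : Eucl n}, |z| ≤ M → ‖p‖ ≤ M →
      (x, z, p) ∈ B ×ˢ closedBall (0 : ℝ) M ×ˢ closedBall (0 : Eucl n) M := fun hz hp =>
    ⟨hx, by simpa using hz, by simpa using hp⟩
  have h1 := hC.dist_le_mul _ (mem hz hp') _ (mem hz' hp')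
  have h2 := hC₀.dist_le_mul _ (mem hz hp) _ (mem hz' hp')
  set w := z' - z with hw
  have hw0 : 0 ≤ w := sub_nonneg.2 hzz
  have hd : dist z z' = w := by
    rw [dist_comm, Real.dist_eq, abs_of_nonneg hw0]
  have d1 : dist (x, z, p') (x, z', p') = w := by
    simp [Prod.dist_eq, hd, hw0]
  have d2 : dist (x, z, p) (x, z', p') ≤ w + ‖p' - p‖ := by
    simp only [Prod.dist_eq, dist_self, hd]
    rw [dist_comm p p', dist_eq_norm]
    exact max_le (by positivity) (max_le (by linarith [norm_nonneg (p' - p)]) (by linarith))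
  rw [d1, dist_eq_norm] at h1
  simp only [uncurryF, uncurryF₀] at h1 h2
  have h3 : ⟪F x z p' - F x z' p', p' - p⟫_ℝ ≤ C * w * ‖p' - p‖ :=
    (real_inner_le_norm _ _).trans (mul_le_mul_of_nonneg_right h1 (norm_nonneg _))
  have h4 : F₀ x z p - F₀ x z' p' ≤ C * (w + ‖p' - p‖) :=
    (le_abs_self _).trans (h2.trans (mul_le_mul_of_nonneg_left d2 C.coe_nonneg))
  have h5 := mul_le_mul_of_nonneg_right h4 hw0
  rw [inner_sub_left] at hm h3
  set g := ‖p' - p‖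
  have h6 : 2 * C * w * g ≤ lam * g ^ 2 + C ^ 2 / lam * w ^ 2 := by
    have : 0 ≤ (lam * g - C * w) ^ 2 / lam := by positivity
    have e : (lam * g - C * w) ^ 2 / lam = lam * g ^ 2 - 2 * C * w * g + C ^ 2 / lam * w ^ 2 := by
      field_simp
      ring
    linarith
  nlinarith

lemma exists_upper_near (half : Prop) {x₁ : Eucl n} (h : x₁ ∈ (upperCl half : Set (Eucl n)))
    {U : Set (Eucl n)} (hU : U ∈ 𝓝 x₁) : ∃ y ∈ U, y ∈ (upper half : Set (Eucl n)) := by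
  have hc : Tendsto (fun s : ℝ => x₁ + s • eLast n) (𝓝[>] 0) (𝓝 x₁) := by
    have : Tendsto (fun s : ℝ => x₁ + s • eLast n) (𝓝 0) (𝓝 (x₁ + (0 : ℝ) • eLast n)) :=
      Continuous.tendsto (by fun_prop) 0
    rw [zero_smul, add_zero] at this
    exact this.mono_left nhdsWithin_le_nhds
  obtain ⟨s, hs, hs0⟩ := ((hc.eventually hU).and self_mem_nhdsWithin).exists
  refine ⟨_, hs, fun hh => ?_⟩
  have := h hh
  have hs0' : (0 : ℝ) < s := hs0
  simp [eLast]
  linarith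

lemma setIntegral_pos_of_pos {half : Prop} {ψ : Eucl n → ℝ} (hψ : Continuous ψ)
    (hnn : ∀ x, 0 ≤ ψ x) {x₁ : Eucl n} {s : ℝ} (hs : ∀ x, x ∉ closedBall x₁ s → ψ x = 0)
    (hx₁ : x₁ ∈ (upperCl half : Set (Eucl n))) (hpos : 0 < ψ x₁) :
    0 < ∫ x in upper half, ψ x := by
  have hI : Integrable ψ := hψ.integrable_of_hasCompactSupport (hasCompactSupport_of_closedBall hs)
  rw [setIntegral_pos_iff_support_of_nonneg_ae (Eventually.of_forall hnn) hI.integrableOn]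
  have hop : IsOpen (Function.support ψ ∩ upper half) :=
    (hψ.isOpen_support).inter (isOpen_upper' half)
  refine hop.measure_pos _ ?_
  obtain ⟨y, hy1, hy2⟩ := exists_upper_near half hx₁ (hψ.isOpen_support.mem_nhds hpos.ne')
  exact ⟨y, hy1, hy2⟩

/-- The truncated contact function used as a test function. -/
lemma exists_touch_test (half : Prop) {u φ : Eucl n → ℝ} {L : ℝ≥0} (hu : LipschitzWith L u)
    (hφ : ContDiff ℝ 1 φ) {x₁ : Eucl n} {s ε κ : ℝ} (hs : 0 < s) (hε : 0 < ε)
    (hεs : ε ≤ κ * s ^ 2 / 4) (hφ₁ : φ x₁ = u x₁ + ε) (hκ : 0 < κ)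
    (htouch : ∀ x ∈ ball x₁ s, x ∈ (upperCl half : Set (Eucl n)) →
      φ x - ε + κ * ‖x - x₁‖ ^ 2 ≤ u x) :
    ∃ (C : ℝ≥0) (ψ : Eucl n → ℝ), LipschitzWith C ψ ∧ (∀ x, 0 ≤ ψ x) ∧ (∀ x, ψ x ≤ 2 * ε) ∧
      (∀ x, x ∉ ball x₁ s → ψ x = 0) ∧ 0 < ψ x₁ ∧
      ∀ x ∈ ball x₁ s, x ∈ (upperCl half : Set (Eucl n)) → ψ x = max 0 (φ x - u x) := by
  obtain ⟨Cφ, hCφ⟩ := exists_lipschitzOnWith_of_contDiffOn isOpen_univ hφ.contDiffOn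
    (isCompact_closedBall x₁ s) (Set.subset_univ _)
  obtain ⟨f, hf, hfφ⟩ := hCφ.extend_real
  let χ : Eucl n → ℝ := fun x => 2 * ε / s * (s - ‖x - x₁‖)
  have hχ : LipschitzWith (Real.toNNReal (2 * ε / s)) χ := by
    refine LipschitzWith.of_dist_le_mul fun x y => ?_
    rw [Real.coe_toNNReal _ (by positivity), Real.dist_eq]
    have e : χ x - χ y = 2 * ε / s * (‖y - x₁‖ - ‖x - x₁‖) := by simp only [χ]; ring
    rw [e, abs_mul, abs_of_pos (by positivity : (0 : ℝ) < 2 * ε / s)]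
    refine mul_le_mul_of_nonneg_left ?_ (by positivity)
    refine (abs_norm_sub_norm_le _ _).trans ?_
    rw [sub_sub_sub_cancel_right, dist_comm, dist_eq_norm]
  have hχ2 : ∀ x, χ x ≤ 2 * ε := fun x => by
    have : χ x = 2 * ε - 2 * ε / s * ‖x - x₁‖ := by simp only [χ]; field_simp
    rw [this]
    have : 0 ≤ 2 * ε / s * ‖x - x₁‖ := by positivity
    linarith
  refine ⟨_, fun x => max 0 (min (f x - u x) (χ x)), (((hf.sub hu).min hχ).const_max 0),
    fun x => le_max_left _ _, fun x => max_le (by positivity) ((min_le_right _ _).trans (hχ2 x)),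
    fun x hx => ?_, ?_, fun x hx hxu => ?_⟩
  · refine max_eq_left ((min_le_right _ _).trans ?_)
    rw [mem_ball, dist_eq_norm, not_lt] at hx
    exact mul_nonpos_of_nonneg_of_nonpos (by positivity) (by linarith)
  · refine lt_max_of_lt_right (lt_min ?_ ?_)
    · rw [← hfφ (mem_closedBall_self hs.le), hφ₁]
      linarith
    · simp only [χ, sub_self, norm_zero, sub_zero]
      positivity
  · have ht := htouch x hx hxu
    change max 0 (min (f x - u x) (χ x)) = _
    rw [← hfφ (ball_subset_closedBall hx)]
    rw [mem_ball, dist_eq_norm] at hx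
    by_cases h2 : ‖x - x₁‖ ≤ s / 2
    · congr 1
      refine min_eq_left ?_
      have h3 : ε ≤ χ x := by
        have : 2 * ε / s * (s / 2) ≤ χ x :=
          mul_le_mul_of_nonneg_left (by linarith) (by positivity)
        have e : 2 * ε / s * (s / 2) = ε := by field_simp
        linarith
      have : 0 ≤ κ * ‖x - x₁‖ ^ 2 := by positivity
      linarith
    · have h3 : φ x - u x ≤ 0 := by
        have h4 : (s / 2) ^ 2 ≤ ‖x - x₁‖ ^ 2 :=
          pow_le_pow_left₀ (by positivity) (not_le.1 h2).le 2
        have h5 := mul_le_mul_of_nonneg_left h4 hκ.le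
        nlinarith
      rw [max_eq_left h3, max_eq_left ((min_le_left _ _).trans h3)]

lemma exists_touch_radius {F : Eucl n → ℝ → Eucl n → Eucl n} {F₀ : Eucl n → ℝ → Eucl n → ℝ}
    (hF : ContDiffOn ℝ 1 (uncurryF F) (jetDom n))
    (hF₀ : ContDiffOn ℝ 1 (uncurryF₀ F₀) (jetDom n)) {half : Prop} {x₁ : Eucl n} {c : ℝ}
    {p ν : Eucl n} {a b r : ℝ} (hx₁ : x₁ ∈ ball (0 : Eucl n) 1)
    (hx₁' : x₁ ∈ (upperCl half : Set (Eucl n))) (hr : 0 < r)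
    (hflux : half → x₁ (Fin.last n) = 0 → 0 < F x₁ c p (Fin.last n))
    (hstrict : F₀ x₁ c p < jetDiv F a b ν (x₁, c, p)) :
    ∃ s δ c₀ : ℝ, 0 < s ∧ 0 < δ ∧ 0 < c₀ ∧ s ≤ r ∧ closedBall x₁ s ⊆ ball 0 1 ∧
      (∀ ε x, 0 ≤ ε → ε ≤ δ → x ∈ closedBall x₁ s →
        uncurryF₀ F₀ (quadJet (c + ε) p ν a b x₁ x) -
          jetDiv F a b ν (quadJet (c + ε) p ν a b x₁ x) ≤ -c₀) ∧
      (half → (∀ x ∈ closedBall x₁ s, 0 < x (Fin.last n)) ∨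
        ∀ ε x, 0 ≤ ε → ε ≤ δ → x ∈ closedBall x₁ s →
          0 ≤ uncurryF F (quadJet (c + ε) p ν a b x₁ x) (Fin.last n)) := by
  have hJ : Continuous fun y : ℝ × Eucl n => quadJet (c + y.1) p ν a b x₁ y.2 := by
    unfold quadJet quad quadGrad
    fun_prop
  have hJ0 : quadJet (c + 0) p ν a b x₁ x₁ = (x₁, c, p) := by
    simp [quadJet, quad, quadGrad]
  have hnb : jetDom n ∈ 𝓝 (x₁, c, p) := isOpen_jetDom.mem_nhds (mem_jetDom hx₁ c p)
  have hJt : Tendsto (fun y : ℝ × Eucl n => quadJet (c + y.1) p ν a b x₁ y.2) (𝓝 (0, x₁))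
      (𝓝 (x₁, c, p)) := by
    have := hJ.tendsto (0, x₁)
    simpa only [hJ0] using this
  have h1 : Tendsto (fun q => uncurryF₀ F₀ q - jetDiv F a b ν q) (𝓝 (x₁, c, p))
      (𝓝 (F₀ x₁ c p - jetDiv F a b ν (x₁, c, p))) :=
    (hF₀.continuousOn.continuousAt hnb).sub ((continuousOn_jetDiv hF a b ν).continuousAt hnb)
  set c₀ := (jetDiv F a b ν (x₁, c, p) - F₀ x₁ c p) / 2 with hc₀
  have hc₀' : 0 < c₀ := by
    rw [hc₀]
    linarith
  have e1 : ∀ᶠ y : ℝ × Eucl n in 𝓝 (0, x₁), uncurryF₀ F₀ (quadJet (c + y.1) p ν a b x₁ y.2) -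
      jetDiv F a b ν (quadJet (c + y.1) p ν a b x₁ y.2) ≤ -c₀ :=
    (h1.comp hJt).eventually (eventually_le_nhds (by rw [hc₀]; linarith))
  have e2 : ∀ᶠ y : ℝ × Eucl n in 𝓝 (0, x₁), half → (if x₁ (Fin.last n) = 0 then
      0 ≤ uncurryF F (quadJet (c + y.1) p ν a b x₁ y.2) (Fin.last n) else
      0 < y.2 (Fin.last n)) := by
    by_cases hh : half
    · split_ifs with h0
      · have h2 : Tendsto (fun q => uncurryF F q (Fin.last n)) (𝓝 (x₁, c, p))
            (𝓝 (F x₁ c p (Fin.last n))) :=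
          (continuous_last.tendsto _).comp (hF.continuousOn.continuousAt hnb)
        filter_upwards [(h2.comp hJt).eventually (eventually_ge_nhds (hflux hh h0))] with y hy _
        exact hy
      · have hpos : 0 < x₁ (Fin.last n) := lt_of_le_of_ne (hx₁' hh) (Ne.symm h0)
        have h2 : Tendsto (fun y : ℝ × Eucl n => y.2 (Fin.last n)) (𝓝 (0, x₁))
            (𝓝 (x₁ (Fin.last n))) := (continuous_last.comp continuous_snd).tendsto (0, x₁)
        filter_upwards [h2.eventually (eventually_gt_nhds hpos)] with y hy _
        exact hy
    · exact Eventually.of_forall fun _ h => absurd h hh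
  have e3 : ∀ᶠ y : ℝ × Eucl n in 𝓝 (0, x₁), y.2 ∈ ball (0 : Eucl n) 1 :=
    (continuous_snd.tendsto ((0 : ℝ), x₁)).eventually (isOpen_ball.mem_nhds hx₁)
  obtain ⟨η, hη, hball⟩ := Metric.eventually_nhds_iff_ball.1 (e1.and (e2.and e3))
  have key : ∀ ε x, 0 ≤ ε → ε ≤ η / 2 → x ∈ closedBall x₁ (min r (η / 2)) →
      ((ε, x) : ℝ × Eucl n) ∈ ball ((0 : ℝ), x₁) η := by
    intro ε x h0 h1 hx
    rw [mem_closedBall] at hx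
    rw [mem_ball, Prod.dist_eq]
    refine max_lt ?_ ?_
    · simp only [Real.dist_eq, sub_zero, abs_of_nonneg h0]
      linarith
    · exact (hx.trans (min_le_right _ _)).trans_lt (by linarith)
  refine ⟨min r (η / 2), η / 2, c₀, by positivity, by positivity, hc₀', min_le_left _ _,
    fun x hx => (hball _ (key 0 x le_rfl (by positivity) hx)).2.2,
    fun ε x h0 h1 hx => (hball _ (key ε x h0 h1 hx)).1, fun hh => ?_⟩
  by_cases h0 : x₁ (Fin.last n) = 0
  · right
    intro ε x h1 h2 hx
    have := (hball _ (key ε x h1 h2 hx)).2.1 hh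
    rwa [if_pos h0] at this
  · left
    intro x hx
    have := (hball _ (key 0 x le_rfl (by positivity) hx)).2.1 hh
    rwa [if_neg h0] at this

lemma setIntegral_upper_le (half : Prop) {C C' : ℝ≥0} {G : Eucl n → Eucl n}
    (hG : LipschitzWith C' G) {ψ : Eucl n → ℝ} (hψ : LipschitzWith C ψ) (hnn : ∀ x, 0 ≤ ψ x)
    {x₁ : Eucl n} {s : ℝ} (hs : ∀ x, x ∉ closedBall x₁ s → ψ x = 0)
    (hcase : half → (∀ x ∈ closedBall x₁ s, 0 < x (Fin.last n)) ∨
      ∀ x, ψ x ≠ 0 → 0 ≤ G x (Fin.last n)) :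
    ∫ x in upper half, ⟪G x, gradient ψ x⟫_ℝ ≤ ∫ x in upper half, -lipDiv G x * ψ x := by
  by_cases hh : half
  · rcases hcase hh with h | h
    · have hz : ∀ x, x ∉ (upper half : Set (Eucl n)) → ψ x = 0 := fun x hx =>
        hs x fun hx' => hx fun _ => h x hx'
      rw [setIntegral_eq_integral_of_forall_compl_eq_zero fun x hx => by
          rw [gradient_eq_zero_of_nonneg hnn (hz x hx), inner_zero_right],
        setIntegral_eq_integral_of_forall_compl_eq_zero fun x hx => by rw [hz x hx, mul_zero],
        integral_inner_gradient_eq hG hψ hs]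
    · have e : (upper half : Set (Eucl n)) = {x | 0 < x (Fin.last n)} := by simp [upper, hh]
      rw [e]
      exact setIntegral_inner_gradient_le hG hψ hnn hs h
  · have e : (upper half : Set (Eucl n)) = Set.univ := by simp [upper, hh]
    rw [e, setIntegral_univ, setIntegral_univ, integral_inner_gradient_eq hG hψ hs]

/-- A strict classical subsolution cannot touch a weak supersolution from below. -/
theorem not_touch_of_strict {F : Eucl n → ℝ → Eucl n → Eucl n} {F₀ : Eucl n → ℝ → Eucl n → ℝ}
    (hF : ContDiffOn ℝ 1 (uncurryF F) (jetDom n))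
    (hF₀ : ContDiffOn ℝ 1 (uncurryF₀ F₀) (jetDom n)) (hell : H1 F) {half : Prop}
    {u : Eucl n → ℝ} {L : ℝ≥0} (hu : LipschitzWith L u) {x₁ p ν : Eucl n} {a b κ r : ℝ}
    (hx₁ : x₁ ∈ ball (0 : Eucl n) 1) (hx₁' : x₁ ∈ (upperCl half : Set (Eucl n))) (hr : 0 < r)
    (hw : LocalWeak half F F₀ u x₁ r) (hκ : 0 < κ)
    (htouch : ∀ x ∈ ball x₁ r, x ∈ (upperCl half : Set (Eucl n)) →
      quad (u x₁) p ν a b x₁ x + κ * ‖x - x₁‖ ^ 2 ≤ u x)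
    (hflux : half → x₁ (Fin.last n) = 0 → 0 < F x₁ (u x₁) p (Fin.last n))
    (hstrict : F₀ x₁ (u x₁) p < jetDiv F a b ν (x₁, u x₁, p)) : False := by
  obtain ⟨s, δ, c₀, hs, hδ, hc₀, hsr, hsub, hneg, hcase⟩ :=
    exists_touch_radius hF hF₀ hx₁ hx₁' hr hflux hstrict
  obtain ⟨M, hM0, hMu, hMg, hMφ, hMφg⟩ : ∃ M : ℝ, 0 < M ∧ (∀ x ∈ closedBall x₁ s, |u x| ≤ M) ∧
      (∀ x, ‖gradient u x‖ ≤ M) ∧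
      (∀ ε x, 0 ≤ ε → ε ≤ δ → x ∈ closedBall x₁ s → |quad (u x₁ + ε) p ν a b x₁ x| ≤ M) ∧
      (∀ x ∈ closedBall x₁ s, ‖quadGrad p ν a b x₁ x‖ ≤ M) := by
    obtain ⟨M1, h1⟩ := (isCompact_closedBall x₁ s).exists_bound_of_continuousOn
      hu.continuous.continuousOn
    obtain ⟨M2, h2⟩ := (isCompact_closedBall x₁ s).exists_bound_of_continuousOn
      (contDiff_quad (u x₁) p ν a b x₁).continuous.continuousOn
    obtain ⟨M3, h3⟩ := (isCompact_closedBall x₁ s).exists_bound_of_continuousOn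
      (contDiff_quadGrad p ν a b x₁).continuous.continuousOn
    have b1 := le_abs_self M1
    have b2 := le_abs_self M2
    have b3 := le_abs_self M3
    have a1 := abs_nonneg M1
    have a2 := abs_nonneg M2
    have a3 := abs_nonneg M3
    have hL := L.coe_nonneg
    refine ⟨|M1| + |M2| + |M3| + L + δ, by positivity, fun x hx => ?_, fun x => ?_,
      fun ε x h0 hεδ hx => ?_, fun x hx => ?_⟩
    · have := h1 x hx
      rw [Real.norm_eq_abs] at this
      linarith
    · have := norm_gradient_le hu x
      linarith
    · have := h2 x hx
      have e : quad (u x₁ + ε) p ν a b x₁ x = quad (u x₁) p ν a b x₁ x + ε := by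
        unfold quad
        ring
      rw [e]
      refine (abs_add_le _ _).trans ?_
      rw [Real.norm_eq_abs] at this
      rw [abs_of_nonneg h0]
      linarith
    · have := h3 x hx
      linarith
  obtain ⟨lam, hlam, hell'⟩ := hell M hM0
  have hKc : IsCompact (closedBall x₁ s ×ˢ closedBall (0 : ℝ) M ×ˢ closedBall (0 : Eucl n) M) :=
    (isCompact_closedBall _ _).prod ((isCompact_closedBall _ _).prod (isCompact_closedBall _ _))
  have hKs : closedBall x₁ s ×ˢ closedBall (0 : ℝ) M ×ˢ closedBall (0 : Eucl n) M ⊆ jetDom n :=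
    fun q hq => mem_jetDom (hsub hq.1) _ _
  obtain ⟨CF, hCF⟩ := exists_lipschitzOnWith_of_contDiffOn isOpen_jetDom hF hKc hKs
  obtain ⟨C0, hC0⟩ := exists_lipschitzOnWith_of_contDiffOn isOpen_jetDom hF₀ hKc hKs
  set C := max CF C0
  have hCF' := hCF.weaken (le_max_left CF C0)
  have hC0' := hC0.weaken (le_max_right CF C0)
  set C₂ : ℝ := (C : ℝ) ^ 2 / lam + C with hC₂
  have hC₂0 : 0 ≤ C₂ := by positivity
  obtain ⟨ε, hε, hεδ, hεr, hεs, hεc⟩ : ∃ ε : ℝ, 0 < ε ∧ ε ≤ δ ∧ 2 * ε ≤ r ∧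
      ε ≤ κ * s ^ 2 / 4 ∧ C₂ * (2 * ε) < c₀ := by
    refine ⟨min (min δ (r / 2)) (min (κ * s ^ 2 / 4) (c₀ / (4 * (C₂ + 1)))), by positivity,
      (min_le_left _ _).trans (min_le_left _ _), ?_, (min_le_right _ _).trans (min_le_left _ _),
      ?_⟩
    · have : min (min δ (r / 2)) (min (κ * s ^ 2 / 4) (c₀ / (4 * (C₂ + 1)))) ≤ r / 2 :=
        (min_le_left _ _).trans (min_le_right _ _)
      linarith
    · have : min (min δ (r / 2)) (min (κ * s ^ 2 / 4) (c₀ / (4 * (C₂ + 1)))) ≤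
          c₀ / (4 * (C₂ + 1)) := (min_le_right _ _).trans (min_le_right _ _)
      have h2 := mul_le_mul_of_nonneg_left this hC₂0
      have h3 : C₂ * (c₀ / (4 * (C₂ + 1))) < c₀ / 2 := by
        rw [mul_div_assoc', div_lt_div_iff₀ (by positivity) (by positivity)]
        nlinarith
      linarith
  set φ := quad (u x₁ + ε) p ν a b x₁ with hφ
  set gφ := quadGrad p ν a b x₁ with hgφ
  obtain ⟨Cψ, ψ, hψ, hψ0, hψle, hψs, hψ1, hψeq⟩ := exists_touch_test half hu
    (contDiff_quad (u x₁ + ε) p ν a b x₁) (x₁ := x₁) hs hε hεs (by simp [quad]) hκ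
    (fun x hx hxu => by
      have := htouch x (ball_subset_ball hsr hx) hxu
      unfold quad at this ⊢
      linarith)
  have hψs' : ∀ x, x ∉ closedBall x₁ s → ψ x = 0 := fun x hx =>
    hψs x fun h => hx (ball_subset_closedBall h)
  have hmem : ∀ x, ψ x ≠ 0 → x ∈ ball x₁ s := fun x hx => by
    by_contra h
    exact hx (hψs x h)
  -- the Lipschitz field
  obtain ⟨CG, hCG⟩ := exists_lipschitzOnWith_of_contDiffOn (f := fun x =>
      uncurryF F (quadJet (u x₁ + ε) p ν a b x₁ x)) isOpen_ball
    (hF.comp (contDiff_quadJet (u x₁ + ε) p ν a b x₁).contDiffOn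
      fun x hx => mem_jetDom hx _ _) (isCompact_closedBall x₁ s) hsub
  obtain ⟨G, hG, hGeq⟩ := hCG.extend_finite_dimension
  have hIBP := setIntegral_upper_le half hG hψ hψ0 hψs' (fun hh => by
    rcases hcase hh with h | h
    · exact Or.inl h
    · refine Or.inr fun x hx => ?_
      have hxs := ball_subset_closedBall (hmem x hx)
      rw [← hGeq hxs]
      exact h ε x hε.le hεδ hxs)
  let VF : Eucl n → Eucl n :=
    fun x => (jetDom n).indicator (uncurryF F) (x, u x, gradient u x)
  let V0 : Eucl n → ℝ := fun x => (jetDom n).indicator (uncurryF₀ F₀) (x, u x, gradient u x)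
  let W0 : Eucl n → ℝ := fun x =>
    (jetDom n).indicator (uncurryF₀ F₀) (quadJet (u x₁ + ε) p ν a b x₁ x)
  have hjm : Measurable fun x : Eucl n => (x, u x, gradient u x) :=
    measurable_id.prodMk (hu.continuous.measurable.prodMk (measurable_gradient u))
  have hVF : Measurable VF :=
    (measurable_indicator_of_continuousOn isOpen_jetDom hF.continuousOn).comp hjm
  have hV0 : Measurable V0 :=
    (measurable_indicator_of_continuousOn isOpen_jetDom hF₀.continuousOn).comp hjm
  have hW0 : Measurable W0 :=
    (measurable_indicator_of_continuousOn isOpen_jetDom hF₀.continuousOn).comp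
      (contDiff_quadJet (u x₁ + ε) p ν a b x₁).continuous.measurable
  obtain ⟨BF, hBF⟩ := hKc.exists_bound_of_continuousOn (hF.continuousOn.mono hKs)
  obtain ⟨B0, hB0⟩ := hKc.exists_bound_of_continuousOn (hF₀.continuousOn.mono hKs)
  have hK : ∀ x, ψ x ≠ 0 → (x, u x, gradient u x) ∈
      closedBall x₁ s ×ˢ closedBall (0 : ℝ) M ×ˢ closedBall (0 : Eucl n) M := fun x hx =>
    ⟨ball_subset_closedBall (hmem x hx), by
      simpa using hMu x (ball_subset_closedBall (hmem x hx)), by simpa using hMg x⟩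
  have hK' : ∀ x, ψ x ≠ 0 → quadJet (u x₁ + ε) p ν a b x₁ x ∈
      closedBall x₁ s ×ˢ closedBall (0 : ℝ) M ×ˢ closedBall (0 : Eucl n) M := fun x hx =>
    ⟨ball_subset_closedBall (hmem x hx), by
      simpa [quadJet] using hMφ ε x hε.le hεδ (ball_subset_closedBall (hmem x hx)), by
      simpa [quadJet] using hMφg x (ball_subset_closedBall (hmem x hx))⟩
  have iVF : Integrable fun x => ⟪VF x, gradient ψ x⟫_ℝ :=
    integrable_inner_gradient hψ hψ0 hψs' hVF.aestronglyMeasurable (M := BF) fun x hx => by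
      simp only [VF, Set.indicator_of_mem (hKs (hK x hx))]
      exact hBF _ (hK x hx)
  have iV0 : Integrable fun x => V0 x * ψ x :=
    integrable_mul_of_support hψ hψs' hV0.aestronglyMeasurable (M := B0) fun x hx => by
      simp only [V0, Set.indicator_of_mem (hKs (hK x hx))]
      exact hB0 _ (hK x hx)
  have iW0 : Integrable fun x => W0 x * ψ x :=
    integrable_mul_of_support hψ hψs' hW0.aestronglyMeasurable (M := B0) fun x hx => by
      simp only [W0, Set.indicator_of_mem (hKs (hK' x hx))]
      exact hB0 _ (hK' x hx)
  obtain ⟨BG, hBG⟩ := (isCompact_closedBall x₁ s).exists_bound_of_continuousOn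
    hG.continuous.continuousOn
  have iG : Integrable fun x => ⟪G x, gradient ψ x⟫_ℝ :=
    integrable_inner_gradient hψ hψ0 hψs' hG.continuous.aestronglyMeasurable (M := BG)
      fun x hx => hBG x (ball_subset_closedBall (hmem x hx))
  obtain ⟨BD, hBD⟩ := exists_bound_lipDiv hG
  have iD : Integrable fun x => -lipDiv G x * ψ x :=
    integrable_mul_of_support hψ hψs' (measurable_lipDiv hG).neg.aestronglyMeasurable (M := BD)
      fun x _ => by simpa using hBD x
  have iψ : Integrable ψ := by
    simpa using integrable_mul_of_support hψ hψs' (V := fun _ => (1 : ℝ))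
      aestronglyMeasurable_const (M := 1) fun x _ => by simp
  have hweak : 0 ≤ ∫ x in upper half, (⟪VF x, gradient ψ x⟫_ℝ + V0 x * ψ x) := by
    have h := hw ψ ⟨Cψ, hψ⟩ hψ0 (fun x => (hψle x).trans hεr)
      (fun x hx => hψs x fun h => hx (ball_subset_ball hsr h))
    have e : (fun x => ⟪F x (u x) (gradient u x), gradient ψ x⟫_ℝ +
        F₀ x (u x) (gradient u x) * ψ x) = fun x => ⟪VF x, gradient ψ x⟫_ℝ + V0 x * ψ x := by
      funext x
      by_cases hx : ψ x = 0
      · simp [hx, gradient_eq_zero_of_nonneg hψ0 hx]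
      · simp only [VF, V0, Set.indicator_of_mem (hKs (hK x hx)), uncurryF, uncurryF₀]
    rw [e, ← setIntegral_eq_of_subset_of_forall_sdiff_eq_zero
      ((isOpen_upper' half).measurableSet) Set.inter_subset_left] at h
    · exact h
    · intro x hx
      have hx0 : ψ x = 0 := by
        by_contra h0
        exact hx.2 ⟨hx.1, hsub (ball_subset_closedBall (hmem x h0))⟩
      simp [hx0, gradient_eq_zero_of_nonneg hψ0 hx0]
  have hstep1 : ∫ x in upper half, (⟪VF x, gradient ψ x⟫_ℝ + V0 x * ψ x) ≤
      ∫ x in upper half, (⟪G x, gradient ψ x⟫_ℝ + (W0 x * ψ x + C₂ * (2 * ε) * ψ x)) := by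
    refine setIntegral_mono_on_ae (iVF.add iV0).integrableOn
      (iG.add (iW0.add (iψ.const_mul _))).integrableOn (isOpen_upper' half).measurableSet ?_
    filter_upwards [hψ.ae_differentiableAt, hu.ae_differentiableAt] with x hxψ hxu hxup
    by_cases hx : ψ x = 0
    · simp [hx, gradient_eq_zero_of_nonneg hψ0 hx]
    have hxb := hmem x hx
    have hxc := ball_subset_closedBall hxb
    have hval : ψ x = φ x - u x := by
      have h1 := hψeq x hxb (upper_subset_upperCl half hxup)
      rcases max_choice 0 (φ x - u x) with h | h
      · rw [h] at h1
        exact absurd h1 hx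
      · rw [h] at h1
        exact h1
    have hgr : gradient ψ x = gφ x - gradient u x := by
      have hev : ∀ᶠ y in 𝓝 x, φ y - u y ≤ ψ y := by
        filter_upwards [isOpen_ball.mem_nhds hxb, (isOpen_upper' half).mem_nhds hxup] with y h1 h2
        rw [hψeq y h1 (upper_subset_upperCl half h2)]
        exact le_max_right _ _
      have hgq := hasGradientAt_quad (u x₁ + ε) p ν a b x₁ x
      rw [← gradient_eq_of_touching (hgq.differentiableAt.fun_sub hxu) hxψ hev hval.symm,
        gradient_sub_apply hgq.differentiableAt hxu, hgq.gradient]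
    have hpos : 0 < ψ x := lt_of_le_of_ne (hψ0 x) (Ne.symm hx)
    have hcmp := energy_comparison hlam hF hell' hsub hCF' hC0' hxc (hMu x hxc)
      (hMφ ε x hε.le hεδ hxc) (hMg x) (hMφg x hxc) (by
        rw [hval] at hpos
        exact (sub_pos.1 hpos).le)
    rw [← hφ, ← hgr, ← hval] at hcmp
    have e1 : VF x = F x (u x) (gradient u x) := by
      simp only [VF, Set.indicator_of_mem (hKs (hK x hx)), uncurryF]
    have e2 : V0 x = F₀ x (u x) (gradient u x) := by
      simp only [V0, Set.indicator_of_mem (hKs (hK x hx)), uncurryF₀]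
    have e3 : W0 x = F₀ x (φ x) (gφ x) := by
      simp only [W0, Set.indicator_of_mem (hKs (hK' x hx))]
      rfl
    have e4 : G x = F x (φ x) (gφ x) := by
      rw [← hGeq hxc]
      simp only [uncurryF, quadJet, hφ, hgφ]
    rw [e1, e2, e3, e4]
    have h5 : C₂ * ψ x ^ 2 ≤ C₂ * (2 * ε) * ψ x := by
      rw [sq, mul_assoc]
      exact mul_le_mul_of_nonneg_left (mul_le_mul_of_nonneg_right (hψle x) (hψ0 x)) hC₂0
    rw [← hC₂] at hcmp
    linarith
  have hstep2 : ∫ x in upper half, (⟪G x, gradient ψ x⟫_ℝ + (W0 x * ψ x + C₂ * (2 * ε) * ψ x)) ≤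
      ∫ x in upper half, (-lipDiv G x * ψ x + (W0 x * ψ x + C₂ * (2 * ε) * ψ x)) := by
    have iR : Integrable fun x => W0 x * ψ x + C₂ * (2 * ε) * ψ x := iW0.add (iψ.const_mul _)
    rw [integral_add iG.integrableOn iR.integrableOn, integral_add iD.integrableOn iR.integrableOn]
    linarith
  have hstep3 : ∫ x in upper half, (-lipDiv G x * ψ x + (W0 x * ψ x + C₂ * (2 * ε) * ψ x)) ≤
      ∫ x in upper half, (C₂ * (2 * ε) - c₀) * ψ x := by
    refine setIntegral_mono_on (iD.add (iW0.add (iψ.const_mul _))).integrableOn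
      (iψ.const_mul _).integrableOn (isOpen_upper' half).measurableSet fun x _ => ?_
    by_cases hx : ψ x = 0
    · simp [hx]
    have hxb := hmem x hx
    have hev : G =ᶠ[𝓝 x] fun x => uncurryF F (quadJet (u x₁ + ε) p ν a b x₁ x) := by
      filter_upwards [isOpen_ball.mem_nhds hxb] with y hy
      exact (hGeq (ball_subset_closedBall hy)).symm
    have h1 := hneg ε x hε.le hεδ (ball_subset_closedBall hxb)
    rw [lipDiv_eq_jetDiv hF _ p ν a b x₁ x (hsub (ball_subset_closedBall hxb)) hev]
    have e3 : W0 x = uncurryF₀ F₀ (quadJet (u x₁ + ε) p ν a b x₁ x) := by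
      simp only [W0, Set.indicator_of_mem (hKs (hK' x hx))]
    rw [e3]
    nlinarith [mul_le_mul_of_nonneg_right h1 (hψ0 x)]
  have hpos : 0 < ∫ x in upper half, ψ x :=
    setIntegral_pos_of_pos hψ.continuous hψ0 hψs' hx₁' hψ1
  rw [integral_const_mul] at hstep3
  have : (C₂ * (2 * ε) - c₀) * ∫ x in upper half, ψ x < 0 :=
    mul_neg_of_neg_of_pos (by linarith) hpos
  linarith

/-- Touching from below, at `x₁`, by a quadratic polynomial with Hessian `2 a ν⊗ν - 2 b`. -/
def TouchBelow (half : Prop) (U : Eucl n → ℝ) (x₁ p ν : Eucl n) (a b : ℝ) : Prop :=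
  ∃ r : ℝ, 0 < r ∧ ∀ x ∈ ball x₁ r, x ∈ (upperCl half : Set (Eucl n)) →
    quad (U x₁) p ν a b x₁ x ≤ U x

lemma LocalWeak.mono {half : Prop} {F : Eucl n → ℝ → Eucl n → Eucl n}
    {F₀ : Eucl n → ℝ → Eucl n → ℝ} {u : Eucl n → ℝ} {x₁ : Eucl n} {r r' : ℝ}
    (h : LocalWeak half F F₀ u x₁ r) (hr : r' ≤ r) : LocalWeak half F F₀ u x₁ r' :=
  fun ψ hL h0 hle hs => h ψ hL h0 (fun x => (hle x).trans hr)
    fun x hx => hs x fun hx' => hx (ball_subset_ball hr hx')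

lemma fderiv_uncurryF_snd {F : Eucl n → ℝ → Eucl n → Eucl n}
    (hF : ContDiffOn ℝ 1 (uncurryF F) (jetDom n)) {x : Eucl n} (hx : x ∈ ball (0 : Eucl n) 1)
    (z : ℝ) (p v : Eucl n) :
    fderiv ℝ (uncurryF F) (x, z, p) (0, 0, v) = fderiv ℝ (F x z) p v := by
  have h1 : DifferentiableAt ℝ (uncurryF F) (x, z, p) :=
    (hF.contDiffAt (isOpen_jetDom.mem_nhds (mem_jetDom hx z p))).differentiableAt (by simp)
  have h2 : HasFDerivAt (fun q : Eucl n => (x, z, q)) ((0 : Eucl n →L[ℝ] Eucl n).prod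
      ((0 : Eucl n →L[ℝ] ℝ).prod (ContinuousLinearMap.id ℝ (Eucl n)))) p :=
    (hasFDerivAt_const x p).prodMk
      (HasFDerivAt.prodMk (f₂ := fun q => q) (hasFDerivAt_const z p) (hasFDerivAt_id p))
  have h3 : HasFDerivAt (F x z) ((fderiv ℝ (uncurryF F) (x, z, p)).comp _) p :=
    HasFDerivAt.comp (g := uncurryF F) (f := fun q : Eucl n => (x, z, q)) p h1.hasFDerivAt h2
  rw [h3.fderiv]
  simp

lemma inner_eq_sum_coord (v ν : Eucl n) : ⟪v, ν⟫_ℝ = ∑ i, ν i * v i := by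
  simp [PiLp.inner_apply]

lemma jetDiv_eq {F : Eucl n → ℝ → Eucl n → Eucl n}
    (hF : ContDiffOn ℝ 1 (uncurryF F) (jetDom n)) {x : Eucl n} (hx : x ∈ ball (0 : Eucl n) 1)
    (z : ℝ) (p ν : Eucl n) (a b : ℝ) :
    jetDiv F a b ν (x, z, p) =
      (∑ i, fderiv ℝ (uncurryF F) (x, z, p) (EuclideanSpace.single i 1, p i, 0) i) +
        2 * a * ⟪fderiv ℝ (F x z) p ν, ν⟫_ℝ -
        2 * b * ∑ i, fderiv ℝ (uncurryF F) (x, z, p) (0, 0, EuclideanSpace.single i 1) i := by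
  rw [inner_eq_sum_coord, Finset.mul_sum, Finset.mul_sum, ← Finset.sum_add_distrib,
    ← Finset.sum_sub_distrib]
  refine Finset.sum_congr rfl fun i _ => ?_
  rw [← fderiv_uncurryF_snd hF hx]
  have e : ((EuclideanSpace.single i 1, p i,
      (2 * a * ν i) • ν - (2 * b) • EuclideanSpace.single i (1 : ℝ)) : Eucl n × ℝ × Eucl n) =
      (EuclideanSpace.single i 1, p i, 0) + (2 * a * ν i) • ((0, 0, ν) : Eucl n × ℝ × Eucl n) -
        (2 * b) • ((0, 0, EuclideanSpace.single i 1) : Eucl n × ℝ × Eucl n) := by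
    simp
  simp only
  rw [e, map_sub, map_add, map_smul, map_smul]
  simp
  ring

lemma exists_jetDiv_bound {F : Eucl n → ℝ → Eucl n → Eucl n} {F₀ : Eucl n → ℝ → Eucl n → ℝ}
    (hF : ContDiffOn ℝ 1 (uncurryF F) (jetDom n))
    (hF₀ : ContDiffOn ℝ 1 (uncurryF₀ F₀) (jetDom n)) (hell : H1 F) {z₀ : Eucl n} {ρ : ℝ}
    (hρ : closedBall z₀ ρ ⊆ ball 0 1) {M : ℝ} (hM : 0 < M) :
    ∃ lam Lam C₀ : ℝ, 0 < lam ∧ 0 ≤ Lam ∧ 0 ≤ C₀ ∧ ∀ x ∈ closedBall z₀ ρ, ∀ z p ν a b,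
      |z| ≤ M → ‖p‖ ≤ M → ‖ν‖ = 1 → 0 ≤ a → 0 ≤ b →
      lam * a - Lam * b - C₀ ≤ jetDiv F a b ν (x, z, p) - F₀ x z p := by
  obtain ⟨lam, hlam, hell'⟩ := hell M hM
  have hKc : IsCompact (closedBall z₀ ρ ×ˢ closedBall (0 : ℝ) M ×ˢ closedBall (0 : Eucl n) M) :=
    (isCompact_closedBall _ _).prod ((isCompact_closedBall _ _).prod (isCompact_closedBall _ _))
  have hKs : closedBall z₀ ρ ×ˢ closedBall (0 : ℝ) M ×ˢ closedBall (0 : Eucl n) M ⊆ jetDom n :=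
    fun q hq => mem_jetDom (hρ hq.1) _ _
  obtain ⟨B, hB⟩ := hKc.exists_bound_of_continuousOn
    ((hF.continuousOn_fderiv_of_isOpen isOpen_jetDom le_rfl).mono hKs)
  obtain ⟨B0, hB0⟩ := hKc.exists_bound_of_continuousOn (hF₀.continuousOn.mono hKs)
  refine ⟨2 * lam, 2 * ((n + 1) * |B|), (n + 1) * (|B| * (1 + M)) + |B0|, by positivity,
    by positivity, by positivity, fun x hx z p ν a b hz hp hν ha hb => ?_⟩
  have hq : (x, z, p) ∈ closedBall z₀ ρ ×ˢ closedBall (0 : ℝ) M ×ˢ closedBall (0 : Eucl n) M :=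
    ⟨hx, by simpa using hz, by simpa using hp⟩
  have hcoord : ∀ (i : Fin (n + 1)) (w : Eucl n × ℝ × Eucl n),
      |fderiv ℝ (uncurryF F) (x, z, p) w i| ≤ |B| * ‖w‖ := fun i w => by
    refine (PiLp.norm_apply_le (p := 2) (fderiv ℝ (uncurryF F) (x, z, p) w) i).trans ?_
    refine (ContinuousLinearMap.le_opNorm _ _).trans ?_
    exact mul_le_mul_of_nonneg_right ((hB _ hq).trans (le_abs_self _)) (norm_nonneg _)
  have h1 : |∑ i, fderiv ℝ (uncurryF F) (x, z, p) (EuclideanSpace.single i 1, p i, 0) i| ≤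
      (n + 1) * (|B| * (1 + M)) := by
    refine (Finset.abs_sum_le_sum_abs _ _).trans ?_
    refine (Finset.sum_le_card_nsmul _ _ (|B| * (1 + M)) fun i _ => ?_).trans (by simp)
    refine (hcoord i _).trans (mul_le_mul_of_nonneg_left ?_ (abs_nonneg _))
    have : |p i| ≤ M := (PiLp.norm_apply_le (p := 2) p i).trans hp
    simp only [Prod.norm_def, Real.norm_eq_abs]
    refine max_le ?_ (max_le (by linarith) (by simp; linarith))
    simp
    linarith
  have h2 : |∑ i, fderiv ℝ (uncurryF F) (x, z, p) (0, 0, EuclideanSpace.single i 1) i| ≤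
      (n + 1) * |B| := by
    refine (Finset.abs_sum_le_sum_abs _ _).trans ?_
    refine (Finset.sum_le_card_nsmul _ _ |B| fun i _ => ?_).trans (by simp)
    refine (hcoord i _).trans ?_
    simp [Prod.norm_def]
  have h3 := hell' x (hρ hx) z hz p hp ν
  rw [hν] at h3
  have h4 : |F₀ x z p| ≤ |B0| := (hB0 _ hq).trans (le_abs_self _)
  rw [jetDiv_eq hF (hρ hx)]
  have h5 := mul_le_mul_of_nonneg_left (abs_le.1 h2).2 hb
  have h6 := mul_le_mul_of_nonneg_left h3 ha
  have h7 := (abs_le.1 h1).1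
  have h8 := (abs_le.1 h4).2
  linarith

lemma touch_bound {F : Eucl n → ℝ → Eucl n → Eucl n} {F₀ : Eucl n → ℝ → Eucl n → ℝ}
    (hF : ContDiffOn ℝ 1 (uncurryF F) (jetDom n))
    (hF₀ : ContDiffOn ℝ 1 (uncurryF₀ F₀) (jetDom n)) (hell : H1 F) {half : Prop}
    {u : Eucl n → ℝ} {L : ℝ≥0} (hu : LipschitzWith L u) {z₀ : Eucl n} {ρ : ℝ}
    (hρ : closedBall z₀ ρ ⊆ ball 0 1) (P : ℝ) :
    ∃ lam Lam C₀ : ℝ, 0 < lam ∧ 0 ≤ Lam ∧ 0 ≤ C₀ ∧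
      ∀ x₁ ∈ closedBall z₀ ρ, x₁ ∈ (upperCl half : Set (Eucl n)) → ∀ p ν a b,
      ‖p‖ ≤ P → ‖ν‖ = 1 → 0 ≤ a → 0 ≤ b → (∃ r, 0 < r ∧ LocalWeak half F F₀ u x₁ r) →
      (half → x₁ (Fin.last n) = 0 → 0 < F x₁ (u x₁) p (Fin.last n)) →
      TouchBelow half u x₁ p ν a b → lam * a ≤ Lam * b + C₀ := by
  obtain ⟨B, hB⟩ := (isCompact_closedBall z₀ ρ).exists_bound_of_continuousOn
    hu.continuous.continuousOn
  obtain ⟨lam, Lam, C₀, hlam, hLam, hC₀, h⟩ := exists_jetDiv_bound hF hF₀ hell hρ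
    (M := |B| + |P| + 1) (by positivity)
  refine ⟨lam, Lam, C₀, hlam, hLam, hC₀, ?_⟩
  rintro x₁ hx₁ hx₁' p ν a b hp hν ha hb ⟨r, hr, hw⟩ hflux ⟨r', hr', ht⟩
  by_contra! hcon
  obtain ⟨κ, hκ, hκ'⟩ : ∃ κ : ℝ, 0 < κ ∧ Lam * (b + κ) + C₀ < lam * a := by
    refine ⟨(lam * a - (Lam * b + C₀)) / (2 * (Lam + 1)), div_pos (by linarith) (by positivity),
      ?_⟩
    have h1 : Lam * ((lam * a - (Lam * b + C₀)) / (2 * (Lam + 1))) <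
        lam * a - (Lam * b + C₀) := by
      rw [mul_div_assoc', div_lt_iff₀ (by positivity)]
      nlinarith
    linarith
  have hj := h x₁ hx₁ (u x₁) p ν a (b + κ)
    (by have := hB x₁ hx₁; rw [Real.norm_eq_abs] at this
        linarith [le_abs_self B, abs_nonneg P])
    (by linarith [le_abs_self P, abs_nonneg B]) hν ha (by positivity)
  refine not_touch_of_strict hF hF₀ hell hu (hρ hx₁) hx₁' (lt_min hr hr')
    (hw.mono (min_le_left _ _)) hκ (fun x hx hxu => ?_) hflux
    (a := a) (b := b + κ) (ν := ν) (by linarith)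
  have := ht x (ball_subset_ball (min_le_right _ _) hx) hxu
  unfold quad at this ⊢
  linarith

/-- The blow-up of `u` at `y` at scale `t`. -/
def resc (u : Eucl n → ℝ) (y : Eucl n) (t : ℝ) (x : Eucl n) : ℝ := u (y + t • x) / t

lemma TouchBelow.of_resc {half : Prop} {u : Eucl n → ℝ} {y : Eucl n} {t : ℝ} (ht : 0 < t)
    (hy : y (Fin.last n) = 0) {x₁ p ν : Eucl n} {a b : ℝ}
    (h : TouchBelow half (resc u y t) x₁ p ν a b) :
    TouchBelow half u (y + t • x₁) p ν (a / t) (b / t) := by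
  obtain ⟨r, hr, h⟩ := h
  refine ⟨t * r, by positivity, fun x hx hxu => ?_⟩
  set w := t⁻¹ • (x - y) with hw
  have hxw : x = y + t • w := by
    rw [hw, smul_inv_smul₀ ht.ne']
    abel
  have hξ : x - (y + t • x₁) = t • (w - x₁) := by
    rw [hxw, smul_sub]
    abel
  have hwb : w ∈ ball x₁ r := by
    rw [mem_ball, dist_eq_norm, hξ, norm_smul, Real.norm_of_nonneg ht.le] at hx
    rw [mem_ball, dist_eq_norm]
    exact lt_of_mul_lt_mul_left hx ht.le
  have h1 := h w hwb fun hh => by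
    have := hxu hh
    simp only [hw, PiLp.smul_apply, PiLp.sub_apply, hy, smul_eq_mul, sub_zero]
    positivity
  unfold quad resc at h1
  unfold quad
  rw [← hxw] at h1
  rw [hξ, inner_smul_right, inner_smul_right, norm_smul, Real.norm_of_nonneg ht.le]
  rw [le_div_iff₀ ht] at h1
  refine le_trans (le_of_eq ?_) h1
  field_simp

lemma resc_touch_bound {F : Eucl n → ℝ → Eucl n → Eucl n} {F₀ : Eucl n → ℝ → Eucl n → ℝ}
    (hF : ContDiffOn ℝ 1 (uncurryF F) (jetDom n))
    (hF₀ : ContDiffOn ℝ 1 (uncurryF₀ F₀) (jetDom n)) (hell : H1 F) {half : Prop}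
    {u : Eucl n → ℝ} {L : ℝ≥0} (hu : LipschitzWith L u) {z₀ : Eucl n}
    (hz₀ : z₀ ∈ ball (0 : Eucl n) 1) (P : ℝ) :
    ∃ lam Lam : ℝ, 0 < lam ∧ 0 ≤ Lam ∧ ∀ {ι : Type} (l : Filter ι) (y : ι → Eucl n) (t : ι → ℝ),
      (∀ k, y k (Fin.last n) = 0) → (∀ᶠ k in l, 0 < t k) → Tendsto y l (𝓝 z₀) → Tendsto t l (𝓝 0) →
      ∀ R c : ℝ, 0 < c → ∀ᶠ k in l, ∀ x₁ : Eucl n, ‖x₁‖ ≤ R →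
      x₁ ∈ (upperCl half : Set (Eucl n)) → ∀ p ν a b,
      ‖p‖ ≤ P → ‖ν‖ = 1 → 0 ≤ a → 0 ≤ b →
      (∃ r, 0 < r ∧ LocalWeak half F F₀ u (y k + t k • x₁) r) →
      (half → x₁ (Fin.last n) = 0 →
        0 < F (y k + t k • x₁) (u (y k + t k • x₁)) p (Fin.last n)) →
      TouchBelow half (resc u (y k) (t k)) x₁ p ν a b → lam * a ≤ Lam * b + c := by
  obtain ⟨ρ, hρ0, hρ⟩ := nhds_basis_closedBall.mem_iff.1 (isOpen_ball.mem_nhds hz₀)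
  obtain ⟨lam, Lam, C₀, hlam, hLam, hC₀, h⟩ := touch_bound hF hF₀ hell (half := half) hu hρ P
  refine ⟨lam, Lam, hlam, hLam, fun l y t hy ht hyl htl R c hc => ?_⟩
  have e1 : ∀ᶠ k in l, dist (y k) z₀ < ρ / 2 := hyl.eventually (ball_mem_nhds z₀ (by positivity))
  have e2 : ∀ᶠ k in l, t k < min (ρ / 2 / (|R| + 1)) (c / (C₀ + 1)) :=
    htl.eventually (eventually_lt_nhds (by positivity))
  filter_upwards [e1, e2, ht] with k h1 h2 htk x₁ hx₁ hxu p ν a b hp hν ha hb hw hflux htouch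
  have h3 := h (y k + t k • x₁) (by
      rw [mem_closedBall, dist_eq_norm]
      have e : y k + t k • x₁ - z₀ = (y k - z₀) + t k • x₁ := by abel
      rw [e]
      refine (norm_add_le _ _).trans ?_
      rw [← dist_eq_norm, norm_smul, Real.norm_of_nonneg htk.le]
      have h4 : t k * ‖x₁‖ ≤ ρ / 2 := by
        have h5 := h2.trans_le (min_le_left _ _)
        rw [lt_div_iff₀ (by positivity)] at h5
        have h6 : ‖x₁‖ ≤ |R| + 1 := by linarith [le_abs_self R]
        exact (mul_le_mul_of_nonneg_left h6 htk.le).trans h5.le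
      linarith) (fun hh => by
      have := hxu hh
      simp only [PiLp.add_apply, PiLp.smul_apply, hy, zero_add, smul_eq_mul]
      positivity) p ν (a / t k) (b / t k) hp hν (by positivity) (by positivity) hw
      (fun hh h0 => hflux hh (by
        simpa [hy k, htk.ne'] using h0)) (htouch.of_resc htk (hy k))
  have h5 := h2.trans_le (min_le_right _ _)
  rw [lt_div_iff₀ (by positivity)] at h5
  have h6 := mul_le_mul_of_nonneg_right h3 htk.le
  have e1 : lam * (a / t k) * t k = lam * a := by field_simp
  have e2 : (Lam * (b / t k) + C₀) * t k = Lam * b + C₀ * t k := by field_simp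
  rw [e1, e2] at h6
  linarith

/-- The operator governing `-u`. -/
def negF (F : Eucl n → ℝ → Eucl n → Eucl n) (x : Eucl n) (z : ℝ) (p : Eucl n) : Eucl n :=
  -F x (-z) (-p)

/-- The lower order term governing `-u`. -/
def negF₀ (F₀ : Eucl n → ℝ → Eucl n → ℝ) (x : Eucl n) (z : ℝ) (p : Eucl n) : ℝ :=
  -F₀ x (-z) (-p)

lemma contDiffOn_reflect : ContDiff ℝ 1
    (fun q : Eucl n × ℝ × Eucl n => (q.1, -q.2.1, -q.2.2)) :=
  contDiff_fst.prodMk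
    ((contDiff_fst.comp contDiff_snd).neg.prodMk (contDiff_snd.comp contDiff_snd).neg)

lemma contDiffOn_negF {F : Eucl n → ℝ → Eucl n → Eucl n}
    (hF : ContDiffOn ℝ 1 (uncurryF F) (jetDom n)) :
    ContDiffOn ℝ 1 (uncurryF (negF F)) (jetDom n) :=
  (hF.comp contDiffOn_reflect.contDiffOn fun _ hq => mem_jetDom hq.1 _ _).neg

lemma contDiffOn_negF₀ {F₀ : Eucl n → ℝ → Eucl n → ℝ}
    (hF₀ : ContDiffOn ℝ 1 (uncurryF₀ F₀) (jetDom n)) :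
    ContDiffOn ℝ 1 (uncurryF₀ (negF₀ F₀)) (jetDom n) :=
  (hF₀.comp contDiffOn_reflect.contDiffOn fun _ hq => mem_jetDom hq.1 _ _).neg

lemma fderiv_negF (F : Eucl n → ℝ → Eucl n → Eucl n) (x : Eucl n) (z : ℝ) (p : Eucl n) :
    fderiv ℝ (negF F x z) p = fderiv ℝ (F x (-z)) (-p) := by
  have h : negF F x z = fun p => -(fun q => F x (-z) ((-1 : ℝ) • q)) p := by
    funext p
    simp [negF]
  rw [h, fderiv_fun_neg, fderiv_comp_smul]
  simp

lemma h1_negF {F : Eucl n → ℝ → Eucl n → Eucl n} (hell : H1 F) : H1 (negF F) := by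
  intro M hM
  obtain ⟨lam, hlam, h⟩ := hell M hM
  refine ⟨lam, hlam, fun x hx z hz p hp ξ => ?_⟩
  rw [fderiv_negF]
  exact h x hx (-z) (by rwa [abs_neg]) (-p) (by rwa [norm_neg]) ξ

/-- Globally Lipschitz functions satisfying the variational inequality of the thin obstacle
problem (`half` false) or of the boundary obstacle problem (`half` true). -/
structure WeakSol (half : Prop) (F : Eucl n → ℝ → Eucl n → Eucl n)
    (F₀ : Eucl n → ℝ → Eucl n → ℝ) (u : Eucl n → ℝ) (L : ℝ≥0) : Prop where
  lip : LipschitzWith L u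
  nonneg : ∀ x ∈ tBall (0 : Eucl n) 1, 0 ≤ u x
  weak : ∀ ψ : Eucl n → ℝ, (∃ C : ℝ≥0, LipschitzWith C ψ) →
    (∃ ρ : ℝ, ρ < 1 ∧ ∀ x, x ∉ ball (0 : Eucl n) ρ → ψ x = 0) →
    (∀ x ∈ tBall (0 : Eucl n) 1, 0 ≤ u x + ψ x) →
    0 ≤ ∫ x in upper half ∩ ball (0 : Eucl n) 1,
      (⟪F x (u x) (gradient u x), gradient ψ x⟫_ℝ + F₀ x (u x) (gradient u x) * ψ x)

section

variable {half : Prop} {F : Eucl n → ℝ → Eucl n → Eucl n} {F₀ : Eucl n → ℝ → Eucl n → ℝ}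
  {u : Eucl n → ℝ} {L : ℝ≥0}

lemma WeakSol.localWeak (S : WeakSol half F F₀ u L) {x₁ : Eucl n}
    (hx₁ : x₁ ∈ ball (0 : Eucl n) 1) : ∃ r, 0 < r ∧ LocalWeak half F F₀ u x₁ r := by
  rw [mem_ball_zero_iff] at hx₁
  refine ⟨(1 - ‖x₁‖) / 2, by linarith, fun ψ hL h0 _ hs => S.weak ψ hL
    ⟨(1 + ‖x₁‖) / 2, by linarith, fun x hx => hs x fun hx' => hx ?_⟩
    fun x hx => add_nonneg (S.nonneg x hx) (h0 x)⟩
  rw [mem_ball, dist_eq_norm] at hx'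
  rw [mem_ball_zero_iff]
  have := norm_sub_norm_le x x₁
  linarith

lemma WeakSol.localWeak_neg (S : WeakSol half F F₀ u L) {x₁ : Eucl n}
    (hx₁ : x₁ ∈ ball (0 : Eucl n) 1) (hpos : x₁ (Fin.last n) = 0 → 0 < u x₁) :
    ∃ r, 0 < r ∧ LocalWeak half (negF F) (negF₀ F₀) (fun x => -u x) x₁ r := by
  rw [mem_ball_zero_iff] at hx₁
  obtain ⟨r, hr, hr'⟩ : ∃ r, 0 < r ∧ ∀ x ∈ ball x₁ r, x (Fin.last n) = 0 → r ≤ u x := by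
    by_cases h : x₁ (Fin.last n) = 0
    · have h1 := hpos h
      obtain ⟨r, hr, hr'⟩ := Metric.eventually_nhds_iff_ball.1
        (S.lip.continuous.continuousAt.eventually (eventually_gt_nhds (half_lt_self h1)))
      exact ⟨min r (u x₁ / 2), lt_min hr (by linarith), fun x hx _ =>
        (min_le_right _ _).trans (hr' x (ball_subset_ball (min_le_left _ _) hx)).le⟩
    · obtain ⟨r, hr, hr'⟩ := Metric.eventually_nhds_iff_ball.1
        ((continuous_last (n := n)).continuousAt.eventually (isOpen_ne.mem_nhds h))
      exact ⟨r, hr, fun x hx h0 => absurd h0 (hr' x hx)⟩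
  refine ⟨min r ((1 - ‖x₁‖) / 2), lt_min hr (by linarith), fun ψ hL h0 hle hs => ?_⟩
  obtain ⟨C, hC⟩ := hL
  have h1 := S.weak (fun x => -ψ x) ⟨C, hC.neg⟩
    ⟨(1 + ‖x₁‖) / 2, by linarith, fun x hx => by
      rw [hs x fun hx' => hx ?_, neg_zero]
      have hx' := ball_subset_ball (min_le_right _ _) hx'
      rw [mem_ball, dist_eq_norm] at hx'
      rw [mem_ball_zero_iff]
      have := norm_sub_norm_le x x₁
      linarith⟩ fun x hx => by
      by_cases hx' : x ∈ ball x₁ (min r ((1 - ‖x₁‖) / 2))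
      · have h2 := hr' x (ball_subset_ball (min_le_left _ _) hx') hx.2
        have h3 := (hle x).trans (min_le_left _ _)
        linarith
      · rw [hs x hx']
        simpa using S.nonneg x hx
  refine h1.trans (le_of_eq (integral_congr_ae (Eventually.of_forall fun x => ?_)))
  simp only [gradient_neg_apply, negF, negF₀, neg_neg, inner_neg_left, inner_neg_right]
  ring

end

/-- Quadratic polynomials touching `U` from below inside `upperCl half`, with slope allowed by
`Φ`, cannot be too convex. -/
def Touchable (half : Prop) (Φ : Eucl n → Eucl n → Prop) (U : Eucl n → ℝ)
    (R P lam Lam c : ℝ) : Prop :=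
  ∀ x₁ : Eucl n, ‖x₁‖ ≤ R → x₁ ∈ (upperCl half : Set (Eucl n)) → ∀ p ν a b,
    ‖p‖ ≤ P → ‖ν‖ = 1 → 0 ≤ a → 0 ≤ b → Φ x₁ p →
    TouchBelow half U x₁ p ν a b → lam * a ≤ Lam * b + c

lemma quad_recenter (c : ℝ) (p ν : Eucl n) (a b : ℝ) (y x₁ x : Eucl n) :
    quad c p ν a b y x =
      quad (quad c p ν a b y x₁) (quadGrad p ν a b y x₁) ν a b x₁ x := by
  have e : x - y = (x - x₁) + (x₁ - y) := by abel
  unfold quad quadGrad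
  rw [e]
  generalize x - x₁ = v
  generalize x₁ - y = w
  rw [norm_add_sq_real]
  simp only [inner_add_left, inner_sub_left, inner_add_right, real_inner_smul_left]
  rw [real_inner_comm v w]
  ring

lemma Touchable.quad_le {half : Prop} {Φ : Eucl n → Eucl n → Prop} {U : Eucl n → ℝ}
    {R P lam Lam c : ℝ} (hT : Touchable half Φ U R P lam Lam c) (hU : Continuous U)
    {Q : Set (Eucl n)} (hQ : IsCompact Q) {c₀ a b : ℝ} {p ν y : Eucl n} (hν : ‖ν‖ = 1)
    (ha : 0 ≤ a) (hb : 0 ≤ b) (hlt : Lam * b + c < lam * a)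
    (h : ∀ x ∈ Q, U x < quad c₀ p ν a b y x → x ∈ (upperCl half : Set (Eucl n)) ∧
      (∃ r, 0 < r ∧ ball x r ∩ upperCl half ⊆ Q) ∧ ‖x‖ ≤ R ∧
      ‖quadGrad p ν a b y x‖ ≤ P ∧ Φ x (quadGrad p ν a b y x)) :
    ∀ x ∈ Q, quad c₀ p ν a b y x ≤ U x := by
  intro x hx
  by_contra! hcon
  obtain ⟨x₁, hx₁, hmin⟩ := hQ.exists_isMinOn ⟨x, hx⟩
    (f := fun x => U x - quad c₀ p ν a b y x)
    (hU.sub (contDiff_quad c₀ p ν a b y).continuous).continuousOn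
  have h1 : U x₁ - quad c₀ p ν a b y x₁ ≤ U x - quad c₀ p ν a b y x := hmin hx
  obtain ⟨h2, ⟨r, hr, hrQ⟩, h3, h4, h5⟩ := h x₁ hx₁ (by linarith)
  have := hT x₁ h3 h2 _ ν a b h4 hν ha hb h5 ⟨r, hr, fun z hz hzu => by
    have h6 : U x₁ - quad c₀ p ν a b y x₁ ≤ U z - quad c₀ p ν a b y z := hmin (hrQ ⟨hz, hzu⟩)
    rw [quad_recenter c₀ p ν a b y x₁ z] at h6
    unfold quad at h6 ⊢
    linarith⟩
  linarith

lemma lipschitzWith_resc {u : Eucl n → ℝ} {L : ℝ≥0} (hu : LipschitzWith L u) (y : Eucl n)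
    (t : ℝ) : LipschitzWith L (resc u y t) := by
  refine LipschitzWith.of_dist_le_mul fun x x' => ?_
  rcases eq_or_ne t 0 with rfl | ht
  · simpa [resc] using mul_nonneg L.coe_nonneg dist_nonneg
  · have h := hu.dist_le_mul (y + t • x) (y + t • x')
    rw [dist_add_left, dist_smul₀, Real.norm_eq_abs] at h
    rw [Real.dist_eq] at h ⊢
    unfold resc
    rw [← sub_div, abs_div, div_le_iff₀ (abs_pos.2 ht)]
    linarith

lemma neg_resc (u : Eucl n → ℝ) (y : Eucl n) (t : ℝ) :
    (fun x => -resc u y t x) = resc (fun x => -u x) y t := by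
  funext x
  simp [resc, neg_div]

/-- `W` is the pointwise limit along `l` of the blow-ups of `u` at `y k → z₀` and scales
`t k → 0⁺`. -/
structure BlowUp (u : Eucl n → ℝ) (z₀ : Eucl n) {ι : Type} (l : Filter ι) (y : ι → Eucl n)
    (t : ι → ℝ) (W : Eucl n → ℝ) : Prop where
  thin : ∀ k, y k (Fin.last n) = 0
  pos : ∀ᶠ k in l, 0 < t k
  ylim : Tendsto y l (𝓝 z₀)
  tlim : Tendsto t l (𝓝 0)
  lim : ∀ x, Tendsto (fun k => resc u (y k) (t k) x) l (𝓝 (W x))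

lemma exists_lim_of_lipschitz {ι : Type} (l : Ultrafilter ι) {L : ℝ≥0} {U : ι → Eucl n → ℝ}
    (hU : ∀ k, LipschitzWith L (U k)) {C : ℝ} (hC : ∀ᶠ k in l, |U k 0| ≤ C) :
    ∃ W : Eucl n → ℝ, ∀ x, Tendsto (fun k => U k x) l (𝓝 (W x)) := by
  have h : ∀ x, ∃ w, Tendsto (fun k => U k x) l (𝓝 w) := fun x => by
    have h1 : ∀ᶠ k in l, U k x ∈ closedBall (0 : ℝ) (C + L * ‖x‖) := hC.mono fun k hk => by
      have := (hU k).dist_le_mul x 0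
      rw [dist_zero_right, Real.dist_eq] at this
      rw [mem_closedBall_zero_iff, Real.norm_eq_abs]
      have h2 := abs_sub_abs_le_abs_sub (U k x) (U k 0)
      linarith
    obtain ⟨w, -, hw⟩ := (isCompact_closedBall (0 : ℝ) (C + L * ‖x‖)).ultrafilter_le_nhds
      (l.map fun k => U k x) (Filter.le_principal_iff.2 h1)
    exact ⟨w, hw⟩
  choose W hW using h
  exact ⟨W, hW⟩

section

variable {ι : Type} {l : Filter ι} {L : ℝ≥0} {u W : Eucl n → ℝ} {z₀ : Eucl n} {y : ι → Eucl n}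
  {t : ι → ℝ}

lemma BlowUp.lip [l.NeBot] (B : BlowUp u z₀ l y t W) (hu : LipschitzWith L u) :
    LipschitzWith L W :=
  LipschitzWith.of_dist_le_mul fun x x' =>
    le_of_tendsto ((B.lim x).dist (B.lim x')) (Eventually.of_forall fun k =>
      (lipschitzWith_resc hu (y k) (t k)).dist_le_mul x x')

lemma BlowUp.uniform [l.NeBot] (B : BlowUp u z₀ l y t W) (hu : LipschitzWith L u)
    {Q : Set (Eucl n)} (hQ : IsCompact Q) {η : ℝ} (hη : 0 < η) :
    ∀ᶠ k in l, ∀ x ∈ Q, |resc u (y k) (t k) x - W x| < η := by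
  refine hQ.induction_on (p := fun s => ∀ᶠ k in l, ∀ x ∈ s, |resc u (y k) (t k) x - W x| < η)
    (by simp) (fun s s' hss h => h.mono fun k hk x hx => hk x (hss hx))
    (fun s s' h h' => by
      filter_upwards [h, h'] with k h1 h2 x hx using hx.elim (h1 x) (h2 x)) fun x₀ _ => ?_
  refine ⟨ball x₀ (η / (3 * (L + 1))), mem_nhdsWithin_of_mem_nhds
    (ball_mem_nhds _ (by positivity)), ?_⟩
  have h1 := (tendsto_iff_dist_tendsto_zero.1 (B.lim x₀)).eventually
    (eventually_lt_nhds (show 0 < η / 3 by positivity))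
  filter_upwards [h1] with k hk x hx
  have h2 := (lipschitzWith_resc hu (y k) (t k)).dist_le_mul x x₀
  have h3 := (B.lip hu).dist_le_mul x x₀
  have h4 : L * dist x x₀ ≤ η / 3 := by
    rw [mem_ball, lt_div_iff₀ (by positivity)] at hx
    have := dist_nonneg (x := x) (y := x₀)
    nlinarith
  rw [Real.dist_eq] at hk h2 h3
  rw [abs_lt] at hk ⊢
  have h5 := abs_le.1 (h2.trans h4)
  have h6 := abs_le.1 (h3.trans h4)
  constructor <;> linarith [h5.1, h5.2, h6.1, h6.2]

lemma BlowUp.eventually_mem_ball (B : BlowUp u z₀ l y t W) (hz₀ : z₀ ∈ ball (0 : Eucl n) 1)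
    (R : ℝ) {ε : ℝ} (hε : 0 < ε) :
    ∀ᶠ k in l, ∀ x : Eucl n, ‖x‖ ≤ R →
      y k + t k • x ∈ ball z₀ ε ∧ y k + t k • x ∈ ball (0 : Eucl n) 1 := by
  obtain ⟨ρ, hρ, hsub⟩ := Metric.isOpen_iff.1 isOpen_ball z₀ hz₀
  have e1 := B.ylim.eventually (ball_mem_nhds z₀ (show 0 < min ε ρ / 2 by positivity))
  have e2 := B.tlim.eventually (eventually_lt_nhds (show 0 < min ε ρ / 2 / (|R| + 1) by positivity))
  filter_upwards [e1, e2, B.pos] with k h1 h2 h3 x hx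
  have h4 : y k + t k • x ∈ ball z₀ (min ε ρ) := by
    rw [dist_eq_norm] at h1
    rw [mem_ball, dist_eq_norm]
    rw [lt_div_iff₀ (by positivity)] at h2
    have e : y k + t k • x - z₀ = (y k - z₀) + t k • x := by abel
    rw [e]
    refine (norm_add_le _ _).trans_lt ?_
    rw [norm_smul, Real.norm_of_nonneg h3.le]
    have h6 : ‖x‖ ≤ |R| + 1 := by linarith [le_abs_self R]
    have := mul_le_mul_of_nonneg_left h6 h3.le
    linarith
  exact ⟨ball_subset_ball (min_le_left _ _) h4, hsub (ball_subset_ball (min_le_right _ _) h4)⟩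

variable {half : Prop} {F : Eucl n → ℝ → Eucl n → Eucl n} {F₀ : Eucl n → ℝ → Eucl n → ℝ}

lemma WeakSol.touchable (S : WeakSol half F F₀ u L) (hF : ContDiffOn ℝ 1 (uncurryF F) (jetDom n))
    (hF₀ : ContDiffOn ℝ 1 (uncurryF₀ F₀) (jetDom n)) (hell : H1 F)
    (hz₀ : z₀ ∈ ball (0 : Eucl n) 1) (P : ℝ) :
    ∃ lam Lam : ℝ, 0 < lam ∧ 0 ≤ Lam ∧ ∀ {ι : Type} (l : Filter ι) (y : ι → Eucl n) (t : ι → ℝ)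
      (W : Eucl n → ℝ), BlowUp u z₀ l y t W → ∀ R c : ℝ, 0 < c → ∀ᶠ k in l,
      Touchable half (fun x p => half → x (Fin.last n) = 0 →
        0 < F (y k + t k • x) (u (y k + t k • x)) p (Fin.last n))
        (resc u (y k) (t k)) R P lam Lam c := by
  obtain ⟨lam, Lam, hlam, hLam, h⟩ := resc_touch_bound hF hF₀ hell (half := half) S.lip hz₀ P
  refine ⟨lam, Lam, hlam, hLam, fun l y t W B R c hc => ?_⟩
  filter_upwards [h l y t B.thin B.pos B.ylim B.tlim R c hc,
    B.eventually_mem_ball hz₀ R one_pos] with k h1 h2 x₁ hx₁ hxu p ν a b hp hν ha hb hΦ ht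
  exact h1 x₁ hx₁ hxu p ν a b hp hν ha hb (S.localWeak (h2 x₁ hx₁).2) hΦ ht

lemma WeakSol.touchable_neg (S : WeakSol half F F₀ u L)
    (hF : ContDiffOn ℝ 1 (uncurryF F) (jetDom n))
    (hF₀ : ContDiffOn ℝ 1 (uncurryF₀ F₀) (jetDom n)) (hell : H1 F)
    (hz₀ : z₀ ∈ ball (0 : Eucl n) 1) (P : ℝ) :
    ∃ lam Lam : ℝ, 0 < lam ∧ 0 ≤ Lam ∧ ∀ {ι : Type} (l : Filter ι) (y : ι → Eucl n) (t : ι → ℝ)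
      (W : Eucl n → ℝ), BlowUp u z₀ l y t W → ∀ R c : ℝ, 0 < c → ∀ᶠ k in l,
      Touchable half (fun x p => x (Fin.last n) = 0 → 0 < resc u (y k) (t k) x ∧
        (half → F (y k + t k • x) (u (y k + t k • x)) (-p) (Fin.last n) < 0))
        (fun x => -resc u (y k) (t k) x) R P lam Lam c := by
  obtain ⟨lam, Lam, hlam, hLam, h⟩ := resc_touch_bound (contDiffOn_negF hF) (contDiffOn_negF₀ hF₀)
    (h1_negF hell) (half := half) S.lip.neg hz₀ P
  refine ⟨lam, Lam, hlam, hLam, fun l y t W B R c hc => ?_⟩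
  filter_upwards [h l y t B.thin B.pos B.ylim B.tlim R c hc, B.pos,
    B.eventually_mem_ball hz₀ R one_pos] with k h1 h3 h2 x₁ hx₁ hxu p ν a b hp hν ha hb hΦ ht
  have e : (y k + t k • x₁) (Fin.last n) = 0 → x₁ (Fin.last n) = 0 := by
    simp [B.thin k, h3.ne']
  refine h1 x₁ hx₁ hxu p ν a b hp hν ha hb (S.localWeak_neg (h2 x₁ hx₁).2 fun h0 => ?_)
    (fun hh h0 => ?_) (by rw [neg_resc] at ht; exact ht)
  · have := (hΦ (e h0)).1
    rw [resc] at this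
    exact (div_pos_iff_of_pos_right h3).1 this
  · have := (hΦ h0).2 hh
    simpa [negF] using this

end

/-- The slope `p` has positive conormal flux at the (rescaled) boundary point `x`. -/
def FluxPos (half : Prop) (F : Eucl n → ℝ → Eucl n → Eucl n) (u : Eucl n → ℝ) (y : Eucl n) (t : ℝ)
    (x p : Eucl n) : Prop :=
  half → x (Fin.last n) = 0 → 0 < F (y + t • x) (u (y + t • x)) p (Fin.last n)

lemma norm_quadGrad_le {p ν : Eucl n} (hν : ‖ν‖ = 1) {a b s : ℝ} (ha : 0 ≤ a) (hb : 0 ≤ b)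
    {x₀ x : Eucl n} (hx : ‖x - x₀‖ ≤ s) : ‖quadGrad p ν a b x₀ x‖ ≤ ‖p‖ + 2 * (a + b) * s := by
  unfold quadGrad
  refine (norm_sub_le _ _).trans ?_
  have h1 := norm_add_le p ((2 * a * ⟪ν, x - x₀⟫_ℝ) • ν)
  rw [norm_smul, hν, Real.norm_eq_abs, abs_mul, abs_of_nonneg (show (0 : ℝ) ≤ 2 * a by positivity)]
    at h1
  rw [norm_smul, Real.norm_of_nonneg (show (0 : ℝ) ≤ 2 * b by positivity)]
  have h2 := abs_real_inner_le_norm ν (x - x₀)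
  rw [hν, one_mul] at h2
  have h3 := mul_le_mul_of_nonneg_left (h2.trans hx) (show (0 : ℝ) ≤ 2 * a by positivity)
  have h4 := mul_le_mul_of_nonneg_left hx (show (0 : ℝ) ≤ 2 * b by positivity)
  linarith

lemma _root_.IsCompact.exists_pos_le {X : Type*} [TopologicalSpace X] {Q : Set X}
    (hQ : IsCompact Q) {f : X → ℝ} (hf : ContinuousOn f Q) (h : ∀ x ∈ Q, 0 < f x) :
    ∃ η : ℝ, 0 < η ∧ ∀ x ∈ Q, η ≤ f x := by
  rcases Q.eq_empty_or_nonempty with rfl | hne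
  · exact ⟨1, one_pos, by simp⟩
  · obtain ⟨x, hx, hmin⟩ := hQ.exists_isMinOn hne hf
    exact ⟨f x, h x hx, fun z hz => hmin hz⟩

section

variable {ι : Type} {l : Filter ι} [l.NeBot] {L : ℝ≥0} {u W : Eucl n → ℝ} {z₀ : Eucl n}
  {y : ι → Eucl n} {t : ι → ℝ} {half : Prop} {P lam Lam : ℝ}

lemma BlowUp.limit_barrier (B : BlowUp u z₀ l y t W) (hu : LipschitzWith L u)
    {Φ : ι → Eucl n → Eucl n → Prop}
    (hT : ∀ R c : ℝ, 0 < c → ∀ᶠ k in l,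
      Touchable half (Φ k) (resc u (y k) (t k)) R P lam Lam c)
    {p ν x₀ : Eucl n} {a b s : ℝ} (hν : ‖ν‖ = 1) (ha : 0 ≤ a) (hb : 0 ≤ b)
    (hlt : Lam * b < lam * a) (hx₀ : x₀ ∈ (upperCl half : Set (Eucl n))) (hs : 0 < s)
    (hsph : ∀ x ∈ sphere x₀ s, x ∈ (upperCl half : Set (Eucl n)) →
      quad (W x₀) p ν a b x₀ x < W x)
    (hgrad : ∀ x ∈ closedBall x₀ s, ‖quadGrad p ν a b x₀ x‖ ≤ P)
    (hΦ : ∀ᶠ k in l, ∀ x ∈ closedBall x₀ s, Φ k x (quadGrad p ν a b x₀ x)) : False := by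
  obtain ⟨η, hη, hη'⟩ := ((isCompact_sphere x₀ s).inter_right (isClosed_upperCl half)).exists_pos_le
    (f := fun x => W x - quad (W x₀) p ν a b x₀ x)
    ((B.lip hu).continuous.sub (contDiff_quad _ p ν a b x₀).continuous).continuousOn
    fun x hx => sub_pos.2 (hsph x hx.1 hx.2)
  have hc : 0 < (lam * a - Lam * b) / 2 := by linarith
  obtain ⟨k, hk1, hk2, hk3⟩ := ((hT (‖x₀‖ + s) _ hc).and (hΦ.and
    (B.uniform hu (isCompact_closedBall x₀ s) (show 0 < η / 4 by positivity)))).exists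
  have h1 := hk1.quad_le (lipschitzWith_resc hu _ _).continuous
    ((isCompact_closedBall x₀ s).inter_right (isClosed_upperCl half))
    (c₀ := W x₀ + η / 2) (p := p) (y := x₀) hν ha hb (by linarith) (fun x hx hlt' => ?_) x₀
    ⟨mem_closedBall_self hs.le, hx₀⟩
  · have h2 := abs_lt.1 (hk3 x₀ (mem_closedBall_self hs.le))
    simp only [quad, sub_self, inner_zero_right, norm_zero] at h1
    linarith [h2.2]
  · have h2 := abs_lt.1 (hk3 x hx.1)
    have hb' : x ∈ ball x₀ s := by
      by_contra hx'
      have hxs : x ∈ sphere x₀ s := by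
        rw [mem_sphere]
        rw [mem_ball, not_lt] at hx'
        exact le_antisymm hx.1 hx'
      have h3 := hη' x ⟨hxs, hx.2⟩
      unfold quad at h3 hlt'
      linarith [h2.1]
    refine ⟨hx.2, ?_, ?_, hgrad x hx.1, hk2 x hx.1⟩
    · obtain ⟨r, hr, hr'⟩ := Metric.isOpen_iff.1 isOpen_ball x hb'
      exact ⟨r, hr, fun z hz => ⟨ball_subset_closedBall (hr' hz.1), hz.2⟩⟩
    · have h4 := hx.1
      rw [mem_closedBall, dist_eq_norm] at h4
      have := norm_sub_norm_le x x₀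
      linarith

variable {F : Eucl n → ℝ → Eucl n → Eucl n} {σ m : ℝ}

lemma norm_smul_eLast (c : ℝ) : ‖c • eLast n‖ = |c| := by
  simp [norm_smul, eLast]

lemma inner_smul_eLast (c : ℝ) (x : Eucl n) : ⟪c • eLast n, x⟫_ℝ = c * x (Fin.last n) := by
  rw [real_inner_smul_left, real_inner_comm, inner_eLast]

lemma abs_last_le (x : Eucl n) : |x (Fin.last n)| ≤ ‖x‖ := PiLp.norm_apply_le (p := 2) x _

lemma BlowUp.interior_ball_false (B : BlowUp u z₀ l y t W) (hu : LipschitzWith L u)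
    (hlam : 0 < lam) (hLam : 0 ≤ Lam)
    (hT : ∀ R c : ℝ, 0 < c → ∀ᶠ k in l,
      Touchable half (FluxPos half F u (y k) (t k)) (resc u (y k) (t k)) R P lam Lam c)
    (hσ : |σ| = 1) (hσh : half → σ = 1) (hP : |m| + 1 ≤ P)
    (hW : ∀ x : Eucl n, 0 < σ * x (Fin.last n) → m * (σ * x (Fin.last n)) ≤ W x)
    {x₀ ν : Eucl n} {R : ℝ} (hν : ‖ν‖ = 1) (hR : 0 < R) (hx₀ : 0 < σ * x₀ (Fin.last n))
    (hWx₀ : W x₀ = m * (σ * x₀ (Fin.last n)))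
    (hball : ∀ x : Eucl n, 0 < σ * x (Fin.last n) → ‖x - x₀‖ ^ 2 < 2 * R * ⟪ν, x - x₀⟫_ℝ →
      m * (σ * x (Fin.last n)) < W x) : False := by
  have hWc := (B.lip hu).continuous
  set b : ℝ := R⁻¹ with hb
  have hb0 : 0 < b := inv_pos.2 hR
  set K : ℝ := (Lam * b + 1) / lam with hK
  have hK0 : 0 < K := by positivity
  have hlamK : lam * K = Lam * b + 1 := by
    rw [hK]
    field_simp
  obtain ⟨s, hs, hs1, hsK, hsx⟩ : ∃ s : ℝ, 0 < s ∧ s ≤ 1 ∧ K * s ≤ 1 / 2 ∧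
      s < σ * x₀ (Fin.last n) := by
    refine ⟨min 1 (min (1 / 2 / K) (σ * x₀ (Fin.last n) / 2)), by positivity, min_le_left _ _, ?_,
      ?_⟩
    · rw [← le_div_iff₀' hK0]
      exact (min_le_right _ _).trans (min_le_left _ _)
    · exact ((min_le_right _ _).trans (min_le_right _ _)).trans_lt (by linarith)
  have hside : ∀ x ∈ closedBall x₀ s, 0 < σ * x (Fin.last n) := fun x hx => by
    rw [mem_closedBall, dist_eq_norm] at hx
    have h1 := (abs_last_le (x - x₀)).trans hx
    have h2 : |σ * (x - x₀) (Fin.last n)| ≤ s := by rwa [abs_mul, hσ, one_mul]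
    have h3 := (abs_le.1 h2).1
    rw [PiLp.sub_apply] at h3
    linarith
  set β : Eucl n → ℝ := fun x =>
    ⟪ν, x - x₀⟫_ℝ + K * ⟪ν, x - x₀⟫_ℝ ^ 2 - b * ‖x - x₀‖ ^ 2 with hβ
  have hβc : Continuous β := by fun_prop
  have hinner : ∀ x ∈ sphere x₀ s, |⟪ν, x - x₀⟫_ℝ| ≤ s := fun x hx => by
    rw [mem_sphere, dist_eq_norm] at hx
    have h2 := abs_real_inner_le_norm ν (x - x₀)
    rwa [hν, one_mul, hx] at h2
  have hpos : ∀ x ∈ sphere x₀ s, 0 ≤ β x → m * (σ * x (Fin.last n)) < W x := fun x hx hβx => by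
    refine hball x (hside x (sphere_subset_closedBall hx)) ?_
    have h1 := abs_le.1 (hinner x hx)
    rw [mem_sphere, dist_eq_norm] at hx
    simp only [hβ, hx] at hβx
    rw [hx]
    set w := ⟪ν, x - x₀⟫_ℝ
    have h2 : b * s ^ 2 ≤ 3 / 2 * w := by
      have h5 : 0 < b * s ^ 2 := by positivity
      have hKw1 : K * w ≤ 1 / 2 := (mul_le_mul_of_nonneg_left h1.2 hK0.le).trans hsK
      have hKw2 : -(1 / 2) ≤ K * w := by
        have := mul_le_mul_of_nonneg_left h1.1 hK0.le
        linarith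
      have hw0 : 0 ≤ w := by
        by_contra! hw0
        nlinarith
      nlinarith
    have h3 : s ^ 2 = R * (b * s ^ 2) := by
      rw [hb]
      field_simp
    have h4 : 0 < s ^ 2 := by positivity
    have h5 : s ^ 2 ≤ R * (3 / 2 * w) := by
      rw [h3]
      exact mul_le_mul_of_nonneg_left h2 hR.le
    nlinarith
  obtain ⟨τ, hτ, hτ'⟩ := ((isCompact_sphere x₀ s).inter_right
    (isClosed_le continuous_const hβc)).exists_pos_le
    (f := fun x => W x - m * (σ * x (Fin.last n)))
    (hWc.sub (continuous_const.mul (continuous_const.mul continuous_last))).continuousOn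
    fun x hx => sub_pos.2 (hpos x hx.1 hx.2)
  set δ : ℝ := min (τ / 4) (1 / (1 + 2 * (K + b))) with hδ
  have hδ0 : 0 < δ := by positivity
  have hδ1 : δ * (1 + 2 * (K + b)) ≤ 1 := by
    rw [← le_div_iff₀ (by positivity)]
    exact min_le_right _ _
  have hquad : ∀ x : Eucl n, quad (W x₀) ((m * σ) • eLast n + δ • ν) ν (δ * K) (δ * b) x₀ x =
      m * (σ * x (Fin.last n)) + δ * β x := fun x => by
    rw [quad, hWx₀, inner_add_left, inner_smul_eLast, real_inner_smul_left, PiLp.sub_apply]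
    ring
  refine B.limit_barrier hu hT (p := (m * σ) • eLast n + δ • ν) (x₀ := x₀) (s := s) hν
    (by positivity : 0 ≤ δ * K) (by positivity : 0 ≤ δ * b) ?_ (fun hh => ?_) hs
    (fun x hx _ => ?_) (fun x hx => ?_) (Eventually.of_forall fun k x hx hh h0 => ?_)
  · have : lam * (δ * K) = δ * (Lam * b + 1) := by rw [← hlamK]; ring
    rw [this]
    nlinarith
  · rw [hσh hh] at hx₀
    linarith
  · rw [hquad]
    by_cases h : 0 ≤ β x
    · have h1 := hτ' x ⟨hx, h⟩
      have h2 := abs_le.1 (hinner x hx)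
      have h3 : β x ≤ 2 := by
        have h4 : 0 ≤ b * ‖x - x₀‖ ^ 2 := by positivity
        have h5 : K * ⟪ν, x - x₀⟫_ℝ ^ 2 ≤ K * s ^ 2 :=
          mul_le_mul_of_nonneg_left (sq_le_sq.2 ((hinner x hx).trans (le_abs_self s))) hK0.le
        have h6 : K * s ^ 2 ≤ 1 := by nlinarith
        simp only [hβ]
        linarith [h2.2]
      have h4 : δ ≤ τ / 4 := min_le_left _ _
      nlinarith
    · have h1 := hW x (hside x (sphere_subset_closedBall hx))
      nlinarith
  · have h1 := norm_quadGrad_le (p := (m * σ) • eLast n + δ • ν) hν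
      (by positivity : 0 ≤ δ * K) (by positivity : 0 ≤ δ * b) (x := x) (x₀ := x₀) (s := 1)
      (by rw [mem_closedBall, dist_eq_norm] at hx; linarith)
    have h2 := norm_add_le ((m * σ) • eLast n) (δ • ν)
    rw [norm_smul_eLast, abs_mul, hσ, norm_smul, hν, Real.norm_of_nonneg hδ0.le] at h2
    linarith
  · have := hside x hx
    rw [h0] at this
    simp at this

lemma BlowUp.strong_min (B : BlowUp u z₀ l y t W) (hu : LipschitzWith L u)
    (hlam : 0 < lam) (hLam : 0 ≤ Lam)
    (hT : ∀ R c : ℝ, 0 < c → ∀ᶠ k in l,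
      Touchable half (FluxPos half F u (y k) (t k)) (resc u (y k) (t k)) R P lam Lam c)
    (hσ : |σ| = 1) (hσh : half → σ = 1) (hP : |m| + 1 ≤ P)
    (hW : ∀ x : Eucl n, 0 < σ * x (Fin.last n) → m * (σ * x (Fin.last n)) ≤ W x)
    {y₁ : Eucl n} (hy₁ : 0 < σ * y₁ (Fin.last n)) (hWy₁ : m * (σ * y₁ (Fin.last n)) < W y₁)
    (x : Eucl n) (hx : 0 < σ * x (Fin.last n)) : m * (σ * x (Fin.last n)) < W x := by
  have hWc := (B.lip hu).continuous
  have hsc : Continuous fun x : Eucl n => σ * x (Fin.last n) := continuous_const.mul continuous_last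
  have hconv : Convex ℝ {x : Eucl n | 0 < σ * x (Fin.last n)} := by
    have : {x : Eucl n | 0 < σ * x (Fin.last n)} = {x | 0 < ⟪σ • eLast n, x⟫_ℝ} := by
      ext x
      rw [Set.mem_ofPred_eq, Set.mem_ofPred_eq, inner_smul_eLast]
    rw [this]
    exact convex_halfSpace_gt (innerSL ℝ (σ • eLast n)).isLinear 0
  have hVo : IsOpen {x : Eucl n | 0 < σ * x (Fin.last n) ∧ W x ≤ m * (σ * x (Fin.last n))} := by
    refine Metric.isOpen_iff.2 fun x hx => ?_
    obtain ⟨ρ, hρ, hsub⟩ := Metric.isOpen_iff.1 (isOpen_lt continuous_const hsc) x hx.1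
    have hsub : ∀ z, dist z x < ρ → 0 < σ * z (Fin.last n) := fun z hz => hsub hz
    refine ⟨ρ / 2, by positivity, fun w hw => ⟨hsub w (by rw [mem_ball] at hw; linarith), ?_⟩⟩
    by_contra! hcon
    rw [mem_ball] at hw
    obtain ⟨x₀, hx₀, hmin⟩ := ((isCompact_closedBall w (dist x w)).inter_right
      (isClosed_le hWc (continuous_const.mul hsc))).exists_isMinOn
      ⟨x, mem_closedBall.2 le_rfl, hx.2⟩
      (f := fun z => dist z w) (continuous_id.dist continuous_const).continuousOn
    have hx₀s : 0 < σ * x₀ (Fin.last n) := by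
      refine hsub x₀ ?_
      have h1 := dist_triangle x₀ w x
      have h2 := mem_closedBall.1 hx₀.1
      rw [dist_comm x w] at h2
      linarith
    have hR : 0 < ‖w - x₀‖ := by
      rw [norm_pos_iff, sub_ne_zero]
      rintro rfl
      exact absurd hx₀.2 (not_le.2 hcon)
    refine B.interior_ball_false hu hlam hLam hT hσ hσh hP hW (x₀ := x₀)
      (ν := ‖w - x₀‖⁻¹ • (w - x₀)) (R := ‖w - x₀‖) ?_ hR hx₀s (le_antisymm hx₀.2 (hW x₀ hx₀s))
      fun z hz hzb => ?_
    · rw [norm_smul, norm_inv, norm_norm, inv_mul_cancel₀ hR.ne']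
    · by_contra! hcon'
      rw [real_inner_smul_left, mul_assoc, mul_inv_cancel_left₀ hR.ne'] at hzb
      have h1 : ‖z - w‖ ^ 2 < ‖w - x₀‖ ^ 2 := by
        have e : z - w = (z - x₀) - (w - x₀) := by abel
        rw [e, norm_sub_sq_real, real_inner_comm]
        linarith
      have h2 : dist z w < dist x₀ w := by
        rw [dist_eq_norm, dist_comm, dist_eq_norm]
        exact lt_of_pow_lt_pow_left₀ 2 (norm_nonneg _) h1
      exact absurd (hmin ⟨mem_closedBall.2 (h2.le.trans hx₀.1), hcon'⟩) (not_le.2 h2)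
  have hUo : IsOpen {x : Eucl n | m * (σ * x (Fin.last n)) < W x} :=
    isOpen_lt (continuous_const.mul hsc) hWc
  refine hconv.isPreconnected.subset_left_of_subset_union hUo hVo ?_ (fun z hz => ?_)
    ⟨y₁, hy₁, hWy₁⟩ hx
  · exact Set.disjoint_left.2 fun z hz hz' => absurd hz'.2 (not_le.2 hz)
  · rcases lt_or_ge (m * (σ * z (Fin.last n))) (W z) with h | h
    · exact Or.inl h
    · exact Or.inr ⟨hz, h⟩

end

/-- `u` lies above the linear function of slope `μ` on the side `σ` of the thin space near
`z₀`. -/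
def SlopeBelow (u : Eucl n → ℝ) (z₀ : Eucl n) (σ μ : ℝ) : Prop :=
  ∃ r : ℝ, 0 < r ∧ ∀ x ∈ ball z₀ r, 0 ≤ σ * x (Fin.last n) → μ * (σ * x (Fin.last n)) ≤ u x

lemma norm_eLast : ‖eLast n‖ = 1 := by
  simp [eLast]

section

variable {ι : Type} {l : Filter ι} {L : ℝ≥0} {u W : Eucl n → ℝ} {z₀ : Eucl n}
  {y : ι → Eucl n} {t : ι → ℝ} {half : Prop} {P lam Lam : ℝ}
  {F : Eucl n → ℝ → Eucl n → Eucl n} {F₀ : Eucl n → ℝ → Eucl n → ℝ} {σ m : ℝ}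

lemma BlowUp.eventually_slope (B : BlowUp u z₀ l y t W) (hz₀ : z₀ ∈ ball (0 : Eucl n) 1) {μ : ℝ}
    (hμ : SlopeBelow u z₀ σ μ) (R : ℝ) :
    ∀ᶠ k in l, ∀ x : Eucl n, ‖x‖ ≤ R → 0 ≤ σ * x (Fin.last n) →
      μ * (σ * x (Fin.last n)) ≤ resc u (y k) (t k) x := by
  obtain ⟨r, hr, h⟩ := hμ
  filter_upwards [B.eventually_mem_ball hz₀ R hr, B.pos] with k h1 h2 x hx hxσ
  have e : σ * (y k + t k • x) (Fin.last n) = t k * (σ * x (Fin.last n)) := by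
    simp only [PiLp.add_apply, PiLp.smul_apply, B.thin k, smul_eq_mul]
    ring
  have h3 := h _ (h1 x hx).1 (by rw [e]; positivity)
  rw [e] at h3
  rw [resc, le_div_iff₀ h2]
  linarith

variable [l.NeBot]

lemma BlowUp.slope_le (B : BlowUp u z₀ l y t W) (hz₀ : z₀ ∈ ball (0 : Eucl n) 1)
    (hm : ∀ μ < m, SlopeBelow u z₀ σ μ) (x : Eucl n) (hx : 0 ≤ σ * x (Fin.last n)) :
    m * (σ * x (Fin.last n)) ≤ W x := by
  have h1 : Tendsto (fun μ : ℝ => μ * (σ * x (Fin.last n))) (𝓝[<] m)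
      (𝓝 (m * (σ * x (Fin.last n)))) :=
    ((continuous_id.mul continuous_const).tendsto m).mono_left nhdsWithin_le_nhds
  refine le_of_tendsto h1 ?_
  filter_upwards [self_mem_nhdsWithin] with μ hμ
  exact ge_of_tendsto (B.lim x)
    ((B.eventually_slope hz₀ (hm μ hμ) ‖x‖).mono fun k hk => hk x le_rfl hx)

lemma BlowUp.exists_better_slope (S : WeakSol half F F₀ u L) (B : BlowUp u z₀ l (fun _ => z₀) t W)
    (hz₀ : z₀ ∈ ball (0 : Eucl n) 1) (hlam : 0 < lam) (hLam : 0 ≤ Lam)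
    (hT : ∀ R c : ℝ, 0 < c → ∀ᶠ k in l,
      Touchable half (FluxPos half F u z₀ (t k)) (resc u z₀ (t k)) R P lam Lam c)
    (hσ : |σ| = 1) (hσh : half → σ = 1) (hP : |m| + 1 ≤ P)
    (hm : ∀ μ < m, SlopeBelow u z₀ σ μ)
    (hW : ∀ x : Eucl n, 0 < σ * x (Fin.last n) → m * (σ * x (Fin.last n)) < W x) :
    ∃ μ, m < μ ∧ SlopeBelow u z₀ σ μ := by
  have hWc := (B.lip S.lip).continuous
  have hz₀t : z₀ (Fin.last n) = 0 := by
    obtain ⟨k, -⟩ := B.pos.exists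
    exact B.thin k
  have hsc : Continuous fun x : Eucl n => σ * x (Fin.last n) := continuous_const.mul continuous_last
  have hσ2 : ∀ a : ℝ, (σ * a) ^ 2 = a ^ 2 := fun a => by
    rw [mul_pow, ← sq_abs σ, hσ]
    ring
  have habs : ∀ x : Eucl n, σ * x (Fin.last n) ≤ ‖x‖ := fun x => by
    refine (le_abs_self _).trans ?_
    rw [abs_mul, hσ, one_mul]
    exact abs_last_le x
  set K : ℝ := (Lam + 1) / lam + 1 with hK
  have hK1 : 1 ≤ K := by
    have : 0 ≤ (Lam + 1) / lam := by positivity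
    linarith
  have hlamK : lam * K = Lam + 1 + lam := by
    rw [hK]
    field_simp
  obtain ⟨τ, hτ, hτ'⟩ := ((isCompact_closedBall (0 : Eucl n) 3).inter_right
    (isClosed_le (continuous_const (y := 1 / (1 + K))) hsc)).exists_pos_le
    (f := fun x => W x - m * (σ * x (Fin.last n)))
    (hWc.sub (continuous_const.mul hsc)).continuousOn
    fun x hx => sub_pos.2 (hW x ((show (0 : ℝ) < 1 / (1 + K) by positivity).trans_le hx.2))
  set δ : ℝ := min (τ / 2 / (3 + 9 * K)) (1 / (1 + 2 * (K + 1))) with hδ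
  have hδ0 : 0 < δ := by positivity
  have hδ1 : δ * (1 + 2 * (K + 1)) ≤ 1 := by
    rw [← le_div_iff₀ (by positivity)]
    exact min_le_right _ _
  have hδ2 : δ * (3 + 9 * K) ≤ τ / 2 := by
    rw [← le_div_iff₀ (by positivity)]
    exact min_le_left _ _
  have hc : 0 < δ / 2 := by positivity
  obtain ⟨k, hk1, hk2, hk3, hk4, hk5⟩ := ((hT 3 _ hc).and ((B.uniform S.lip
    (isCompact_closedBall (0 : Eucl n) 3) (show 0 < τ / 2 by positivity)).and
    ((B.eventually_slope hz₀ (hm (m - δ / 2) (by linarith)) 3).and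
    ((B.eventually_mem_ball hz₀ 3 one_pos).and B.pos)))).exists
  have key : ∀ w : Eucl n, ‖w‖ ≤ 2 → w (Fin.last n) = 0 →
      ∀ x ∈ closedBall w 1 ∩ {x : Eucl n | 0 ≤ σ * x (Fin.last n)},
      quad 0 (((m + δ / 2) * σ) • eLast n) (eLast n) (δ * K) δ w x ≤ resc u z₀ (t k) x := by
    intro w hw hw0
    have hquad : ∀ x : Eucl n, quad 0 (((m + δ / 2) * σ) • eLast n) (eLast n) (δ * K) δ w x =
        (m - δ / 2) * (σ * x (Fin.last n)) +
          δ * (σ * x (Fin.last n) + K * (σ * x (Fin.last n)) ^ 2 - ‖x - w‖ ^ 2) := fun x => by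
      rw [quad, inner_smul_eLast, real_inner_comm, inner_eLast, PiLp.sub_apply, hw0, hσ2]
      ring
    refine hk1.quad_le (lipschitzWith_resc S.lip _ _).continuous
      ((isCompact_closedBall w 1).inter_right (isClosed_le continuous_const hsc)) norm_eLast
      (by positivity) hδ0.le ?_ fun x hx hlt => ?_
    · have : lam * (δ * K) = δ * (Lam + 1 + lam) := by rw [← hlamK]; ring
      rw [this]
      nlinarith
    · have hxw : ‖x - w‖ ≤ 1 := by
        rw [← dist_eq_norm]
        exact hx.1
      have hx3 : ‖x‖ ≤ 3 := by
        have := norm_sub_norm_le x w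
        linarith
      have hxσ : 0 ≤ σ * x (Fin.last n) := hx.2
      rw [hquad] at hlt
      have hlow := hk3 x hx3 hxσ
      have hxb : ‖x - w‖ < 1 := by
        refine lt_of_le_of_ne hxw fun h1 => ?_
        rw [h1] at hlt
        by_cases hh : 1 / (1 + K) ≤ σ * x (Fin.last n)
        · have h2 := hτ' x ⟨mem_closedBall_zero_iff.2 hx3, hh⟩
          have h3 := (abs_lt.1 (hk2 x (mem_closedBall_zero_iff.2 hx3))).1
          have h4 : σ * x (Fin.last n) ≤ 3 := (habs x).trans hx3
          have h6 : (σ * x (Fin.last n)) ^ 2 ≤ 9 := by nlinarith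
          have h5 : K * (σ * x (Fin.last n)) ^ 2 ≤ K * 9 :=
            mul_le_mul_of_nonneg_left h6 (by linarith)
          nlinarith
        · rw [not_le, lt_div_iff₀ (by positivity)] at hh
          have h2 : σ * x (Fin.last n) ≤ 1 := by nlinarith
          have h3 : K * (σ * x (Fin.last n)) ^ 2 ≤ K * (σ * x (Fin.last n)) := by nlinarith
          nlinarith
      have hxp : 0 < σ * x (Fin.last n) := by
        refine lt_of_le_of_ne hxσ fun h1 => ?_
        rw [← h1] at hlt hlow
        nlinarith [sq_nonneg ‖x - w‖]
      refine ⟨fun hh => ?_, ?_, hx3, ?_, fun _ h0 => ?_⟩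
      · simpa [hσh hh] using hxσ
      · obtain ⟨r, hr, hr'⟩ := Metric.isOpen_iff.1 ((isOpen_ball (x := w) (ε := 1)).inter
          (isOpen_lt continuous_const hsc)) x ⟨by rwa [mem_ball, dist_eq_norm], hxp⟩
        refine ⟨r, hr, fun z hz => ⟨ball_subset_closedBall (hr' hz.1).1, ?_⟩⟩
        have hzσ : 0 < σ * z (Fin.last n) := (hr' hz.1).2
        exact hzσ.le
      · have h1 := norm_quadGrad_le (p := ((m + δ / 2) * σ) • eLast n) norm_eLast
          (by positivity : 0 ≤ δ * K) hδ0.le hxw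
        rw [norm_smul_eLast, abs_mul, hσ] at h1
        have h2 := abs_add_le m (δ / 2)
        rw [abs_of_pos (by positivity : 0 < δ / 2)] at h2
        linarith
      · rw [h0] at hxp
        simp at hxp
  refine ⟨m + δ / 2, by linarith, t k, hk5, fun x hx hxσ => ?_⟩
  set w := (t k)⁻¹ • (x - z₀) with hw
  have hxw : x = z₀ + t k • w := by
    rw [hw, smul_inv_smul₀ hk5.ne']
    abel
  have hwl : σ * x (Fin.last n) = t k * (σ * w (Fin.last n)) := by
    rw [hxw]
    simp only [PiLp.add_apply, PiLp.smul_apply, hz₀t, smul_eq_mul]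
    ring
  have hw1 : ‖w‖ ≤ 1 := by
    rw [hw, norm_smul, norm_inv, Real.norm_of_nonneg hk5.le, ← div_eq_inv_mul, div_le_one hk5,
      ← dist_eq_norm]
    exact (mem_ball.1 hx).le
  have hwσ : 0 ≤ σ * w (Fin.last n) := by
    rw [hwl] at hxσ
    exact nonneg_of_mul_nonneg_right hxσ hk5
  have hwle := abs_last_le w
  have hlast : (w (Fin.last n) • eLast n) (Fin.last n) = w (Fin.last n) := by
    simp [eLast]
  have h1 := key (w - w (Fin.last n) • eLast n)
    ((norm_sub_le _ _).trans (by rw [norm_smul_eLast]; linarith))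
    (by rw [PiLp.sub_apply, hlast, sub_self]) w
    ⟨by rw [mem_closedBall, dist_eq_norm, sub_sub_cancel, norm_smul_eLast]; linarith, hwσ⟩
  rw [quad, sub_sub_cancel, inner_smul_eLast, real_inner_comm, inner_eLast, hlast, norm_smul_eLast,
    sq_abs, resc, ← hxw, le_div_iff₀ hk5] at h1
  rw [hwl]
  have h2 : 0 ≤ δ * (K - 1) * w (Fin.last n) ^ 2 :=
    mul_nonneg (mul_nonneg hδ0.le (by linarith)) (sq_nonneg _)
  nlinarith

end

lemma eq_of_eq_side {f g : Eucl n → ℝ} (hf : Continuous f) (hg : Continuous g) {σ : ℝ}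
    (hσ : |σ| = 1) (h : ∀ x : Eucl n, 0 < σ * x (Fin.last n) → f x = g x) (x : Eucl n)
    (hx : 0 ≤ σ * x (Fin.last n)) : f x = g x := by
  have h1 : Tendsto (fun ε : ℝ => x + (ε * σ) • eLast n) (𝓝[>] 0) (𝓝 x) := by
    have : Continuous fun ε : ℝ => x + (ε * σ) • eLast n := by fun_prop
    simpa using (this.tendsto 0).mono_left nhdsWithin_le_nhds
  refine tendsto_nhds_unique ((hf.tendsto x).comp h1) (((hg.tendsto x).comp h1).congr' ?_)
  filter_upwards [self_mem_nhdsWithin] with ε hε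
  refine (h _ ?_).symm
  have h2 : σ * σ = 1 := by rw [← abs_mul_abs_self, hσ, one_mul]
  have h3 : σ * (x + (ε * σ) • eLast n) (Fin.last n) = σ * x (Fin.last n) + ε * (σ * σ) := by
    simp [eLast]
    ring
  rw [h3, h2]
  have : 0 < ε := hε
  linarith

section

variable {L : ℝ≥0} {u : Eucl n → ℝ} {z₀ : Eucl n} {half : Prop}
  {F : Eucl n → ℝ → Eucl n → Eucl n} {F₀ : Eucl n → ℝ → Eucl n → ℝ} {σ : ℝ}

lemma SlopeBelow.mono {μ μ' : ℝ} (h : SlopeBelow u z₀ σ μ) (hμ : μ' ≤ μ) :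
    SlopeBelow u z₀ σ μ' := by
  obtain ⟨r, hr, h⟩ := h
  exact ⟨r, hr, fun x hx hxσ => (mul_le_mul_of_nonneg_right hμ hxσ).trans (h x hx hxσ)⟩

lemma WeakSol.slopeBelow_neg (S : WeakSol half F F₀ u L) (hz₀ : z₀ ∈ tBall (0 : Eucl n) 1)
    (hσ : |σ| = 1) : SlopeBelow u z₀ σ (-L) := by
  obtain ⟨r, hr, hr'⟩ := Metric.isOpen_iff.1 isOpen_ball z₀ hz₀.1
  have hz0 : z₀ (Fin.last n) = 0 := hz₀.2
  refine ⟨r / 2, by positivity, fun x hx hxσ => ?_⟩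
  have hlast : (x (Fin.last n) • eLast n) (Fin.last n) = x (Fin.last n) := by
    simp [eLast]
  have hxn : |x (Fin.last n)| ≤ ‖x - z₀‖ := by
    have := abs_last_le (x - z₀)
    rwa [PiLp.sub_apply, hz0, sub_zero] at this
  rw [mem_ball, dist_eq_norm] at hx
  have h1 : 0 ≤ u (x - x (Fin.last n) • eLast n) := by
    refine S.nonneg _ ⟨hr' ?_, show (x - x (Fin.last n) • eLast n) (Fin.last n) = 0 by
      rw [PiLp.sub_apply, hlast, sub_self]⟩
    rw [mem_ball, dist_eq_norm, sub_right_comm]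
    refine (norm_sub_le _ _).trans_lt ?_
    rw [norm_smul_eLast]
    linarith
  have h2 := S.lip.dist_le_mul x (x - x (Fin.last n) • eLast n)
  rw [dist_eq_norm, dist_eq_norm, sub_sub_cancel, norm_smul_eLast] at h2
  have h3 := (abs_le.1 h2).1
  have h4 : σ * x (Fin.last n) = |x (Fin.last n)| := by
    rw [← abs_of_nonneg hxσ, abs_mul, hσ, one_mul]
  rw [h4]
  linarith

lemma SlopeBelow.le (hu : LipschitzWith L u) (hz₀ : z₀ (Fin.last n) = 0) (hu0 : u z₀ = 0)
    (hσ : |σ| = 1) {μ : ℝ} (h : SlopeBelow u z₀ σ μ) : μ ≤ L := by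
  obtain ⟨r, hr, h⟩ := h
  have hσσ : σ * σ = 1 := by rw [← abs_mul_abs_self, hσ, one_mul]
  have e : σ * (z₀ + (r / 2 * σ) • eLast n) (Fin.last n) = r / 2 := by
    have : σ * (z₀ + (r / 2 * σ) • eLast n) (Fin.last n) = r / 2 * (σ * σ) := by
      simp [eLast, hz₀]
      ring
    rw [this, hσσ, mul_one]
  have e2 : dist (z₀ + (r / 2 * σ) • eLast n) z₀ = r / 2 := by
    rw [dist_eq_norm, add_sub_cancel_left, norm_smul_eLast, abs_mul, hσ,
      abs_of_pos (by positivity), mul_one]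
  have h1 := h (z₀ + (r / 2 * σ) • eLast n) (by rw [mem_ball, e2]; linarith) (by rw [e]; positivity)
  have h2 := hu.dist_le_mul (z₀ + (r / 2 * σ) • eLast n) z₀
  rw [e2, hu0, Real.dist_eq, sub_zero] at h2
  rw [e] at h1
  have h3 := h1.trans ((le_abs_self _).trans h2)
  exact le_of_mul_le_mul_right h3 (by positivity)

/-- At a contact point the solution has one-sided blow-ups that are linear. -/
lemma WeakSol.exists_slope (S : WeakSol half F F₀ u L)
    (hF : ContDiffOn ℝ 1 (uncurryF F) (jetDom n))
    (hF₀ : ContDiffOn ℝ 1 (uncurryF₀ F₀) (jetDom n)) (hell : H1 F)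
    (hz₀ : z₀ ∈ tBall (0 : Eucl n) 1) (hu0 : u z₀ = 0) (hσ : |σ| = 1) (hσh : half → σ = 1) :
    ∃ m, (∀ μ < m, SlopeBelow u z₀ σ μ) ∧ ∀ x : Eucl n, 0 ≤ σ * x (Fin.last n) →
      Tendsto (fun s => resc u z₀ s x) (𝓝[>] 0) (𝓝 (m * (σ * x (Fin.last n)))) := by
  have hz0 : z₀ (Fin.last n) = 0 := hz₀.2
  have hneg := S.slopeBelow_neg hz₀ hσ
  have hbdd : BddAbove {μ | SlopeBelow u z₀ σ μ} := ⟨L, fun μ hμ => hμ.le S.lip hz0 hu0 hσ⟩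
  have hne : {μ | SlopeBelow u z₀ σ μ}.Nonempty := ⟨-L, hneg⟩
  set m := sSup {μ | SlopeBelow u z₀ σ μ} with hmdef
  have hm : ∀ μ < m, SlopeBelow u z₀ σ μ := fun μ hμ => by
    obtain ⟨μ', h1, h2⟩ := exists_lt_of_lt_csSup hne hμ
    exact SlopeBelow.mono h1 h2.le
  have hmL : |m| ≤ L :=
    abs_le.2 ⟨le_csSup hbdd hneg, csSup_le hne fun μ hμ => hμ.le S.lip hz0 hu0 hσ⟩
  refine ⟨m, hm, fun x hx => ?_⟩
  obtain ⟨lam, Lam, hlam, hLam, hT⟩ := S.touchable hF hF₀ hell hz₀.1 (L + 1)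
  rw [tendsto_iff_ultrafilter]
  intro g hg
  obtain ⟨W, hW⟩ := exists_lim_of_lipschitz g (fun s => lipschitzWith_resc S.lip z₀ s) (C := 0)
    (Eventually.of_forall fun s => by simp [resc, hu0])
  have B : BlowUp u z₀ g (fun _ => z₀) id W :=
    ⟨fun _ => hz0, hg self_mem_nhdsWithin, tendsto_const_nhds,
      tendsto_id.mono_left (hg.trans nhdsWithin_le_nhds), hW⟩
  have hge := B.slope_le hz₀.1 hm
  have hT' := hT g (fun _ => z₀) id W B
  have hWx : W x = m * (σ * x (Fin.last n)) := by
    refine eq_of_eq_side (B.lip S.lip).continuous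
      (continuous_const.mul (continuous_const.mul continuous_last)) hσ (fun y hy => ?_) x hx
    by_contra hne
    have hgt := B.strong_min S.lip hlam hLam hT' hσ hσh (by linarith) (fun z hz => hge z hz.le) hy
      (lt_of_le_of_ne (hge y hy.le) (Ne.symm hne))
    obtain ⟨μ, h1, h2⟩ := B.exists_better_slope S hz₀.1 hlam hLam hT' hσ hσh (by linarith) hm hgt
    exact absurd (le_csSup hbdd h2) (not_le.2 h1)
  rw [← hWx]
  exact hW x

end

section

variable {L : ℝ≥0} {u : Eucl n → ℝ} {z₀ : Eucl n} {half : Prop}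
  {F : Eucl n → ℝ → Eucl n → Eucl n} {F₀ : Eucl n → ℝ → Eucl n → ℝ}

lemma resc_sub_resc_le (hu : LipschitzWith L u) (y y' x : Eucl n) {s : ℝ} (hs : 0 < s)
    (hy : dist y y' ≤ s ^ 2) : |resc u y s x - resc u y' s x| ≤ L * s := by
  have h := hu.dist_le_mul (y + s • x) (y' + s • x)
  rw [dist_add_right, Real.dist_eq] at h
  unfold resc
  rw [← sub_div, abs_div, abs_of_pos hs, div_le_iff₀ hs]
  have := mul_le_mul_of_nonneg_left hy L.coe_nonneg
  linarith

/-- Near a free boundary point there are blow-ups at positivity points with the same limit as the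
blow-ups at the free boundary point itself. -/
lemma exists_blowUp_pos (hu : LipschitzWith L u) (hz₀ : z₀ ∈ freeBoundary u) {ℓ : Eucl n → ℝ}
    (hℓ : ∀ x ∈ (upperCl half : Set (Eucl n)),
      Tendsto (fun s => resc u z₀ s x) (𝓝[>] 0) (𝓝 (ℓ x))) :
    ∃ (l : Ultrafilter ℕ) (y : ℕ → Eucl n) (t : ℕ → ℝ) (W : Eucl n → ℝ),
      BlowUp u z₀ l y t W ∧ (∀ k, 0 < t k ∧ 0 < u (y k)) ∧
      ∀ x ∈ (upperCl half : Set (Eucl n)), W x = ℓ x := by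
  set t : ℕ → ℝ := fun k => 1 / (k + 1) with ht
  have ht0 : ∀ k, 0 < t k := fun k => Nat.one_div_pos_of_nat
  have htl : Tendsto t atTop (𝓝 0) := tendsto_one_div_add_atTop_nhds_zero_nat
  choose y hy hyd hyu using fun k => hz₀.2 (t k ^ 2) (pow_pos (ht0 k) 2)
  have hl : (hyperfilter ℕ : Filter ℕ) ≤ atTop := by
    rw [← Nat.cofinite_eq_atTop]
    exact hyperfilter_le_cofinite
  have hyd' : ∀ k, dist (y k) z₀ ≤ t k ^ 2 := fun k => (mem_ball.1 (hyd k)).le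
  have ht1 : ∀ k, t k ≤ 1 := fun k => by
    have : (0 : ℝ) ≤ k := k.cast_nonneg
    rw [ht]
    dsimp only
    rw [div_le_one (by positivity)]
    linarith
  obtain ⟨W, hW⟩ := exists_lim_of_lipschitz (hyperfilter ℕ)
    (fun k => lipschitzWith_resc hu (y k) (t k)) (C := L) (Eventually.of_forall fun k => by
      have h := resc_sub_resc_le hu (y k) z₀ 0 (ht0 k) (hyd' k)
      have h0 : resc u z₀ (t k) 0 = 0 := by simp [resc, hz₀.1.2]
      rw [h0, sub_zero] at h
      have := mul_le_mul_of_nonneg_left (ht1 k) L.coe_nonneg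
      linarith)
  have hsq : Tendsto (fun k => t k ^ 2) atTop (𝓝 0) := by
    simpa using htl.pow 2
  refine ⟨hyperfilter ℕ, y, t, W, ⟨fun k => (hy k).2, Eventually.of_forall ht0,
    (tendsto_iff_dist_tendsto_zero.2 (squeeze_zero (fun _ => dist_nonneg) hyd' hsq)).mono_left hl,
    htl.mono_left hl, hW⟩, fun k => ⟨ht0 k, hyu k⟩, fun x hx => ?_⟩
  have h1 : Tendsto t (hyperfilter ℕ) (𝓝[>] 0) :=
    tendsto_nhdsWithin_iff.2 ⟨htl.mono_left hl, Eventually.of_forall ht0⟩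
  have h2 : Tendsto (fun k => resc u (y k) (t k) x - resc u z₀ (t k) x) (hyperfilter ℕ)
      (𝓝 0) := by
    refine squeeze_zero_norm (a := fun k => L * t k)
      (fun k => resc_sub_resc_le hu (y k) z₀ x (ht0 k) (hyd' k)) ?_
    simpa using (htl.mono_left hl).const_mul (L : ℝ)
  refine tendsto_nhds_unique (hW x) ?_
  simpa using h2.add ((hℓ x hx).comp h1)

lemma tendsto_structure (hF : ContDiffOn ℝ 1 (uncurryF F) (jetDom n)) (hu : Continuous u)
    (hz₀ : z₀ ∈ ball (0 : Eucl n) 1) (p : Eucl n) :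
    ContinuousAt (fun q : Eucl n × Eucl n => F q.1 (u q.1) q.2) (z₀, p) := by
  have h1 : ContinuousAt (uncurryF F) (z₀, u z₀, p) :=
    (hF.contDiffAt (isOpen_jetDom.mem_nhds (mem_jetDom hz₀ _ p))).continuousAt
  have h2 : Continuous fun q : Eucl n × Eucl n => (q.1, u q.1, q.2) := by fun_prop
  exact ContinuousAt.comp (f := fun q : Eucl n × Eucl n => (q.1, u q.1, q.2)) (x := (z₀, p)) h1
    h2.continuousAt

/-- At a free boundary point the blow-up cannot lie strictly below a linear function with
negative conormal flux. -/
lemma WeakSol.not_below_linear (S : WeakSol half F F₀ u L)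
    (hF : ContDiffOn ℝ 1 (uncurryF F) (jetDom n))
    (hF₀ : ContDiffOn ℝ 1 (uncurryF₀ F₀) (jetDom n)) (hell : H1 F) (hz₀ : z₀ ∈ freeBoundary u)
    {ℓ : Eucl n → ℝ} {c d : ℝ} (hc : 0 < c)
    (hℓ : ∀ x ∈ (upperCl half : Set (Eucl n)),
      Tendsto (fun s => resc u z₀ s x) (𝓝[>] 0) (𝓝 (ℓ x)))
    (hle : ∀ x ∈ (upperCl half : Set (Eucl n)),
      ℓ x ≤ d * x (Fin.last n) - c * |x (Fin.last n)|)
    (hflux : half → F z₀ 0 (d • eLast n) (Fin.last n) < 0) : False := by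
  obtain ⟨l, y, t, W, B, hpos, hW⟩ := exists_blowUp_pos S.lip hz₀ hℓ
  have hzb : z₀ ∈ ball (0 : Eucl n) 1 := hz₀.1.1.1
  obtain ⟨lam, Lam, hlam, hLam, hT⟩ := S.touchable_neg hF hF₀ hell hzb (|d| + 1)
  obtain ⟨ε, hε, hε'⟩ : ∃ ε : ℝ, 0 < ε ∧ ∀ X ∈ ball z₀ ε, ∀ p ∈ ball (d • eLast n) ε, half →
      F X (u X) p (Fin.last n) < 0 := by
    by_cases hh : half
    · have h1 : ContinuousAt (fun q : Eucl n × Eucl n => F q.1 (u q.1) q.2 (Fin.last n))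
          (z₀, d • eLast n) :=
        continuous_last.continuousAt.comp (tendsto_structure hF S.lip.continuous hzb _)
      have h2 : F z₀ (u z₀) (d • eLast n) (Fin.last n) < 0 := by
        rw [hz₀.1.2]
        exact hflux hh
      obtain ⟨ε, hε, h⟩ := Metric.eventually_nhds_iff_ball.1
        (h1.eventually (eventually_lt_nhds h2))
      refine ⟨ε, hε, fun X hX p hp _ => h (X, p) ?_⟩
      rw [← ball_prod_same]
      exact ⟨hX, hp⟩
    · exact ⟨1, one_pos, fun X _ p _ h => absurd h hh⟩
  set K : ℝ := (Lam + 1) / lam with hK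
  have hK0 : 0 < K := by positivity
  have hlamK : lam * K = Lam + 1 := by
    rw [hK]
    field_simp
  set δ : ℝ := min (c / K) (min (ε / 3) (1 / (2 * (K + 1)))) with hδ
  have hδ0 : 0 < δ := by positivity
  have hδ1 : δ * K ≤ c := by
    rw [← le_div_iff₀ hK0]
    exact min_le_left _ _
  have hδ2 : δ ≤ ε / 3 := (min_le_right _ _).trans (min_le_left _ _)
  have hδ3 : δ * (2 * (K + 1)) ≤ 1 := by
    rw [← le_div_iff₀ (by positivity)]
    exact (min_le_right _ _).trans (min_le_right _ _)
  have hc' : 0 < δ / 2 := by positivity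
  obtain ⟨k, hk1, hk2, hk3⟩ := ((hT l y t W B 1 _ hc').and
    ((B.uniform S.lip (isCompact_closedBall (0 : Eucl n) 1) hδ0).and
      (B.eventually_mem_ball hzb 1 hε))).exists
  have h1 := hk1.quad_le (lipschitzWith_resc S.lip _ _).continuous.neg
    ((isCompact_closedBall (0 : Eucl n) 1).inter_right (isClosed_upperCl half)) (c₀ := 0)
    (p := (-d) • eLast n) (y := 0) norm_eLast (by positivity : 0 ≤ δ * K) hδ0.le ?_
    (fun x hx hlt => ?_) 0 ⟨mem_closedBall_self zero_le_one, fun _ => by simp⟩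
  · have h2 : 0 < resc u (y k) (t k) 0 := by
      simpa [resc] using div_pos (hpos k).2 (hpos k).1
    simp [quad] at h1
    linarith
  · have : lam * (δ * K) = δ * (Lam + 1) := by rw [← hlamK]; ring
    rw [this]
    nlinarith
  · have hx1 : ‖x‖ ≤ 1 := mem_closedBall_zero_iff.1 hx.1
    have hlt' : d * x (Fin.last n) - δ * K * x (Fin.last n) ^ 2 + δ * ‖x‖ ^ 2 <
        resc u (y k) (t k) x := by
      rw [quad, inner_smul_eLast, real_inner_comm, inner_eLast, sub_zero] at hlt
      linarith
    have hxb : ‖x‖ < 1 := by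
      refine lt_of_le_of_ne hx1 fun h => ?_
      have h2 := (abs_lt.1 (hk2 x hx.1)).2
      rw [hW x hx.2] at h2
      have h3 := hle x hx.2
      have h4 : x (Fin.last n) ^ 2 ≤ |x (Fin.last n)| := by
        rw [← sq_abs]
        have := (abs_last_le x).trans hx1
        nlinarith [abs_nonneg (x (Fin.last n))]
      have h5 := mul_le_mul hδ1 h4 (sq_nonneg _) hc.le
      rw [h] at hlt'
      linarith
    refine ⟨hx.2, ?_, hx1, ?_, fun h0 => ⟨?_, ?_⟩⟩
    · obtain ⟨r, hr, hr'⟩ := Metric.isOpen_iff.1 (isOpen_ball (x := (0 : Eucl n)) (ε := 1)) x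
        (mem_ball_zero_iff.2 hxb)
      exact ⟨r, hr, fun w hw => ⟨ball_subset_closedBall (hr' hw.1), hw.2⟩⟩
    · have h2 := norm_quadGrad_le (p := (-d) • eLast n) norm_eLast
        (by positivity : 0 ≤ δ * K) hδ0.le (x₀ := 0) (x := x) (s := 1) (by simpa using hx1)
      rw [norm_smul_eLast, abs_neg] at h2
      linarith
    · rw [h0] at hlt'
      have : 0 ≤ δ * ‖x‖ ^ 2 := by positivity
      linarith
    · refine hε' _ (hk3 x hx1).1 _ ?_
      rw [mem_ball, dist_eq_norm, quadGrad, real_inner_comm, inner_eLast, sub_zero, h0]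
      have e : -((-d) • eLast n + (2 * (δ * K) * 0) • eLast n - (2 * δ) • x) - d • eLast n =
          (2 * δ) • x := by module
      rw [e, norm_smul, Real.norm_of_nonneg (by positivity)]
      nlinarith

end

section

variable {L : ℝ≥0} {u W : Eucl n → ℝ} {z₀ : Eucl n} {half : Prop}
  {F : Eucl n → ℝ → Eucl n → Eucl n} {F₀ : Eucl n → ℝ → Eucl n → ℝ} {d : ℝ}

/-- If the conormal flux of `d • e_{n+1}` is nonnegative at `z₀`, then increasing the slope by `δ`
makes it positive near `z₀`, with a margin proportional to `δ`. -/
lemma exists_flux_pos (hF : ContDiffOn ℝ 1 (uncurryF F) (jetDom n)) (hell : H1 F)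
    (hu : Continuous u) (hz₀ : z₀ ∈ ball (0 : Eucl n) 1) (hu0 : u z₀ = 0)
    (hd : 0 ≤ F z₀ 0 (d • eLast n) (Fin.last n)) :
    ∃ r₀ : ℝ, 0 < r₀ ∧ ∀ δ : ℝ, 0 < δ → δ ≤ 1 → ∃ ε : ℝ, 0 < ε ∧ ∀ X ∈ ball z₀ ε,
      ∀ w : Eucl n, ‖w‖ ≤ r₀ →
      0 < F X (u X) ((d + δ) • eLast n - (2 * δ) • w) (Fin.last n) := by
  obtain ⟨lam, hlam, hmon⟩ := hell (|d| + 3) (by positivity)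
  obtain ⟨ρ, hρ, hρ'⟩ := Metric.nhds_basis_closedBall.mem_iff.1 (isOpen_ball.mem_nhds hz₀)
  obtain ⟨C, hC⟩ := exists_lipschitzOnWith_of_contDiffOn isOpen_jetDom hF
    (K := closedBall z₀ ρ ×ˢ closedBall (0 : ℝ) 1 ×ˢ closedBall (0 : Eucl n) (|d| + 3))
    ((isCompact_closedBall _ _).prod ((isCompact_closedBall _ _).prod (isCompact_closedBall _ _)))
    fun q hq => mem_jetDom (hρ' hq.1) _ _
  set r₀ : ℝ := min 1 (lam / (4 * (C + 1))) with hr₀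
  have hr0 : 0 < r₀ := by positivity
  have hr1 : r₀ ≤ 1 := min_le_left _ _
  have hr2 : r₀ * (4 * (C + 1)) ≤ lam := by
    rw [← le_div_iff₀ (by positivity)]
    exact min_le_right _ _
  refine ⟨r₀, hr0, fun δ hδ hδ1 => ?_⟩
  have hs : 0 < 2 * δ * r₀ := by positivity
  obtain ⟨ε, hε, hε'⟩ := Metric.eventually_nhds_iff_ball.1 (hu.continuousAt.eventually
    (closedBall_mem_nhds (u z₀) (show 0 < min 1 (2 * δ * r₀) by positivity)))
  refine ⟨min ε (min ρ (2 * δ * r₀)), by positivity, fun X hX w hw => ?_⟩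
  have hX1 : dist X z₀ < ε := (mem_ball.1 hX).trans_le (min_le_left _ _)
  have hX2 : dist X z₀ < ρ :=
    (mem_ball.1 hX).trans_le ((min_le_right _ _).trans (min_le_left _ _))
  have hX3 : dist X z₀ < 2 * δ * r₀ :=
    (mem_ball.1 hX).trans_le ((min_le_right _ _).trans (min_le_right _ _))
  have huX : dist (u X) 0 ≤ min 1 (2 * δ * r₀) := by
    rw [← hu0]
    exact hε' X hX1
  have hp1 : ‖(d + δ) • eLast n‖ ≤ |d| + 1 := by
    rw [norm_smul_eLast]
    refine (abs_add_le _ _).trans ?_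
    rw [abs_of_pos hδ]
    linarith
  have hp2 : ‖(2 * δ) • w‖ ≤ 2 * δ * r₀ := by
    rw [norm_smul, Real.norm_of_nonneg (by positivity)]
    exact mul_le_mul_of_nonneg_left hw (by positivity)
  have hp3 : ‖(d + δ) • eLast n - (2 * δ) • w‖ ≤ |d| + 3 := by
    refine (norm_sub_le _ _).trans ?_
    nlinarith
  have h1 := hC.dist_le_mul (X, u X, (d + δ) • eLast n - (2 * δ) • w)
    ⟨hX2.le, huX.trans (min_le_left _ _), mem_closedBall_zero_iff.2 hp3⟩
    (z₀, 0, (d + δ) • eLast n)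
    ⟨mem_closedBall_self hρ.le, mem_closedBall_self zero_le_one,
      mem_closedBall_zero_iff.2 (hp1.trans (by linarith))⟩
  have h2 : dist (X, u X, (d + δ) • eLast n - (2 * δ) • w) (z₀, 0, (d + δ) • eLast n) ≤
      2 * δ * r₀ := by
    rw [Prod.dist_eq, Prod.dist_eq]
    refine max_le hX3.le (max_le (huX.trans (min_le_right _ _)) ?_)
    rw [dist_eq_norm, sub_sub_cancel_left, norm_neg]
    exact hp2
  have h3 := (abs_last_le (uncurryF F (X, u X, (d + δ) • eLast n - (2 * δ) • w) -
    uncurryF F (z₀, 0, (d + δ) • eLast n)))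
  rw [← dist_eq_norm, PiLp.sub_apply] at h3
  have h4 := (abs_le.1 (h3.trans (h1.trans (mul_le_mul_of_nonneg_left h2 C.coe_nonneg)))).1
  have h5 := monotone_of_elliptic hF hmon hz₀ (z := 0) (by rw [abs_zero]; positivity)
    (p := (d + δ) • eLast n) (p' := d • eLast n) (hp1.trans (by linarith))
    (by rw [norm_smul_eLast]; linarith)
  have e : (d + δ) • eLast n - d • eLast n = δ • eLast n := by module
  rw [e, norm_smul_eLast, abs_of_pos hδ, real_inner_smul_right, inner_eLast, PiLp.sub_apply,
    sq, ← mul_assoc, mul_comm, mul_le_mul_iff_right₀ hδ] at h5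
  unfold uncurryF at h4
  dsimp only at h4
  have h6 : 4 * (C * (2 * δ * r₀)) ≤ 2 * (lam * δ) := by nlinarith
  nlinarith

end

section

variable {ι : Type} {l : Filter ι} [l.NeBot] {L : ℝ≥0} {u W : Eucl n → ℝ} {z₀ : Eucl n}
  {y : ι → Eucl n} {t : ι → ℝ} {half : Prop} {P lam Lam : ℝ}
  {F : Eucl n → ℝ → Eucl n → Eucl n} {F₀ : Eucl n → ℝ → Eucl n → ℝ} {σ d : ℝ}

lemma BlowUp.hopf_zero (B : BlowUp u z₀ l y t W) (hu : LipschitzWith L u)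
    (hF : ContDiffOn ℝ 1 (uncurryF F) (jetDom n)) (hell : H1 F)
    (hz₀ : z₀ ∈ ball (0 : Eucl n) 1) (hu0 : u z₀ = 0) (hlam : 0 < lam) (hLam : 0 ≤ Lam)
    (hT : ∀ R c : ℝ, 0 < c → ∀ᶠ k in l,
      Touchable half (FluxPos half F u (y k) (t k)) (resc u (y k) (t k)) R P lam Lam c)
    (hσ : |σ| = 1) (hσh : half → σ = 1) (hP : |d| + 1 ≤ P) (hW0 : W 0 = 0)
    (hW : ∀ x ∈ (upperCl half : Set (Eucl n)), d * x (Fin.last n) ≤ W x)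
    (hW' : ∀ x : Eucl n, 0 < σ * x (Fin.last n) → d * x (Fin.last n) < W x)
    (hflux : half → 0 ≤ F z₀ 0 (d • eLast n) (Fin.last n)) : False := by
  have hWc := (B.lip hu).continuous
  obtain ⟨r₀, hr₀, hflux'⟩ : ∃ r₀ : ℝ, 0 < r₀ ∧ ∀ δ : ℝ, 0 < δ → δ ≤ 1 → ∃ ε : ℝ, 0 < ε ∧
      ∀ X ∈ ball z₀ ε, ∀ w : Eucl n, ‖w‖ ≤ r₀ → half →
      0 < F X (u X) ((d + δ) • eLast n - (2 * δ) • w) (Fin.last n) := by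
    by_cases hh : half
    · obtain ⟨r₀, h1, h2⟩ := exists_flux_pos hF hell hu.continuous hz₀ hu0 (hflux hh)
      refine ⟨r₀, h1, fun δ h3 h4 => ?_⟩
      obtain ⟨ε, h5, h6⟩ := h2 δ h3 h4
      exact ⟨ε, h5, fun X hX w hw _ => h6 X hX w hw⟩
    · exact ⟨1, one_pos, fun δ _ _ => ⟨1, one_pos, fun X _ w _ h => absurd h hh⟩⟩
  set K : ℝ := (Lam + 1) / lam with hK
  have hK0 : 0 < K := by positivity
  have hlamK : lam * K = Lam + 1 := by
    rw [hK]
    field_simp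
  obtain ⟨s, hs, hs1, hsK, hsr⟩ : ∃ s : ℝ, 0 < s ∧ s ≤ 1 ∧ K * s ≤ 1 / 2 ∧ s ≤ r₀ := by
    refine ⟨min 1 (min (1 / 2 / K) r₀), by positivity, min_le_left _ _, ?_,
      (min_le_right _ _).trans (min_le_right _ _)⟩
    rw [← le_div_iff₀' hK0]
    exact (min_le_right _ _).trans (min_le_left _ _)
  set β : Eucl n → ℝ := fun x =>
    σ * x (Fin.last n) + K * x (Fin.last n) ^ 2 - ‖x‖ ^ 2 with hβ
  have hlc := continuous_last (n := n)
  have hβc : Continuous β := by fun_prop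
  have hx2 : ∀ x ∈ sphere (0 : Eucl n) s, |x (Fin.last n)| ≤ s ∧
      K * x (Fin.last n) ^ 2 ≤ |x (Fin.last n)| / 2 := fun x hx => by
    have h1 := abs_last_le x
    rw [mem_sphere_zero_iff_norm.1 hx] at h1
    refine ⟨h1, ?_⟩
    rw [← sq_abs]
    have h2 := (mul_le_mul_of_nonneg_left h1 hK0.le).trans hsK
    nlinarith [abs_nonneg (x (Fin.last n))]
  have habs : ∀ x : Eucl n, |σ * x (Fin.last n)| = |x (Fin.last n)| := fun x => by
    rw [abs_mul, hσ, one_mul]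
  have hpos : ∀ x ∈ sphere (0 : Eucl n) s, 0 ≤ β x → d * x (Fin.last n) < W x :=
      fun x hx hβx => by
    refine hW' x ?_
    by_contra! hcon
    have h1 := (hx2 x hx).2
    rw [← habs, abs_of_nonpos hcon] at h1
    simp only [hβ] at hβx
    rw [mem_sphere_zero_iff_norm.1 hx] at hβx
    nlinarith
  obtain ⟨τ, hτ, hτ'⟩ := ((isCompact_sphere (0 : Eucl n) s).inter_right
    (isClosed_le continuous_const hβc)).exists_pos_le
    (f := fun x => W x - d * x (Fin.last n))
    (hWc.sub (continuous_const.mul continuous_last)).continuousOn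
    fun x hx => sub_pos.2 (hpos x hx.1 hx.2)
  set δ : ℝ := min (τ / 4) (1 / (1 + 2 * (K + 1))) with hδ
  have hδ0 : 0 < δ := by positivity
  have hδ1 : δ * (1 + 2 * (K + 1)) ≤ 1 := by
    rw [← le_div_iff₀ (by positivity)]
    exact min_le_right _ _
  have hδ2 : δ ≤ 1 := by nlinarith
  obtain ⟨ε, hε, hε'⟩ := hflux' δ hδ0 hδ2
  have hquad : ∀ x : Eucl n, quad (W 0) ((d + δ * σ) • eLast n) (eLast n) (δ * K) δ 0 x =
      d * x (Fin.last n) + δ * β x := fun x => by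
    rw [quad, hW0, inner_smul_eLast, real_inner_comm, inner_eLast, sub_zero]
    ring
  refine B.limit_barrier hu hT (p := (d + δ * σ) • eLast n) (x₀ := 0) (s := s) norm_eLast
    (by positivity : 0 ≤ δ * K) hδ0.le ?_ (fun hh => by simp) hs
    (fun x hx hxu => ?_) (fun x hx => ?_) ?_
  · have : lam * (δ * K) = δ * (Lam + 1) := by rw [← hlamK]; ring
    rw [this]
    nlinarith
  · rw [hquad]
    by_cases h : 0 ≤ β x
    · have h1 := hτ' x ⟨hx, h⟩
      have h2 := hx2 x hx
      have h3 : β x ≤ 2 := by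
        have h4 := le_abs_self (σ * x (Fin.last n))
        rw [habs] at h4
        simp only [hβ]
        nlinarith [sq_nonneg ‖x‖]
      have h4 : δ ≤ τ / 4 := min_le_left _ _
      nlinarith
    · have h1 := hW x hxu
      nlinarith
  · have h1 := norm_quadGrad_le (p := (d + δ * σ) • eLast n) norm_eLast
      (by positivity : 0 ≤ δ * K) hδ0.le (x := x) (x₀ := 0) (s := 1)
      (by rw [mem_closedBall, dist_eq_norm] at hx; linarith)
    have h2 := abs_add_le d (δ * σ)
    rw [abs_mul, hσ, abs_of_pos hδ0] at h2
    rw [norm_smul_eLast] at h1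
    linarith
  · filter_upwards [B.eventually_mem_ball hz₀ s hε] with k hk x hx hh h0
    have hxs : ‖x‖ ≤ s := mem_closedBall_zero_iff.1 hx
    have h1 := hε' _ (hk x hxs).1 x (hxs.trans hsr) hh
    rw [quadGrad, real_inner_comm, inner_eLast, sub_zero, h0, hσh hh]
    simpa using h1

/-- Blow-ups lying above the one-sided slopes and vanishing at the origin are linear. -/
lemma BlowUp.eq_linear (B : BlowUp u z₀ l y t W) (hu : LipschitzWith L u)
    (hF : ContDiffOn ℝ 1 (uncurryF F) (jetDom n)) (hell : H1 F)
    (hz₀ : z₀ ∈ ball (0 : Eucl n) 1) (hu0 : u z₀ = 0) (hlam : 0 < lam) (hLam : 0 ≤ Lam)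
    (hT : ∀ R c : ℝ, 0 < c → ∀ᶠ k in l,
      Touchable half (FluxPos half F u (y k) (t k)) (resc u (y k) (t k)) R P lam Lam c)
    (hP : |d| + 1 ≤ P) (hW0 : W 0 = 0)
    (hpos : ∀ μ < d, SlopeBelow u z₀ 1 μ) (hneg : ¬half → ∀ μ < -d, SlopeBelow u z₀ (-1) μ)
    (hflux : half → 0 ≤ F z₀ 0 (d • eLast n) (Fin.last n)) :
    ∀ x ∈ (upperCl half : Set (Eucl n)), W x = d * x (Fin.last n) := by
  have hWc := (B.lip hu).continuous
  have hW1 : ∀ x : Eucl n, 0 ≤ x (Fin.last n) → d * x (Fin.last n) ≤ W x := fun x hx => by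
    have := B.slope_le hz₀ hpos x (by linarith)
    linarith
  have hW2 : ¬half → ∀ x : Eucl n, x (Fin.last n) ≤ 0 → d * x (Fin.last n) ≤ W x :=
      fun hh x hx => by
    have := B.slope_le hz₀ (hneg hh) x (by linarith)
    linarith
  have hW : ∀ x ∈ (upperCl half : Set (Eucl n)), d * x (Fin.last n) ≤ W x := fun x hx => by
    by_cases hh : half
    · exact hW1 x (hx hh)
    · exact (le_total 0 (x (Fin.last n))).elim (hW1 x) (hW2 hh x)
  have key : ∀ σ : ℝ, |σ| = 1 → (half → σ = 1) →
      (∀ x : Eucl n, 0 < σ * x (Fin.last n) → d * x (Fin.last n) ≤ W x) →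
      ∀ x : Eucl n, 0 ≤ σ * x (Fin.last n) → W x = d * x (Fin.last n) := by
    intro σ hσ hσh hWσ
    have hσσ : σ * σ = 1 := by rw [← abs_mul_abs_self, hσ, one_mul]
    have e : ∀ a : ℝ, d * σ * (σ * a) = d * a := fun a => by
      rw [mul_assoc, ← mul_assoc σ, hσσ, one_mul]
    refine eq_of_eq_side hWc (continuous_const.mul continuous_last) hσ fun x hx => ?_
    by_contra hne
    refine B.hopf_zero hu hF hell hz₀ hu0 hlam hLam hT hσ hσh hP hW0 hW (fun x' hx' => ?_) hflux
    have := B.strong_min hu hlam hLam hT hσ hσh (m := d * σ) (by rwa [abs_mul, hσ, mul_one])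
      (fun z hz => by rw [e]; exact hWσ z hz) hx
      (by rw [e]; exact lt_of_le_of_ne (hWσ x hx) (Ne.symm hne)) x' hx'
    rwa [e] at this
  intro x hx
  by_cases h : 0 ≤ x (Fin.last n)
  · exact key 1 abs_one (fun _ => rfl) (fun z hz => hW1 z (by linarith)) x (by linarith)
  · have hh : ¬half := fun hh => h (hx hh)
    exact key (-1) (by simp) (fun h => absurd h hh) (fun z hz => hW2 hh z (by linarith)) x
      (by linarith)

end

section

variable {L : ℝ≥0} {u : Eucl n → ℝ} {z₀ : Eucl n} {half : Prop}
  {F : Eucl n → ℝ → Eucl n → Eucl n} {F₀ : Eucl n → ℝ → Eucl n → ℝ}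

lemma WeakSol.exists_normal_derivative (S : WeakSol half F F₀ u L)
    (hF : ContDiffOn ℝ 1 (uncurryF F) (jetDom n))
    (hF₀ : ContDiffOn ℝ 1 (uncurryF₀ F₀) (jetDom n)) (hell : H1 F) (hz₀ : z₀ ∈ freeBoundary u) :
    ∃ d : ℝ, Tendsto (fun s => resc u z₀ s (eLast n)) (𝓝[>] 0) (𝓝 d) ∧
      (∀ μ < d, SlopeBelow u z₀ 1 μ) ∧ (¬half → ∀ μ < -d, SlopeBelow u z₀ (-1) μ) ∧
      (half → 0 ≤ F z₀ 0 (d • eLast n) (Fin.last n)) := by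
  have hzt := hz₀.1.1
  have hu0 : u z₀ = 0 := hz₀.1.2
  obtain ⟨d, hd, hlim⟩ := S.exists_slope hF hF₀ hell hzt hu0 abs_one fun _ => rfl
  simp only [one_mul] at hlim
  refine ⟨d, ?_, hd, fun hh μ hμ => ?_, fun hh => ?_⟩
  · have e : (eLast n) (Fin.last n) = 1 := by simp [eLast]
    have := hlim (eLast n) (by rw [e]; exact zero_le_one)
    rwa [e, mul_one] at this
  · obtain ⟨m, hm, hlim'⟩ := S.exists_slope hF hF₀ hell hzt hu0 (σ := -1) (by simp)
      fun h => absurd h hh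
    refine hm μ ?_
    by_contra! hcon
    classical
    refine S.not_below_linear hF hF₀ hell hz₀ (d := (d - m) / 2) (c := (-m - d) / 2)
      (ℓ := fun x => if 0 ≤ x (Fin.last n) then d * x (Fin.last n) else m * (-1 * x (Fin.last n)))
      (by linarith) (fun x _ => ?_) (fun x _ => ?_) fun h => absurd h hh
    · split_ifs with h
      · exact hlim x h
      · exact hlim' x (by linarith)
    · dsimp only
      split_ifs with h
      · rw [abs_of_nonneg h]
        linarith
      · rw [abs_of_neg (not_le.1 h)]
        linarith
  · by_contra! hcon
    have h1 : ContinuousAt (fun p : Eucl n => uncurryF F (z₀, 0, p)) (d • eLast n) := by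
      refine ContinuousAt.comp (f := fun p : Eucl n => (z₀, (0 : ℝ), p))
        (hF.contDiffAt (isOpen_jetDom.mem_nhds (mem_jetDom hzt.1 _ _))).continuousAt ?_
      fun_prop
    have h2 : ContinuousAt (fun a : ℝ => F z₀ 0 (a • eLast n) (Fin.last n)) d :=
      continuous_last.continuousAt.comp (ContinuousAt.comp (f := fun a : ℝ => a • eLast n) (x := d)
        h1 (by fun_prop))
    obtain ⟨d', h3, h4⟩ := (((h2.eventually (eventually_lt_nhds hcon)).filter_mono
      nhdsWithin_le_nhds).and (self_mem_nhdsWithin (s := Set.Ioi d))).exists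
    have h4 : d < d' := h4
    refine S.not_below_linear hF hF₀ hell hz₀ (d := d') (c := d' - d)
      (ℓ := fun x => d * x (Fin.last n)) (by linarith) (fun x hx => hlim x (hx hh))
      (fun x hx => ?_) fun _ => h3
    rw [abs_of_nonneg (hx hh)]
    linarith

/-- Uniform convergence of the blow-ups at contact points to the linear function given by the
normal derivative. -/
lemma WeakSol.tendstoUniformlyOn_resc (S : WeakSol half F F₀ u L)
    (hF : ContDiffOn ℝ 1 (uncurryF F) (jetDom n))
    (hF₀ : ContDiffOn ℝ 1 (uncurryF₀ F₀) (jetDom n)) (hell : H1 F)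
    (hz₀ : z₀ ∈ ball (0 : Eucl n) 1) (hu0 : u z₀ = 0) {d : ℝ}
    (hpos : ∀ μ < d, SlopeBelow u z₀ 1 μ) (hneg : ¬half → ∀ μ < -d, SlopeBelow u z₀ (-1) μ)
    (hflux : half → 0 ≤ F z₀ 0 (d • eLast n) (Fin.last n)) {z : ℕ → Eucl n} {t : ℕ → ℝ}
    (hz : ∀ k, z k (Fin.last n) = 0) (hzu : ∀ k, u (z k) = 0) (hzlim : Tendsto z atTop (𝓝 z₀))
    (ht : ∀ k, 0 < t k) (htlim : Tendsto t atTop (𝓝 0)) {Q : Set (Eucl n)} (hQ : IsCompact Q)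
    (hQu : Q ⊆ upperCl half) :
    TendstoUniformlyOn (fun k x => resc u (z k) (t k) x) (fun x => d * x (Fin.last n)) atTop Q := by
  obtain ⟨lam, Lam, hlam, hLam, hT⟩ := S.touchable hF hF₀ hell hz₀ (|d| + 1)
  rw [Metric.tendstoUniformlyOn_iff]
  intro ε hε
  refine mem_iff_ultrafilter.2 fun l hl => ?_
  have h0 : ∀ k, resc u (z k) (t k) 0 = 0 := fun k => by simp [resc, hzu]
  obtain ⟨W, hW⟩ := exists_lim_of_lipschitz l (fun k => lipschitzWith_resc S.lip (z k) (t k))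
    (C := 0) (Eventually.of_forall fun k => by rw [h0, abs_zero])
  have B : BlowUp u z₀ l z t W :=
    ⟨hz, Eventually.of_forall ht, hzlim.mono_left hl, htlim.mono_left hl, hW⟩
  have hW0 : W 0 = 0 := tendsto_nhds_unique (hW 0) (by simp [h0])
  have hWd := B.eq_linear S.lip hF hell hz₀ hu0 hlam hLam (hT l z t W B) le_rfl hW0 hpos hneg hflux
  filter_upwards [B.uniform S.lip hQ hε] with k hk x hx
  rw [dist_comm, Real.dist_eq, ← hWd x (hQu hx)]
  exact hk x hx

end

section

variable {L : ℝ≥0} {u v : Eucl n → ℝ} {z₀ : Eucl n} {half : Prop}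
  {F : Eucl n → ℝ → Eucl n → Eucl n} {F₀ : Eucl n → ℝ → Eucl n → ℝ}

lemma freeBoundary_subset (h : ∀ x ∈ tBall (0 : Eucl n) 1, v x = u x) :
    freeBoundary u ⊆ freeBoundary v := by
  rintro x ⟨⟨hx, hux⟩, hr⟩
  refine ⟨⟨hx, by rw [h x hx, hux]⟩, fun r hr0 => ?_⟩
  obtain ⟨y, hy, hyr, hyu⟩ := hr r hr0
  exact ⟨y, hy, hyr, by rwa [h y hy]⟩

lemma weakSol_of_variational (hv : LipschitzWith L v)
    (heq : ∀ x ∈ closedBall (0 : Eucl n) 1, x ∈ (upperCl half : Set (Eucl n)) → v x = u x)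
    (hnn : ∀ x ∈ tBall (0 : Eucl n) 1, 0 ≤ v x)
    (h : ∀ w : Eucl n → ℝ, (∃ C : ℝ≥0, LipschitzWith C w) → (∀ x : Eucl n, ‖x‖ = 1 → w x = v x) →
      (∀ x ∈ tBall (0 : Eucl n) 1, 0 ≤ w x) →
      0 ≤ ∫ x in upper half ∩ ball (0 : Eucl n) 1,
        (⟪F x (u x) (gradient u x), gradient w x - gradient u x⟫_ℝ +
          F₀ x (u x) (gradient u x) * (w x - u x))) : WeakSol half F F₀ v L := by
  refine ⟨hv, hnn, fun ψ hψ hsupp hnn' => ?_⟩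
  obtain ⟨C, hC⟩ := hψ
  obtain ⟨ρ, hρ, hsupp⟩ := hsupp
  refine (h (fun x => v x + ψ x) ⟨L + C, hv.add hC⟩ (fun x hx => ?_) hnn').trans_eq ?_
  · rw [hsupp x (fun h => ?_), add_zero]
    rw [mem_ball_zero_iff, hx] at h
    linarith
  · have ho : IsOpen (upper half ∩ ball (0 : Eucl n) 1) := (isOpen_upper' half).inter isOpen_ball
    refine setIntegral_congr_ae ho.measurableSet ?_
    filter_upwards [hv.ae_differentiableAt (μ := volume), hC.ae_differentiableAt (μ := volume)]
      with x h1 h2 hx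
    have he : v =ᶠ[𝓝 x] u := (ho.eventually_mem hx).mono fun y hy =>
      heq y (ball_subset_closedBall hy.2) (upper_subset_upperCl half hy.1)
    have hg : gradient u x = gradient v x := by rw [gradient, gradient, he.fderiv_eq]
    rw [hg, ← he.eq_of_nhds, gradient_add_apply h1 h2, add_sub_cancel_left, add_sub_cancel_left]

lemma ThinSolution.exists_weakSol {g : Eucl n → ℝ} (hu : ThinSolution F F₀ g u) :
    ∃ (v : Eucl n → ℝ) (L : ℝ≥0), WeakSol False F F₀ v L ∧
      ∀ x ∈ closedBall (0 : Eucl n) 1, x ∈ (upperCl False : Set (Eucl n)) → v x = u x := by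
  obtain ⟨⟨⟨L, hL⟩, hg, hnn⟩, hvi⟩ := hu
  obtain ⟨v, hv, he⟩ := hL.extend_real
  have heq : ∀ x ∈ closedBall (0 : Eucl n) 1, v x = u x := fun x hx => (he hx).symm
  refine ⟨v, L, weakSol_of_variational hv (fun x hx _ => heq x hx) (fun x hx => ?_)
    fun w hw hwg hwn => ?_, fun x hx _ => heq x hx⟩
  · rw [heq x (ball_subset_closedBall hx.1)]
    exact hnn x hx
  · obtain ⟨C, hC⟩ := hw
    have e : (upper False : Set (Eucl n)) ∩ ball 0 1 = ball 0 1 := by simp [upper]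
    rw [e]
    refine hvi w ⟨⟨C, hC.lipschitzOnWith⟩, fun x hx => ?_, hwn⟩
    rw [hwg x (mem_sphere_zero_iff_norm.1 hx), heq x (sphere_subset_closedBall hx), hg x hx]

lemma BdrySolution.exists_weakSol {g : Eucl n → ℝ} (hu : BdrySolution F F₀ g u) :
    ∃ (v : Eucl n → ℝ) (L : ℝ≥0), WeakSol True F F₀ v L ∧
      ∀ x ∈ closedBall (0 : Eucl n) 1, x ∈ (upperCl True : Set (Eucl n)) → v x = u x := by
  obtain ⟨⟨⟨L, hL⟩, hg, hnn⟩, hvi⟩ := hu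
  obtain ⟨v, hv, he⟩ := hL.extend_real
  have heq : ∀ x ∈ closedBall (0 : Eucl n) 1, 0 ≤ x (Fin.last n) → v x = u x :=
    fun x hx hx' => (he ⟨hx, hx'⟩).symm
  refine ⟨v, L, weakSol_of_variational hv (fun x hx hx' => heq x hx (hx' trivial)) (fun x hx => ?_)
    fun w hw hwg hwn => ?_, fun x hx hx' => heq x hx (hx' trivial)⟩
  · have h0 : x (Fin.last n) = 0 := hx.2
    rw [heq x (ball_subset_closedBall hx.1) h0.ge]
    exact hnn x hx
  · obtain ⟨C, hC⟩ := hw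
    have e : (upper True : Set (Eucl n)) ∩ ball 0 1 = hBall 0 1 := by
      simp [upper, hBall, Set.inter_comm]
    rw [e]
    refine hvi w ⟨⟨C, hC.lipschitzOnWith⟩, fun x hx hx' => ?_, hwn⟩
    rw [hwg x hx, heq x (mem_closedBall_zero_iff.2 hx.le) hx', hg x hx hx']

lemma WeakSol.rescalings_converge (S : WeakSol half F F₀ v L) (hF : H0 F F₀) (hell : H1 F)
    (heq : ∀ x ∈ closedBall (0 : Eucl n) 1, x ∈ (upperCl half : Set (Eucl n)) → v x = u x)
    {D : Set (Eucl n)} (hD : D ⊆ closedBall 0 1 ∩ upperCl half) (hz₀ : z₀ ∈ freeBoundary u)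
    {z : ℕ → Eucl n} (hz : ∀ k, z k ∈ freeBoundary u) (hzlim : Tendsto z atTop (𝓝 z₀))
    {t : ℕ → ℝ} (ht : ∀ k, 0 < t k ∧ t k < 1 - ‖z k‖) (htlim : Tendsto t atTop (𝓝 0)) :
    ∃ d : ℝ, Tendsto (fun s : ℝ => u (z₀ + s • eLast n) / s) (𝓝[>] 0) (𝓝 d) ∧
      TendstoUniformlyOn (fun k x => u (z k + t k • x) / t k)
        (fun x => d * x (Fin.last n)) atTop D := by
  have hthin : ∀ x ∈ tBall (0 : Eucl n) 1, v x = u x := fun x hx => by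
    have h0 : x (Fin.last n) = 0 := hx.2
    exact heq x (ball_subset_closedBall hx.1) fun _ => h0.ge
  have hz₀' := freeBoundary_subset hthin hz₀
  obtain ⟨d, hd, h1, h2, h3⟩ := S.exists_normal_derivative hF.1 hF.2 hell hz₀'
  have h0 : ∀ y ∈ freeBoundary u, y (Fin.last n) = 0 := fun y hy => hy.1.1.2
  refine ⟨d, hd.congr' ?_, ?_⟩
  · have hc : Continuous fun s : ℝ => z₀ + s • eLast n := by fun_prop
    have hb : ∀ᶠ s in 𝓝 (0 : ℝ), z₀ + s • eLast n ∈ ball (0 : Eucl n) 1 :=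
      hc.continuousAt.eventually (isOpen_ball.mem_nhds (by simpa using hz₀.1.1.1))
    filter_upwards [hb.filter_mono nhdsWithin_le_nhds, self_mem_nhdsWithin] with s hs hs0
    rw [resc, heq _ (ball_subset_closedBall hs) fun _ => ?_]
    have hs0 : 0 < s := hs0
    simpa [h0 z₀ hz₀, eLast] using hs0.le
  · have h4 := S.tendstoUniformlyOn_resc hF.1 hF.2 hell hz₀.1.1.1 hz₀'.1.2 h1 h2 h3
      (fun k => h0 _ (hz k)) (fun k => (freeBoundary_subset hthin (hz k)).1.2) hzlim
      (fun k => (ht k).1) htlim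
      ((isCompact_closedBall (0 : Eucl n) 1).inter_right (isClosed_upperCl half))
      Set.inter_subset_right
    refine (h4.mono hD).congr (Eventually.of_forall fun k x hx => ?_)
    have hx1 : ‖x‖ ≤ 1 := mem_closedBall_zero_iff.1 (hD hx).1
    have htk := (ht k).1
    dsimp only
    rw [resc, heq _ (mem_closedBall_zero_iff.2 ?_) fun hh => ?_]
    · refine (norm_add_le _ _).trans ?_
      rw [norm_smul, Real.norm_of_nonneg htk.le]
      have := (ht k).2
      nlinarith
    · have h5 : 0 ≤ x (Fin.last n) := (hD hx).2 hh
      simpa [h0 _ (hz k)] using mul_nonneg htk.le h5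

end

end TOP

open TOP in
/-- Proposition: convergence of rescalings along free boundary
points. For a Lipschitz solution of either the thin obstacle problem (`D = B₁`) or
the boundary obstacle problem (`D = B₁⁺`), if `z_k ∈ Γ(u)`, `z_k → z₀ ∈ Γ(u)`,
`0 < t_k < 1 − |z_k|`, `t_k → 0`, then `u(z_k + t_k x)/t_k → ∂_{n+1}u(z₀) x_{n+1}`
uniformly on `D`, where the normal derivative `∂_{n+1}u(z₀)` exists. -/
theorem rescalings_converge_to_normal_derivative {n : ℕ}
    (F : Eucl n → ℝ → Eucl n → Eucl n) (F₀ : Eucl n → ℝ → Eucl n → ℝ)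
    (g u : Eucl n → ℝ) (D : Set (Eucl n))
    (hF : H0 F F₀) (hell : H1 F)
    (hcase :
      (ThinSolution F F₀ g u ∧ D = Metric.ball (0 : Eucl n) 1) ∨
      (BdrySolution F F₀ g u ∧ D = hBall (0 : Eucl n) 1))
    (z₀ : Eucl n) (hz₀ : z₀ ∈ freeBoundary u)
    (z : ℕ → Eucl n) (hz : ∀ k, z k ∈ freeBoundary u)
    (hzlim : Filter.Tendsto z Filter.atTop (nhds z₀))
    (t : ℕ → ℝ) (ht : ∀ k, 0 < t k ∧ t k < 1 - ‖z k‖)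
    (htlim : Filter.Tendsto t Filter.atTop (nhds 0)) :
    ∃ d : ℝ,
      Filter.Tendsto (fun s : ℝ => u (z₀ + s • eLast n) / s) (𝓝[>] (0 : ℝ)) (nhds d) ∧
      TendstoUniformlyOn (fun (k : ℕ) (x : Eucl n) => u (z k + t k • x) / t k)
        (fun x : Eucl n => d * x (Fin.last n)) Filter.atTop D := by
  rcases hcase with ⟨hu, rfl⟩ | ⟨hu, rfl⟩
  · obtain ⟨v, L, S, heq⟩ := hu.exists_weakSol
    exact S.rescalings_converge hF hell heq
      (fun x hx => ⟨ball_subset_closedBall hx, False.elim⟩) hz₀ hz hzlim ht htlim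
  · obtain ⟨v, L, S, heq⟩ := hu.exists_weakSol
    exact S.rescalings_converge hF hell heq
      (fun x hx => ⟨ball_subset_closedBall hx.1, fun _ => hx.2.le⟩) hz₀ hz hzlim ht htlim
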